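/- Let (u_{p_n}) be least energy solutions of the Finsler Lane-Emden problem with p_n → ∞, and set v_n = u_{p_n}/(∫_Ω u_{p_n}^{p_n} dx)^{1/(N-1)}. Then there exists a subsequence (still denoted v_n) such that the blow-up set S of this subsequence satisfies #(S ∩ Ω) ≤ ⌊e^{(N-1)/N}/d_N⌋, where ⌊·⌋ is the floor function; in particular S ∩ Ω is a finite set. -/

import Mathlib

open MeasureTheory Filter Real Set
open scoped RealInnerProductSpace Topology NNReal

noncomputable section

abbrev Euc (N : ℕ) := EuclideanSpace ℝ (Fin N)

/-- `H` is a norm on `ℝ^N`: convex, nonnegative, vanishing exactly at `0`,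
and absolutely homogeneous. -/
def IsFinslerNorm (N : ℕ) (H : Euc N → ℝ) : Prop :=
  ConvexOn ℝ Set.univ H ∧
  (∀ ξ, 0 ≤ H ξ) ∧
  (∀ ξ, H ξ = 0 ↔ ξ = 0) ∧
  (∀ (t : ℝ) (ξ : Euc N), H (t • ξ) = |t| * H ξ)

/-- Regularity assumptions: `H ∈ C²(ℝ^N \ {0})`, `H^N ∈ C¹(ℝ^N)`, and the Hessian of
`H^N` is positive definite away from the origin. -/
def FinslerRegular (N : ℕ) (H : Euc N → ℝ) : Prop :=
  ContDiffOn ℝ 2 H {(0 : Euc N)}ᶜ ∧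
  ContDiff ℝ 1 (fun ξ => H ξ ^ N) ∧
  ∀ ξ : Euc N, ξ ≠ 0 → ∀ v : Euc N, v ≠ 0 →
    0 < iteratedFDeriv ℝ 2 (fun ξ => H ξ ^ N) ξ ![v, v]

/-- The dual norm `H⁰(x) = sup_{ξ ≠ 0} ⟪x, ξ⟫ / H(ξ)`. -/
def dualNorm {N : ℕ} (H : Euc N → ℝ) (x : Euc N) : ℝ :=
  sSup {r : ℝ | ∃ ξ : Euc N, ξ ≠ 0 ∧ r = ⟪x, ξ⟫ / H ξ}

/-- `κ_N`, the volume of the Wulff ball `{H⁰ < 1}`. -/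
def wulffVol (N : ℕ) (H : Euc N → ℝ) : ℝ :=
  (volume {x : Euc N | dualNorm H x < 1}).toReal

/-- `β_N = N (N κ_N)^{1/(N-1)}`. -/
def betaN (N : ℕ) (H : Euc N → ℝ) : ℝ :=
  N * (N * wulffVol N H) ^ ((1 : ℝ) / ((N : ℝ) - 1))

/-- `u` is a weak solution of `-Q_N u = g` on the open set `U`:
`∫_U H(∇u)^{N-1} ⟪∇H(∇u), ∇φ⟫ = ∫_U g φ` for all test functions `φ`. -/
def IsWeakSolution (N : ℕ) (H : Euc N → ℝ) (U : Set (Euc N)) (u g : Euc N → ℝ) : Prop :=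
  ∀ φ : Euc N → ℝ, ContDiff ℝ (⊤ : ℕ∞) φ → HasCompactSupport φ → tsupport φ ⊆ U →
    (∫ x in U, H (gradient u x) ^ (N - 1) * ⟪gradient H (gradient u x), gradient φ x⟫)
      = ∫ x in U, g x * φ x

/-- `C_p`, the infimum of `∫_Ω H(∇u)^N` over test functions normalized in `L^{p+1}`. -/
def energyInf (N : ℕ) (H : Euc N → ℝ) (Ω : Set (Euc N)) (p : ℝ) : ℝ :=
  sInf {c : ℝ | ∃ u : Euc N → ℝ, ContDiff ℝ (⊤ : ℕ∞) u ∧ HasCompactSupport u ∧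
    tsupport u ⊆ Ω ∧ (∫ x in Ω, |u x| ^ (p + 1)) = 1 ∧
    c = ∫ x in Ω, H (gradient u x) ^ N}

/-- A least energy solution of the Finsler Lane–Emden problem on `Ω` with exponent `p`. -/
def IsLeastEnergySolution (N : ℕ) (H : Euc N → ℝ) (Ω : Set (Euc N)) (p : ℝ)
    (u : Euc N → ℝ) : Prop :=
  ContDiffOn ℝ 1 u (closure Ω) ∧
  (∀ x ∈ Ω, 0 < u x) ∧
  (∀ x ∈ frontier Ω, u x = 0) ∧
  IsWeakSolution N H Ω u (fun x => u x ^ p) ∧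
  (∫ x in Ω, H (gradient u x) ^ N)
    = energyInf N H Ω p * (∫ x in Ω, u x ^ (p + 1)) ^ ((N : ℝ) / (p + 1))

/-- The blow-up set of a sequence of functions `v n` on `Ω`. -/
def BlowUpSet {N : ℕ} (Ω : Set (Euc N)) (v : ℕ → Euc N → ℝ) : Set (Euc N) :=
  {x | x ∈ closure Ω ∧ ∃ σ : ℕ → ℕ, StrictMono σ ∧ ∃ xs : ℕ → Euc N,
    (∀ n, xs n ∈ Ω) ∧ Tendsto xs atTop (𝓝 x) ∧
    Tendsto (fun n => v (σ n) (xs n)) atTop atTop}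

/-- The quotient `d(X,Y)` entering the definition of `d_N`. -/
def dQuot (N : ℕ) (H : Euc N → ℝ) (X Y : Euc N) : ℝ :=
  ⟪H X ^ (N - 1) • gradient H X - H Y ^ (N - 1) • gradient H Y, X - Y⟫ / H (X - Y) ^ N

/-- The constant `d_N`. -/
def dConst (N : ℕ) (H : Euc N → ℝ) : ℝ :=
  sInf {r : ℝ | ∃ X Y : Euc N, X ≠ 0 ∧ Y ≠ 0 ∧ X ≠ Y ∧ r = dQuot N H X Y}

/-- The vector field `ξ ↦ H(ξ)^{N-1} ∇H(ξ)` of the Finsler Laplacian. -/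
def finslerField (N : ℕ) (H : Euc N → ℝ) (ξ : Euc N) : Euc N :=
  H ξ ^ (N - 1) • gradient H ξ

namespace IsFinslerNorm

variable {N : ℕ} {H : Euc N → ℝ}

lemma nonneg (h : IsFinslerNorm N H) (ξ : Euc N) : 0 ≤ H ξ := h.2.1 ξ

lemma smul (h : IsFinslerNorm N H) (t : ℝ) (ξ : Euc N) : H (t • ξ) = |t| * H ξ := h.2.2.2 t ξ

lemma map_zero (h : IsFinslerNorm N H) : H 0 = 0 := (h.2.2.1 0).2 rfl

lemma pos (h : IsFinslerNorm N H) {ξ : Euc N} (hξ : ξ ≠ 0) : 0 < H ξ :=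
  lt_of_le_of_ne (h.nonneg ξ) fun h0 => hξ ((h.2.2.1 ξ).1 h0.symm)

lemma map_neg (h : IsFinslerNorm N H) (ξ : Euc N) : H (-ξ) = H ξ := by
  have := h.smul (-1) ξ
  simpa using this

lemma add_le (h : IsFinslerNorm N H) (ξ ζ : Euc N) : H (ξ + ζ) ≤ H ξ + H ζ := by
  have h1 := h.1.2 (mem_univ ξ) (mem_univ ζ) (show (0 : ℝ) ≤ 1 / 2 by norm_num)
    (show (0 : ℝ) ≤ 1 / 2 by norm_num) (by norm_num)
  rw [← smul_add, h.smul] at h1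
  have : |(1 / 2 : ℝ)| = 1 / 2 := abs_of_pos (by norm_num)
  simp only [this, smul_eq_mul] at h1
  linarith

lemma continuous (h : IsFinslerNorm N H) : Continuous H :=
  h.1.locallyLipschitz.continuous

lemma exists_le_norm (h : IsFinslerNorm N H) : ∃ C > 0, ∀ ξ, H ξ ≤ C * ‖ξ‖ := by
  obtain ⟨C, hC⟩ := (isCompact_sphere (0 : Euc N) 1).exists_bound_of_continuousOn
    h.continuous.continuousOn
  refine ⟨max C 1, by positivity, fun ξ => ?_⟩
  by_cases hξ : ξ = 0
  · simp [hξ, h.map_zero]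
  have hn : 0 < ‖ξ‖ := norm_pos_iff.2 hξ
  have h1 := hC (‖ξ‖⁻¹ • ξ) (by simp [norm_smul, hn.ne'])
  rw [h.smul, Real.norm_eq_abs, abs_of_nonneg (by have := h.nonneg ξ; positivity),
    abs_of_pos (by positivity), inv_mul_le_iff₀ hn] at h1
  calc H ξ ≤ ‖ξ‖ * C := h1
    _ ≤ max C 1 * ‖ξ‖ := by rw [mul_comm]; gcongr; exact le_max_left _ _

lemma exists_norm_le (h : IsFinslerNorm N H) : ∃ C > 0, ∀ ξ, ‖ξ‖ ≤ C * H ξ := by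
  obtain ⟨C, hC⟩ := (isCompact_sphere (0 : Euc N) 1).exists_bound_of_continuousOn
    (f := fun ξ => (H ξ)⁻¹) (by
      apply h.continuous.continuousOn.inv₀
      intro x hx
      refine (h.pos ?_).ne'
      rintro rfl
      simp at hx)
  refine ⟨max C 1, by positivity, fun ξ => ?_⟩
  by_cases hξ : ξ = 0
  · simp [hξ, h.map_zero]
  have hn : 0 < ‖ξ‖ := norm_pos_iff.2 hξ
  have hp := h.pos hξ
  have h1 := hC (‖ξ‖⁻¹ • ξ) (by simp [norm_smul, hn.ne'])
  rw [h.smul, Real.norm_eq_abs, abs_of_nonneg (by positivity),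
    abs_of_pos (by positivity), mul_inv, inv_inv, mul_inv_le_iff₀ hp] at h1
  exact h1.trans (by gcongr; exact le_max_left _ _)

lemma differentiableAt (hreg : FinslerRegular N H) {ξ : Euc N}
    (hξ : ξ ≠ 0) : DifferentiableAt ℝ H ξ :=
  (hreg.1.contDiffAt (isOpen_compl_singleton.mem_nhds hξ)).differentiableAt (by norm_num)

lemma inner_gradient_le (h : IsFinslerNorm N H) (ξ ζ : Euc N) :
    ⟪gradient H ξ, ζ⟫ ≤ H ζ := by
  rw [inner_gradient_left]
  by_cases hd : DifferentiableAt ℝ H ξ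
  · have hl : HasDerivAt (fun t : ℝ => H (ξ + t • ζ)) (fderiv ℝ H ξ ζ) 0 := by
      have := hd.hasFDerivAt
      have h2 : HasDerivAt (fun t : ℝ => ξ + t • ζ) ζ 0 := by
        simpa using ((hasDerivAt_id (0 : ℝ)).smul_const ζ).const_add ξ
      have h3 : HasFDerivAt H (fderiv ℝ H ξ) (ξ + (0 : ℝ) • ζ) := by simpa using this
      exact h3.comp_hasDerivAt (0 : ℝ) h2
    have hs := hl.hasDerivWithinAt (s := Ioi 0)
    rw [hasDerivWithinAt_iff_tendsto_slope' (by simp)] at hs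
    refine le_of_tendsto hs ?_
    filter_upwards [self_mem_nhdsWithin] with t ht
    have ht : 0 < t := ht
    rw [slope_def_field]
    simp only [zero_smul, add_zero, sub_zero]
    rw [div_le_iff₀ ht]
    have := h.add_le ξ (t • ζ)
    rw [h.smul, abs_of_pos ht] at this
    linarith
  · rw [fderiv_zero_of_not_differentiableAt hd]
    simpa using h.nonneg ζ

lemma abs_inner_gradient_le (h : IsFinslerNorm N H) (ξ ζ : Euc N) :
    |⟪gradient H ξ, ζ⟫| ≤ H ζ := by
  refine abs_le.2 ⟨?_, h.inner_gradient_le ξ ζ⟩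
  have := h.inner_gradient_le ξ (-ζ)
  rw [inner_neg_right, h.map_neg] at this
  linarith

lemma inner_gradient_self (h : IsFinslerNorm N H) (hreg : FinslerRegular N H) (ξ : Euc N) :
    ⟪gradient H ξ, ξ⟫ = H ξ := by
  by_cases hξ : ξ = 0
  · simp [hξ, h.map_zero]
  rw [inner_gradient_left]
  have h2 : HasDerivAt (fun t : ℝ => t • ξ) ξ 1 := by
    simpa using (hasDerivAt_id (1 : ℝ)).smul_const ξ
  have h3 : HasFDerivAt H (fderiv ℝ H ξ) ((1 : ℝ) • ξ) := by
    simpa using (differentiableAt hreg hξ).hasFDerivAt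
  have h4 := h3.comp_hasDerivAt (1 : ℝ) h2
  have h5 : HasDerivAt (H ∘ fun t : ℝ => t • ξ) (H ξ) 1 := by
    have h6 : HasDerivAt (fun t : ℝ => t * H ξ) (H ξ) 1 := by
      simpa using (hasDerivAt_id (1 : ℝ)).mul_const (H ξ)
    refine h6.congr_of_eventuallyEq ?_
    filter_upwards [lt_mem_nhds (show (0 : ℝ) < 1 by norm_num)] with t ht
    simp [h.smul, abs_of_pos ht]
  exact h4.unique h5

lemma inner_field_self (h : IsFinslerNorm N H) (hreg : FinslerRegular N H) (hN : 2 ≤ N)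
    (ξ : Euc N) : ⟪finslerField N H ξ, ξ⟫ = H ξ ^ N := by
  rw [finslerField, real_inner_smul_left, h.inner_gradient_self hreg, ← pow_succ]
  congr 1; omega

lemma abs_inner_field_le (h : IsFinslerNorm N H) (ξ ζ : Euc N) :
    |⟪finslerField N H ξ, ζ⟫| ≤ H ξ ^ (N - 1) * H ζ := by
  have h0 := h.nonneg ξ
  rw [finslerField, real_inner_smul_left, abs_mul, abs_of_nonneg (by positivity)]
  gcongr
  exact h.abs_inner_gradient_le ξ ζ

lemma continuous_field (h : IsFinslerNorm N H) (hreg : FinslerRegular N H) (hN : 2 ≤ N) :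
    Continuous (finslerField N H) := by
  rw [continuous_iff_continuousAt]
  intro ξ
  by_cases hξ : ξ = 0
  · subst hξ
    obtain ⟨C, -, hC⟩ := h.exists_le_norm
    have hb : ∀ ζ, ‖finslerField N H ζ‖ ≤ H ζ ^ (N - 1) * C := by
      intro ζ
      rw [finslerField, norm_smul, norm_pow, Real.norm_eq_abs, abs_of_nonneg (h.nonneg ζ)]
      have h0 := h.nonneg ζ
      gcongr
      by_cases hg : gradient H ζ = 0
      · rw [hg, norm_zero]
        by_contra! hC0
        have := hC ζ
        by_cases hz : ζ = 0
        · obtain ⟨i⟩ : Nonempty (Fin N) := ⟨⟨0, by omega⟩⟩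
          have h1 := hC (EuclideanSpace.single i 1)
          have h2 := h.nonneg (EuclideanSpace.single i 1)
          simp at h1
          linarith
        · have := norm_pos_iff.2 hz
          nlinarith
      · have h1 := (h.inner_gradient_le ζ (gradient H ζ)).trans (hC _)
        rw [real_inner_self_eq_norm_sq] at h1
        have := norm_pos_iff.2 hg
        nlinarith
    have h0 : finslerField N H 0 = 0 := by
      simp [finslerField, h.map_zero, show N - 1 ≠ 0 by omega]
    rw [ContinuousAt, h0]
    refine squeeze_zero_norm hb ?_
    have : Tendsto (fun ζ => H ζ ^ (N - 1) * C) (𝓝 0) (𝓝 (H 0 ^ (N - 1) * C)) :=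
      ((h.continuous.pow _).mul continuous_const).tendsto 0
    simpa [h.map_zero, show N - 1 ≠ 0 by omega] using this
  · have h1 : ContinuousAt (fderiv ℝ H) ξ :=
      (hreg.1.contDiffAt (isOpen_compl_singleton.mem_nhds hξ)).continuousAt_fderiv (by norm_num)
    have h2 : ContinuousAt (gradient H) ξ :=
      (InnerProductSpace.toDual ℝ (Euc N)).symm.continuous.continuousAt.comp h1
    exact (h.continuous.continuousAt.pow _).smul h2

end IsFinslerNorm

lemma norm_gradient_eq {N : ℕ} (f : Euc N → ℝ) (x : Euc N) :
    ‖gradient f x‖ = ‖fderiv ℝ f x‖ := by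
  simp [gradient]

lemma continuous_gradient {N : ℕ} {f : Euc N → ℝ} (hf : ContDiff ℝ 1 f) :
    Continuous (gradient f) :=
  (InnerProductSpace.toDual ℝ (Euc N)).symm.continuous.comp (hf.continuous_fderiv one_ne_zero)

lemma gradient_eq_zero_of_notMem_tsupport {N : ℕ} {f : Euc N → ℝ} {x : Euc N}
    (hx : x ∉ tsupport f) : gradient f x = 0 := by
  have h1 : f =ᶠ[𝓝 x] fun _ => (0 : ℝ) := notMem_tsupport_iff_eventuallyEq.1 hx
  rw [h1.gradient_eq]
  exact gradient_const (c := (0 : ℝ)) x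

open Convolution in
lemma exists_contDiff_dist_le_fderiv {N : ℕ} {φ : Euc N → ℝ} (hφ : ContDiff ℝ 1 φ)
    (hc : HasCompactSupport φ) {ε : ℝ} (hε : 0 < ε) :
    ∃ ψ : Euc N → ℝ, ContDiff ℝ (⊤ : ℕ∞) ψ ∧
      (∀ a δ, (∀ x ∈ Metric.ball a ε, dist (φ x) (φ a) ≤ δ) → dist (ψ a) (φ a) ≤ δ) ∧
      (∀ a δ, (∀ x ∈ Metric.ball a ε, dist (fderiv ℝ φ x) (fderiv ℝ φ a) ≤ δ) →
        dist (fderiv ℝ ψ a) (fderiv ℝ φ a) ≤ δ) := by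
  set ρ : ContDiffBump (0 : Euc N) := ⟨ε / 2, ε, half_pos hε, half_lt_self hε⟩
  have hli : LocallyIntegrable φ (volume : Measure (Euc N)) := hφ.continuous.locallyIntegrable
  refine ⟨ρ.normed volume ⋆[ContinuousLinearMap.lsmul ℝ ℝ, volume] φ,
    ρ.hasCompactSupport_normed.contDiff_convolution_left _ ρ.contDiff_normed hli,
    fun a δ => ρ.dist_normed_convolution_le hφ.continuous.aestronglyMeasurable,
    fun a δ h => ?_⟩
  have h1 := hc.hasFDerivAt_convolution_right (ContinuousLinearMap.lsmul ℝ ℝ) (μ := volume)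
    (f := ρ.normed volume) ρ.continuous_normed.locallyIntegrable hφ a
  have h2 : (ρ.normed volume ⋆[(ContinuousLinearMap.lsmul ℝ ℝ).precompR (Euc N), volume]
      fderiv ℝ φ) a =
      (ρ.normed volume ⋆[ContinuousLinearMap.lsmul ℝ ℝ, volume] fderiv ℝ φ) a := by
    simp only [convolution_def]
    congr 1
  rw [h1.fderiv, h2]
  exact ρ.dist_normed_convolution_le (hφ.continuous_fderiv one_ne_zero).aestronglyMeasurable h

lemma exists_smooth_approx {N : ℕ} {φ : Euc N → ℝ} (hφ : ContDiff ℝ 1 φ)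
    (hc : HasCompactSupport φ) {U : Set (Euc N)} (hU : IsOpen U) (hs : tsupport φ ⊆ U) :
    ∃ K : Set (Euc N), IsCompact K ∧ K ⊆ U ∧ tsupport φ ⊆ K ∧ ∃ ψ : ℕ → Euc N → ℝ,
      (∀ k, ContDiff ℝ (⊤ : ℕ∞) (ψ k)) ∧ (∀ k, tsupport (ψ k) ⊆ K) ∧
      (∃ C, ∀ k x, |ψ k x| ≤ C ∧ ‖gradient (ψ k) x‖ ≤ C) ∧
      (∀ x, Tendsto (fun k => ψ k x) atTop (𝓝 (φ x))) ∧
      (∀ x, Tendsto (fun k => gradient (ψ k) x) atTop (𝓝 (gradient φ x))) := by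
  obtain ⟨δ, hδ, hδU⟩ := hc.isCompact.exists_cthickening_subset_open hU hs
  have hKc : IsCompact (Metric.cthickening δ (tsupport φ)) := hc.isCompact.cthickening
  have huc := hc.uniformContinuous_of_continuous hφ.continuous
  have hfc : HasCompactSupport (fderiv ℝ φ) := hc.fderiv ℝ
  have huc' := hfc.uniformContinuous_of_continuous (hφ.continuous_fderiv one_ne_zero)
  have key : ∀ k : ℕ, ∃ ψ : Euc N → ℝ, ContDiff ℝ (⊤ : ℕ∞) ψ ∧
      tsupport ψ ⊆ Metric.cthickening δ (tsupport φ) ∧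
      (∀ x, dist (ψ x) (φ x) ≤ 1 / ((k : ℝ) + 1)) ∧
      (∀ x, dist (fderiv ℝ ψ x) (fderiv ℝ φ x) ≤ 1 / ((k : ℝ) + 1)) := by
    intro k
    have hk : 0 < 1 / ((k : ℝ) + 1) := by positivity
    obtain ⟨ε1, hε1, h1⟩ := Metric.uniformContinuous_iff.1 huc _ hk
    obtain ⟨ε2, hε2, h2⟩ := Metric.uniformContinuous_iff.1 huc' _ hk
    obtain ⟨ψ, hψ, ha, hb⟩ := exists_contDiff_dist_le_fderiv hφ hc
      (ε := min δ (min ε1 ε2)) (by positivity)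
    refine ⟨ψ, hψ, ?_, fun x => ha x _ fun y hy => ?_, fun x => hb x _ fun y hy => ?_⟩
    · refine closure_minimal (fun x hx => ?_) Metric.isClosed_cthickening
      by_contra hxn
      apply hx
      have hz : ∀ y ∈ Metric.ball x (min δ (min ε1 ε2)), φ y = 0 := by
        intro y hy
        by_contra hy0
        apply hxn
        refine Metric.mem_cthickening_of_dist_le x y δ _ (subset_tsupport _ hy0) ?_
        rw [Metric.mem_ball, dist_comm] at hy
        exact (hy.trans_le (min_le_left _ _)).le
      have hx0 : φ x = 0 := hz x (Metric.mem_ball_self (by positivity))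
      have := ha x 0 fun y hy => by rw [hz y hy, hx0, dist_self]
      rw [hx0] at this
      exact dist_le_zero.1 this
    · exact (h1 (lt_of_lt_of_le (Metric.mem_ball.1 hy)
        ((min_le_right _ _).trans (min_le_left _ _)))).le
    · exact (h2 (lt_of_lt_of_le (Metric.mem_ball.1 hy)
        ((min_le_right _ _).trans (min_le_right _ _)))).le
  choose ψ h1 h2 h3 h4 using key
  obtain ⟨C1, hC1⟩ := hφ.continuous.bounded_above_of_compact_support hc
  obtain ⟨C2, hC2⟩ := (hφ.continuous_fderiv one_ne_zero).bounded_above_of_compact_support hfc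
  have hone : ∀ k : ℕ, 1 / ((k : ℝ) + 1) ≤ 1 := fun k => by
    rw [div_le_one (by positivity)]; linarith [Nat.cast_nonneg (α := ℝ) k]
  refine ⟨_, hKc, hδU, Metric.self_subset_cthickening _, ψ, h1, h2,
    ⟨max C1 C2 + 1, fun k x => ⟨?_, ?_⟩⟩, fun x => ?_, fun x => ?_⟩
  · have a1 := h3 k x
    have a2 := hC1 x
    rw [Real.dist_eq] at a1
    rw [Real.norm_eq_abs] at a2
    have a3 : |ψ k x| ≤ |ψ k x - φ x| + |φ x| := by simpa using abs_add_le (ψ k x - φ x) (φ x)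
    linarith [le_max_left C1 C2, hone k]
  · rw [norm_gradient_eq]
    have a1 := h4 k x
    have a2 := hC2 x
    rw [dist_eq_norm] at a1
    have a3 : ‖fderiv ℝ (ψ k) x‖ ≤ ‖fderiv ℝ (ψ k) x - fderiv ℝ φ x‖ + ‖fderiv ℝ φ x‖ := by
      simpa using norm_add_le (fderiv ℝ (ψ k) x - fderiv ℝ φ x) (fderiv ℝ φ x)
    linarith [le_max_right C1 C2, hone k]
  · exact tendsto_iff_dist_tendsto_zero.2 (squeeze_zero (fun _ => dist_nonneg) (fun k => h3 k x)
      tendsto_one_div_add_atTop_nhds_zero_nat)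
  · have : Tendsto (fun k => fderiv ℝ (ψ k) x) atTop (𝓝 (fderiv ℝ φ x)) :=
      tendsto_iff_dist_tendsto_zero.2 (squeeze_zero (fun _ => dist_nonneg) (fun k => h4 k x)
        tendsto_one_div_add_atTop_nhds_zero_nat)
    exact ((InnerProductSpace.toDual ℝ (Euc N)).symm.continuous.tendsto _).comp this

lemma continuousOn_gradient {N : ℕ} {f : Euc N → ℝ} {U : Set (Euc N)} (hU : IsOpen U)
    (hf : ContDiffOn ℝ 1 f U) : ContinuousOn (gradient f) U :=
  (InnerProductSpace.toDual ℝ (Euc N)).symm.continuous.comp_continuousOn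
    (hf.continuousOn_fderiv_of_isOpen hU le_rfl)

/-- A function that is `C¹` on an open set and vanishes off a compact subset is a `C¹`
function with compact support. -/
lemma contDiff_of_eq_zero_off_compact {N : ℕ} {φ : Euc N → ℝ} {U K : Set (Euc N)}
    (hU : IsOpen U) (hK : IsCompact K) (hKU : K ⊆ U) (hφ : ContDiffOn ℝ 1 φ U)
    (h0 : ∀ x ∉ K, φ x = 0) :
    ContDiff ℝ 1 φ ∧ HasCompactSupport φ ∧ tsupport φ ⊆ K := by
  have ht : tsupport φ ⊆ K := closure_minimal (fun x hx => by
    by_contra h; exact hx (h0 x h)) hK.isClosed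
  refine ⟨contDiff_iff_contDiffAt.2 fun x => ?_, hK.of_isClosed_subset (isClosed_tsupport _) ht, ht⟩
  by_cases hx : x ∈ U
  · exact hφ.contDiffAt (hU.mem_nhds hx)
  · have h1 : φ =ᶠ[𝓝 x] fun _ => (0 : ℝ) :=
      notMem_tsupport_iff_eventuallyEq.1 fun h => hx (hKU (ht h))
    exact contDiffAt_const.congr_of_eventuallyEq h1

lemma integrableOn_of_eq_zero_off_compact {N : ℕ} {f : Euc N → ℝ} {U K : Set (Euc N)}
    (hK : IsCompact K) (hKU : K ⊆ U) (hf : ContinuousOn f U) (h0 : ∀ x ∉ K, f x = 0) :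
    IntegrableOn f U := by
  have h1 : IntegrableOn f K := (hf.mono hKU).integrableOn_compact hK
  have h2 : Integrable f := by
    rw [← integrableOn_univ]
    exact h1.of_forall_sdiff_eq_zero MeasurableSet.univ fun x hx => h0 x hx.2
  exact h2.integrableOn

lemma tendsto_integral_of_compact {N : ℕ} {F : ℕ → Euc N → ℝ} {f b : Euc N → ℝ}
    {U K : Set (Euc N)} (hU : IsOpen U) (hK : IsCompact K) (hKU : K ⊆ U)
    (hF : ∀ k, ContinuousOn (F k) U) (hb : ContinuousOn b U)
    (h0 : ∀ k, ∀ x ∉ K, F k x = 0) (hbd : ∀ k, ∀ x ∈ K, |F k x| ≤ b x)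
    (hlim : ∀ x ∈ U, Tendsto (fun k => F k x) atTop (𝓝 (f x))) :
    Tendsto (fun k => ∫ x in U, F k x) atTop (𝓝 (∫ x in U, f x)) := by
  refine tendsto_integral_of_dominated_convergence (K.indicator b)
    (fun k => (hF k).aestronglyMeasurable hU.measurableSet) ?_ (fun k => ?_) ?_
  · have h1 : IntegrableOn b K := (hb.mono hKU).integrableOn_compact hK
    exact ((integrable_indicator_iff hK.measurableSet).2 h1).integrableOn
  · refine Eventually.of_forall fun x => ?_
    by_cases hx : x ∈ K
    · simpa [hx] using hbd k x hx
    · simp [hx, h0 k x hx]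
  · exact (ae_restrict_iff' hU.measurableSet).2 (Eventually.of_forall hlim)

/-- The weak formulation extends to `C¹` test functions with compact support. -/
lemma IsWeakSolution.integral_field_eq {N : ℕ} {H : Euc N → ℝ} (hnorm : IsFinslerNorm N H)
    (hreg : FinslerRegular N H) (hN : 2 ≤ N) {U : Set (Euc N)} (hU : IsOpen U)
    {u g : Euc N → ℝ} (hw : IsWeakSolution N H U u g) (hu : ContDiffOn ℝ 1 u U)
    (hg : ContinuousOn g U) {φ : Euc N → ℝ} (hφ : ContDiff ℝ 1 φ) (hc : HasCompactSupport φ)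
    (hs : tsupport φ ⊆ U) :
    ∫ x in U, ⟪finslerField N H (gradient u x), gradient φ x⟫ = ∫ x in U, g x * φ x := by
  obtain ⟨K, hK, hKU, hφK, ψ, h1, h2, ⟨C, hC⟩, h4, h5⟩ := exists_smooth_approx hφ hc hU hs
  have hψc : ∀ k, HasCompactSupport (ψ k) := fun k =>
    hK.of_isClosed_subset (isClosed_tsupport _) (h2 k)
  have hwk : ∀ k, ∫ x in U, ⟪finslerField N H (gradient u x), gradient (ψ k) x⟫
      = ∫ x in U, g x * ψ k x := by
    intro k
    rw [← hw (ψ k) (h1 k) (hψc k) ((h2 k).trans hKU)]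
    simp [finslerField]
  have hfc : ContinuousOn (fun x => finslerField N H (gradient u x)) U :=
    (hnorm.continuous_field hreg hN).comp_continuousOn (continuousOn_gradient hU hu)
  have hψ1 : ∀ k, ContDiff ℝ 1 (ψ k) := fun k => (h1 k).of_le (by exact_mod_cast le_top)
  have hL := tendsto_integral_of_compact (U := U) (K := K)
    (F := fun k x => ⟪finslerField N H (gradient u x), gradient (ψ k) x⟫)
    (f := fun x => ⟪finslerField N H (gradient u x), gradient φ x⟫)
    (b := fun x => ‖finslerField N H (gradient u x)‖ * C) hU hK hKU
    (fun k => hfc.inner (continuous_gradient (hψ1 k)).continuousOn)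
    (hfc.norm.mul continuousOn_const)
    (fun k x hx => by
      simp [gradient_eq_zero_of_notMem_tsupport (fun h => hx (h2 k h))])
    (fun k x _ => (abs_real_inner_le_norm _ _).trans (by gcongr; exact (hC k x).2))
    (fun x _ => tendsto_const_nhds.inner (h5 x))
  have hR := tendsto_integral_of_compact (U := U) (K := K)
    (F := fun k x => g x * ψ k x) (f := fun x => g x * φ x) (b := fun x => |g x| * C) hU hK hKU
    (fun k => hg.mul (hψ1 k).continuous.continuousOn)
    (hg.abs.mul continuousOn_const)
    (fun k x hx => by
      simp [image_eq_zero_of_notMem_tsupport (fun h => hx (h2 k h))])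
    (fun k x _ => by rw [abs_mul]; gcongr; exact (hC k x).1)
    (fun x _ => tendsto_const_nhds.mul (h4 x))
  simp only [hwk] at hL
  exact tendsto_nhds_unique hL hR

lemma energyInf_nonneg {N : ℕ} {H : Euc N → ℝ} (hnorm : IsFinslerNorm N H) (U : Set (Euc N))
    (p : ℝ) : 0 ≤ energyInf N H U p := by
  refine Real.sInf_nonneg ?_
  rintro c ⟨u, -, -, -, -, rfl⟩
  exact integral_nonneg fun x => pow_nonneg (hnorm.nonneg _) _

lemma gradient_const_mul {N : ℕ} (c : ℝ) {f : Euc N → ℝ} {x : Euc N}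
    (hf : DifferentiableAt ℝ f x) :
    gradient (fun y => c * f y) x = c • gradient f x := by
  simp [gradient, fderiv_const_mul hf]

lemma energyInf_mul_le_of_smooth {N : ℕ} {H : Euc N → ℝ} (hnorm : IsFinslerNorm N H)
    {U : Set (Euc N)} {p : ℝ} (hp : 0 < p) (hN : 0 < N) {φ : Euc N → ℝ}
    (hφ : ContDiff ℝ (⊤ : ℕ∞) φ) (hc : HasCompactSupport φ) (hs : tsupport φ ⊆ U) :
    energyInf N H U p * (∫ x in U, |φ x| ^ (p + 1)) ^ ((N : ℝ) / (p + 1))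
      ≤ ∫ x in U, H (gradient φ x) ^ N := by
  set A := ∫ x in U, |φ x| ^ (p + 1) with hA
  have hA0 : 0 ≤ A := integral_nonneg fun x => by positivity
  rcases hA0.eq_or_lt with h | h
  · rw [← h, Real.zero_rpow (by positivity), mul_zero]
    exact integral_nonneg fun x => pow_nonneg (hnorm.nonneg _) _
  set c : ℝ := A ^ (-(1 / (p + 1))) with hcdef
  have hc0 : 0 < c := by positivity
  have hcp : c ^ (p + 1) = A⁻¹ := by
    rw [hcdef, ← Real.rpow_mul h.le, ← Real.rpow_neg_one]
    congr 1; field_simp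
  have hcN : c ^ N = (A ^ ((N : ℝ) / (p + 1)))⁻¹ := by
    rw [hcdef, ← Real.rpow_natCast, ← Real.rpow_mul h.le, ← Real.rpow_neg h.le]
    congr 1; field_simp
  have hle : energyInf N H U p ≤ ∫ x in U, H (gradient (fun y => c * φ y) x) ^ N := by
    refine csInf_le ⟨0, ?_⟩ ⟨fun y => c * φ y, contDiff_const.mul hφ, hc.mul_left, ?_, ?_, rfl⟩
    · rintro c ⟨u, -, -, -, -, rfl⟩
      exact integral_nonneg fun x => pow_nonneg (hnorm.nonneg _) _
    · exact (tsupport_mul_subset_right (f := fun _ => c)).trans hs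
    · have : ∀ x, |c * φ x| ^ (p + 1) = A⁻¹ * |φ x| ^ (p + 1) := fun x => by
        rw [abs_mul, abs_of_pos hc0, Real.mul_rpow hc0.le (abs_nonneg _), hcp]
      simp_rw [this]
      rw [integral_const_mul, ← hA, inv_mul_cancel₀ h.ne']
  have hd : Differentiable ℝ φ := hφ.differentiable (by simp)
  have : ∀ x, H (gradient (fun y => c * φ y) x) ^ N
      = (A ^ ((N : ℝ) / (p + 1)))⁻¹ * H (gradient φ x) ^ N := fun x => by
    rw [gradient_const_mul c (hd x), hnorm.smul, abs_of_pos hc0, mul_pow, hcN]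
  simp_rw [this] at hle
  rw [integral_const_mul] at hle
  have hAp : 0 < A ^ ((N : ℝ) / (p + 1)) := by positivity
  rwa [inv_mul_eq_div, le_div_iff₀ hAp] at hle

/-- The Sobolev inequality with best constant `energyInf`, for `C¹` functions with compact
support. -/
lemma energyInf_mul_le {N : ℕ} {H : Euc N → ℝ} (hnorm : IsFinslerNorm N H)
    {U : Set (Euc N)} (hU : IsOpen U) {p : ℝ} (hp : 0 < p) (hN : 0 < N) {φ : Euc N → ℝ}
    (hφ : ContDiff ℝ 1 φ) (hc : HasCompactSupport φ) (hs : tsupport φ ⊆ U) :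
    energyInf N H U p * (∫ x in U, |φ x| ^ (p + 1)) ^ ((N : ℝ) / (p + 1))
      ≤ ∫ x in U, H (gradient φ x) ^ N := by
  obtain ⟨K, hK, hKU, hφK, ψ, h1, h2, ⟨C, hC⟩, h4, h5⟩ := exists_smooth_approx hφ hc hU hs
  have hψc : ∀ k, HasCompactSupport (ψ k) := fun k =>
    hK.of_isClosed_subset (isClosed_tsupport _) (h2 k)
  have hψ1 : ∀ k, ContDiff ℝ 1 (ψ k) := fun k => (h1 k).of_le (by exact_mod_cast le_top)
  obtain ⟨C', hC'0, hC'⟩ := hnorm.exists_le_norm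
  have hL := tendsto_integral_of_compact (U := U) (K := K)
    (F := fun k x => |ψ k x| ^ (p + 1)) (f := fun x => |φ x| ^ (p + 1))
    (b := fun _ => C ^ (p + 1)) hU hK hKU
    (fun k => ((hψ1 k).continuous.abs.rpow_const fun x => Or.inr (by linarith)).continuousOn)
    continuousOn_const
    (fun k x hx => by
      simp [image_eq_zero_of_notMem_tsupport (fun h => hx (h2 k h)),
        Real.zero_rpow (show p + 1 ≠ 0 by linarith)])
    (fun k x _ => by
      rw [abs_of_nonneg (by positivity)]
      exact Real.rpow_le_rpow (abs_nonneg _) (hC k x).1 (by linarith))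
    (fun x _ => ((h4 x).abs.rpow_const (Or.inr (by linarith))))
  have hR := tendsto_integral_of_compact (U := U) (K := K)
    (F := fun k x => H (gradient (ψ k) x) ^ N) (f := fun x => H (gradient φ x) ^ N)
    (b := fun _ => (C' * C) ^ N) hU hK hKU
    (fun k => ((hnorm.continuous.comp (continuous_gradient (hψ1 k))).pow N).continuousOn)
    continuousOn_const
    (fun k x hx => by
      simp [gradient_eq_zero_of_notMem_tsupport (fun h => hx (h2 k h)), hnorm.map_zero, hN.ne'])
    (fun k x _ => by
      have h0 := hnorm.nonneg (gradient (ψ k) x)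
      rw [abs_of_nonneg (by positivity)]
      gcongr
      exact (hC' _).trans (by gcongr; exact (hC k x).2))
    (fun x _ => ((hnorm.continuous.tendsto _).comp (h5 x)).pow N)
  have hL' := (hL.rpow_const (p := (N : ℝ) / (p + 1)) (Or.inr (by positivity))).const_mul
    (energyInf N H U p)
  exact le_of_tendsto_of_tendsto' hL' hR fun k =>
    energyInf_mul_le_of_smooth hnorm hp hN (h1 k) (hψc k) ((h2 k).trans hKU)

lemma mul_rpow_sub_one_le {t l s : ℝ} (ht : 0 ≤ t) (hl : 0 ≤ l) (hs : 1 < s) :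
    l * t ^ (s - 1) ≤ (1 - 1 / s) * t ^ s + 1 / s * l ^ s := by
  have h1 : 1 / s ≤ 1 := by rw [div_le_one (by linarith)]; exact hs.le
  have h := Real.geom_mean_le_arith_mean2_weighted (w₁ := 1 - 1 / s) (w₂ := 1 / s)
    (by linarith) (by positivity) (Real.rpow_nonneg ht s) (Real.rpow_nonneg hl s) (by ring)
  rw [← Real.rpow_mul ht, ← Real.rpow_mul hl, mul_one_div_cancel (by linarith), Real.rpow_one,
    mul_sub, mul_one_div_cancel (by linarith), mul_one] at h
  rwa [mul_comm]

/-- `L¹` Sobolev inequality for `C¹` functions with compact support, in terms of Bochner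
integrals. -/
lemma exists_integral_rpow_le_fderiv (N : ℕ) (hN : 2 ≤ N) :
    ∃ C > 0, ∀ f : Euc N → ℝ, ContDiff ℝ 1 f → HasCompactSupport f →
      ∫ x, |f x| ^ ((N : ℝ) / (N - 1)) ≤ C * (∫ x, ‖fderiv ℝ f x‖) ^ ((N : ℝ) / (N - 1)) := by
  have hN1 : (1 : ℝ) < N := by exact_mod_cast hN
  set r : ℝ := (N : ℝ) / (N - 1) with hr
  have hr0 : 0 < r := div_pos (by linarith) (by linarith)
  have hconj : Real.HolderConjugate (Module.finrank ℝ (Euc N)) r := by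
    rw [finrank_euclideanSpace_fin, hr]
    exact Real.HolderConjugate.conjExponent hN1
  refine ⟨(lintegralPowLePowLIntegralFDerivConst (volume : Measure (Euc N)) r : ℝ) + 1,
    by positivity, fun f hf hc => ?_⟩
  have h := lintegral_pow_le_pow_lintegral_fderiv (volume : Measure (Euc N)) hf hc hconj
  have hcf : Continuous (fderiv ℝ f) := hf.continuous_fderiv one_ne_zero
  have hi2 : Integrable (fun x => ‖fderiv ℝ f x‖) :=
    hcf.norm.integrable_of_hasCompactSupport (hc.fderiv ℝ).norm
  have e1 : ∫⁻ x, ‖f x‖ₑ ^ r = ENNReal.ofReal (∫ x, |f x| ^ r) := by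
    rw [ofReal_integral_eq_lintegral_ofReal]
    · refine lintegral_congr fun x => ?_
      rw [Real.enorm_eq_ofReal_abs, ENNReal.ofReal_rpow_of_nonneg (abs_nonneg _) hr0.le]
    · refine (hf.continuous.abs.rpow_const fun x => Or.inr hr0.le).integrable_of_hasCompactSupport ?_
      exact hc.mono fun x hx => by
        contrapose! hx
        simp only [Function.mem_support, not_not] at hx ⊢
        simp [hx, Real.zero_rpow hr0.ne']
    · exact Eventually.of_forall fun x => by positivity
  have e2 : ∫⁻ x, ‖fderiv ℝ f x‖ₑ = ENNReal.ofReal (∫ x, ‖fderiv ℝ f x‖) := by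
    rw [ofReal_integral_eq_lintegral_ofReal hi2 (Eventually.of_forall fun x => norm_nonneg _)]
    simp
  have hI0 : 0 ≤ ∫ x, ‖fderiv ℝ f x‖ := integral_nonneg fun x => norm_nonneg _
  rw [e1, e2, ENNReal.ofReal_rpow_of_nonneg hI0 hr0.le, ← ENNReal.ofReal_coe_nnreal,
    ← ENNReal.ofReal_mul (by positivity), ENNReal.ofReal_le_ofReal_iff (by positivity)] at h
  refine h.trans ?_
  gcongr
  linarith

lemma norm_fderiv_rpow {N : ℕ} {w : Euc N → ℝ} (hw : ContDiff ℝ 1 w) (hw0 : ∀ x, 0 ≤ w x)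
    {s : ℝ} (hs : 1 < s) (x : Euc N) :
    ‖fderiv ℝ (fun y => w y ^ s) x‖ = s * (‖fderiv ℝ w x‖ * w x ^ (s - 1)) := by
  have h1 := ((hw.differentiable one_ne_zero) x).hasFDerivAt.rpow_const (p := s) (Or.inr hs.le)
  rw [h1.fderiv, norm_smul, Real.norm_eq_abs,
    abs_of_nonneg (mul_nonneg (by linarith) (Real.rpow_nonneg (hw0 x) _))]
  ring

/-- Critical Sobolev inequality with linear growth of the constant in the exponent. -/
lemma exists_sobolev (N : ℕ) (hN : 2 ≤ N) {H : Euc N → ℝ} (hnorm : IsFinslerNorm N H) :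
    ∃ C ≥ 1, ∀ U : Set (Euc N), IsOpen U → Bornology.IsBounded U → ∀ w : Euc N → ℝ,
      ContDiff ℝ 1 w → HasCompactSupport w → tsupport w ⊆ U → (∀ x, 0 ≤ w x) →
      ∀ q : ℝ, 2 < q →
        ∫ x in U, w x ^ q ≤ volume.real U * (C * q) ^ q *
          (∫ x in U, H (gradient w x) ^ N) ^ (q / N) := by
  obtain ⟨C0, hC0, hS⟩ := exists_integral_rpow_le_fderiv N hN
  obtain ⟨C1, hC1, hH⟩ := hnorm.exists_norm_le
  have hN1 : (1 : ℝ) < N := by exact_mod_cast hN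
  have hN2 : (2 : ℝ) ≤ N := by exact_mod_cast hN
  set r : ℝ := (N : ℝ) / (N - 1) with hr
  have hr0 : 0 < r := div_pos (by linarith) (by linarith)
  have hr2 : r ≤ 2 := by rw [hr, div_le_iff₀ (by linarith)]; linarith
  have hconj : Real.HolderConjugate N r := Real.HolderConjugate.conjExponent hN1
  refine ⟨max 1 (C0 ^ (1 / r) * (1 / r) * C1), le_max_left _ _,
    fun U hU hUb w hw hc hs hw0 q hq => ?_⟩
  set s : ℝ := q / r with hsdef
  have hs1 : 1 < s := by rw [hsdef, lt_div_iff₀ hr0]; linarith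
  have hsr : s * r = q := by rw [hsdef]; field_simp
  have hz : ∀ x ∉ U, w x = 0 := fun x hx =>
    image_eq_zero_of_notMem_tsupport fun h => hx (hs h)
  have hzs : ∀ a : ℝ, a ≠ 0 → ∀ x ∉ U, w x ^ a = 0 := fun a ha x hx => by
    rw [hz x hx, Real.zero_rpow ha]
  have hcs : ∀ a : ℝ, a ≠ 0 → HasCompactSupport fun x => w x ^ a := fun a ha =>
    hc.mono fun x hx => by
      contrapose! hx
      simp only [Function.mem_support, not_not] at hx ⊢
      rw [hx, Real.zero_rpow ha]
  have hcont : ∀ a : ℝ, 0 ≤ a → Continuous fun x => w x ^ a := fun a ha =>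
    hw.continuous.rpow_const fun x => Or.inr ha
  have hcf : Continuous (fderiv ℝ w) := hw.continuous_fderiv one_ne_zero
  set G : ℝ := ∫ x, ‖fderiv ℝ w x‖ ^ (N : ℝ) with hG
  have hG0 : 0 ≤ G := integral_nonneg fun x => by positivity
  set A : ℝ := ∫ x in U, w x ^ q with hA
  set B : ℝ := ∫ x in U, w x ^ ((s - 1) * r) with hB
  have hB0 : 0 ≤ B := integral_nonneg fun x => Real.rpow_nonneg (hw0 x) _
  have hBfull : ∫ x, (w x ^ (s - 1)) ^ r = B := by
    rw [hB, setIntegral_eq_integral_of_forall_compl_eq_zero (hzs _ (by nlinarith))]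
    simp_rw [← Real.rpow_mul (hw0 _)]
  have hAfull : ∫ x, |w x ^ s| ^ r = A := by
    rw [hA, setIntegral_eq_integral_of_forall_compl_eq_zero (hzs _ (by linarith))]
    simp_rw [abs_of_nonneg (Real.rpow_nonneg (hw0 _) s), ← Real.rpow_mul (hw0 _), hsr]
  have h1 := hS (fun x => w x ^ s)
    ((Real.contDiff_rpow_const_of_le (by exact_mod_cast hs1.le)).comp hw) (hcs s (by linarith))
  rw [hAfull] at h1
  simp_rw [norm_fderiv_rpow hw hw0 hs1] at h1
  rw [integral_const_mul] at h1
  have h2 := integral_mul_le_Lp_mul_Lq_of_nonneg (μ := (volume : Measure (Euc N))) hconj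
    (f := fun x => ‖fderiv ℝ w x‖) (g := fun x => w x ^ (s - 1))
    (Eventually.of_forall fun x => norm_nonneg _)
    (Eventually.of_forall fun x => Real.rpow_nonneg (hw0 x) _)
    (hcf.norm.memLp_of_hasCompactSupport (hc.fderiv ℝ).norm)
    ((hcont _ (by linarith)).memLp_of_hasCompactSupport (hcs _ (by linarith)))
  rw [hBfull, ← hG] at h2
  set l : ℝ := C0 * s ^ r * G ^ (r / N) with hl
  have hl0 : 0 ≤ l := by positivity
  have h3 : A ≤ l * B := by
    refine h1.trans ?_
    calc C0 * (s * ∫ x, ‖fderiv ℝ w x‖ * w x ^ (s - 1)) ^ r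
        ≤ C0 * (s * (G ^ (1 / (N : ℝ)) * B ^ (1 / r))) ^ r := by
          have : 0 ≤ ∫ x, ‖fderiv ℝ w x‖ * w x ^ (s - 1) :=
            integral_nonneg fun x => mul_nonneg (norm_nonneg _) (Real.rpow_nonneg (hw0 x) _)
          gcongr
      _ = l * B := by
          rw [Real.mul_rpow (by positivity) (by positivity),
            Real.mul_rpow (by positivity) (by positivity), ← Real.rpow_mul hG0,
            ← Real.rpow_mul hB0, one_div_mul_cancel hr0.ne', Real.rpow_one, hl]
          ring_nf
  have hfin : volume U ≠ ⊤ := hUb.measure_lt_top.ne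
  have hintg : ∀ a : ℝ, 0 < a → IntegrableOn (fun x => w x ^ a) U := fun a ha =>
    ((hcont a ha.le).integrable_of_hasCompactSupport (hcs a ha.ne')).integrableOn
  have h4 : l * B ≤ (1 - 1 / s) * A + volume.real U * (1 / s * l ^ s) := by
    rw [hB, hA, ← integral_const_mul, ← integral_const_mul, ← smul_eq_mul (volume.real U),
      ← setIntegral_const, ← integral_add ((hintg q (by linarith)).const_mul _)
        (integrableOn_const hfin)]
    refine integral_mono_of_nonneg (Eventually.of_forall fun x =>
      mul_nonneg hl0 (Real.rpow_nonneg (hw0 x) _)) (((hintg q (by linarith)).const_mul _).add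
        (integrableOn_const hfin)) (Eventually.of_forall fun x => ?_)
    have := mul_rpow_sub_one_le (Real.rpow_nonneg (hw0 x) r) hl0 hs1
    rw [← Real.rpow_mul (hw0 x), ← Real.rpow_mul (hw0 x), mul_comm r, mul_comm r, hsr] at this
    exact this
  have h5 : A ≤ volume.real U * l ^ s := by
    have : 1 / s * A ≤ 1 / s * (volume.real U * l ^ s) := by nlinarith
    exact le_of_mul_le_mul_left this (by positivity)
  refine h5.trans ?_
  have hGH : G ≤ C1 ^ N * ∫ x in U, H (gradient w x) ^ N := by
    rw [hG, ← setIntegral_eq_integral_of_forall_compl_eq_zero (s := U), ← integral_const_mul]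
    · refine setIntegral_mono_on ?_ ?_ hU.measurableSet fun x _ => ?_
      · refine (Continuous.integrable_of_hasCompactSupport ?_ ?_).integrableOn
        · exact hcf.norm.rpow_const fun x => Or.inr (by positivity)
        · exact (hc.fderiv ℝ).mono fun x hx => by
            contrapose! hx
            simp only [Function.mem_support, not_not] at hx ⊢
            rw [hx, norm_zero, Real.zero_rpow (by positivity)]
      · refine (Continuous.integrable_of_hasCompactSupport ?_ ?_).integrableOn
        · exact continuous_const.mul
            ((hnorm.continuous.comp (continuous_gradient hw)).pow N)
        · exact (hc.fderiv ℝ).mono fun x hx => by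
            contrapose! hx
            simp only [Function.mem_support, not_not] at hx ⊢
            simp [gradient, hx, hnorm.map_zero, show N ≠ 0 by omega]
      · rw [Real.rpow_natCast, ← mul_pow, ← norm_gradient_eq]
        gcongr
        exact hH _
    · intro x hx
      have : fderiv ℝ w x = 0 := by
        by_contra h
        exact hx (hs (support_fderiv_subset ℝ h))
      rw [this, norm_zero, Real.zero_rpow (by positivity)]
  set D : ℝ := ∫ x in U, H (gradient w x) ^ N with hD
  have hD0 : 0 ≤ D := integral_nonneg fun x => pow_nonneg (hnorm.nonneg _) _
  have h6 : l ^ s = (C0 ^ (1 / r) * (1 / r) * q * G ^ (1 / (N : ℝ))) ^ q := by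
    have : l = (C0 ^ (1 / r) * (1 / r) * q * G ^ (1 / (N : ℝ))) ^ r := by
      rw [Real.mul_rpow (by positivity) (by positivity), mul_assoc (C0 ^ (1 / r)),
        Real.mul_rpow (by positivity) (by positivity), ← Real.rpow_mul hC0.le,
        ← Real.rpow_mul hG0, one_div_mul_cancel hr0.ne', Real.rpow_one, hl, hsdef]
      ring_nf
    rw [this, ← Real.rpow_mul (by positivity), mul_comm r, hsr]
  have h7 : G ^ (1 / (N : ℝ)) ≤ C1 * D ^ (1 / (N : ℝ)) := by
    calc G ^ (1 / (N : ℝ)) ≤ (C1 ^ N * D) ^ (1 / (N : ℝ)) := by gcongr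
      _ = C1 * D ^ (1 / (N : ℝ)) := by
        rw [Real.mul_rpow (by positivity) hD0, ← Real.rpow_natCast, ← Real.rpow_mul hC1.le,
          mul_one_div_cancel (by positivity), Real.rpow_one]
  have h8 : D ^ (q / N) = (D ^ (1 / (N : ℝ))) ^ q := by
    rw [← Real.rpow_mul hD0]; ring_nf
  rw [h6, h8, mul_assoc (volume.real U), ← Real.mul_rpow (by positivity) (by positivity)]
  refine mul_le_mul_of_nonneg_left (Real.rpow_le_rpow (by positivity) ?_ (by positivity))
    measureReal_nonneg
  calc C0 ^ (1 / r) * (1 / r) * q * G ^ (1 / (N : ℝ))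
      ≤ C0 ^ (1 / r) * (1 / r) * q * (C1 * D ^ (1 / (N : ℝ))) := by gcongr
    _ = C0 ^ (1 / r) * (1 / r) * C1 * q * D ^ (1 / (N : ℝ)) := by ring
    _ ≤ _ := by gcongr; exact le_max_right _ _

lemma fderiv_pow_eq_inner_field {N : ℕ} {H : Euc N → ℝ}
    (hreg : FinslerRegular N H) {ξ : Euc N} (hξ : ξ ≠ 0) (ζ : Euc N) :
    fderiv ℝ (fun η => H η ^ N) ξ ζ = N * ⟪finslerField N H ξ, ζ⟫ := by
  rw [fderiv_fun_pow N (IsFinslerNorm.differentiableAt hreg hξ)]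
  simp [finslerField, real_inner_smul_left, gradient, mul_assoc]

lemma contDiffAt_fderiv_pow {N : ℕ} {H : Euc N → ℝ}
    (hreg : FinslerRegular N H) {ξ : Euc N} (hξ : ξ ≠ 0) :
    ContDiffAt ℝ 1 (fderiv ℝ fun η => H η ^ N) ξ := by
  have h1 : ContDiffAt ℝ 2 (fun η => H η ^ N) ξ :=
    (hreg.1.contDiffAt (isOpen_compl_singleton.mem_nhds hξ)).pow N
  exact h1.fderiv_right (by norm_num)

/-- Quantitative strict convexity of `H ^ N`, from homogeneity and compactness of the sphere. -/
lemma exists_hessian_lower_bound {N : ℕ} (hN : 2 ≤ N) {H : Euc N → ℝ} (h : IsFinslerNorm N H)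
    (hreg : FinslerRegular N H) :
    ∃ c > 0, ∀ ξ : Euc N, ξ ≠ 0 → ∀ ζ : Euc N,
      c * ‖ξ‖ ^ (N - 2) * ‖ζ‖ ^ 2 ≤
        fderiv ℝ (fderiv ℝ fun η => H η ^ N) ξ ζ ζ := by
  set f : Euc N → ℝ := fun η => H η ^ N with hf
  have hne : Nontrivial (Euc N) := by
    have : Nonempty (Fin N) := ⟨⟨0, by omega⟩⟩
    infer_instance
  set S : Set (Euc N × Euc N) := Metric.sphere 0 1 ×ˢ Metric.sphere 0 1 with hS
  have hSc : IsCompact S := (isCompact_sphere _ _).prod (isCompact_sphere _ _)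
  have hSn : S.Nonempty :=
    (NormedSpace.sphere_nonempty.2 zero_le_one).prod (NormedSpace.sphere_nonempty.2 zero_le_one)
  have hcont : ContinuousOn (fun z : Euc N × Euc N => fderiv ℝ (fderiv ℝ f) z.1 z.2 z.2) S := by
    intro z hz
    have hz1 : z.1 ≠ 0 := by
      have : ‖z.1‖ = 1 := by simpa using hz.1
      intro h0; simp [h0] at this
    have h1 : ContinuousAt (fderiv ℝ (fderiv ℝ f)) z.1 :=
      ((contDiffAt_fderiv_pow hreg hz1).fderiv_right (m := 0) (by norm_num)).continuousAt
    have h2 : ContinuousAt (fun z : Euc N × Euc N => fderiv ℝ (fderiv ℝ f) z.1) z :=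
      ContinuousAt.comp (f := Prod.fst) h1 continuousAt_fst
    exact ((h2.clm_apply continuousAt_snd).clm_apply continuousAt_snd).continuousWithinAt
  obtain ⟨z, hz, hmin⟩ := hSc.exists_isMinOn hSn hcont
  have hpos : ∀ ξ : Euc N, ξ ≠ 0 → ∀ ζ : Euc N, ζ ≠ 0 → 0 < fderiv ℝ (fderiv ℝ f) ξ ζ ζ := by
    intro ξ hξ ζ hζ
    have := hreg.2.2 ξ hξ ζ hζ
    rw [iteratedFDeriv_two_apply] at this
    simpa using this
  have hn0 : ∀ ξ : Euc N, ‖ξ‖ = 1 → ξ ≠ 0 := fun ξ h1 h0 => by simp [h0] at h1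
  refine ⟨_, hpos z.1 (hn0 _ (by simpa using hz.1)) z.2 (hn0 _ (by simpa using hz.2)), ?_⟩
  intro ξ hξ ζ
  rcases eq_or_ne ζ 0 with rfl | hζ
  · simp
  have hhom : ∀ l : ℝ, 0 < l → ∀ η : Euc N, η ≠ 0 →
      fderiv ℝ (fderiv ℝ f) (l • η) = l ^ (N - 2) • fderiv ℝ (fderiv ℝ f) η := by
    intro l hl η hη
    have e1 : (fun x => fderiv ℝ f (l • x)) = fun x => l ^ (N - 1) • fderiv ℝ f x := by
      funext x
      have e2 : (fun y => f (l • y)) = fun y => l ^ N • f y := by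
        funext y
        simp only [hf, h.smul, abs_of_pos hl, mul_pow, smul_eq_mul]
      have e3 := fderiv_comp_smul (𝕜 := ℝ) (f := f) (x := x) l
      rw [e2, fderiv_fun_const_smul ((hreg.2.1.differentiable one_ne_zero) x)] at e3
      have e4 : l ^ N = l * l ^ (N - 1) := by rw [← pow_succ']; congr 1; omega
      rw [e4, mul_smul] at e3
      exact (smul_right_injective _ hl.ne' e3).symm
    have e5 := fderiv_comp_smul (𝕜 := ℝ) (f := fderiv ℝ f) (x := η) l
    rw [e1, fderiv_fun_const_smul ((contDiffAt_fderiv_pow hreg hη).differentiableAt one_ne_zero)]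
      at e5
    have e4 : l ^ (N - 1) = l * l ^ (N - 2) := by rw [← pow_succ']; congr 1; omega
    rw [e4, mul_smul] at e5
    exact (smul_right_injective _ hl.ne' e5).symm
  have hξ' : 0 < ‖ξ‖ := norm_pos_iff.2 hξ
  have hζ' : 0 < ‖ζ‖ := norm_pos_iff.2 hζ
  set ξ1 : Euc N := ‖ξ‖⁻¹ • ξ with hξ1
  set ζ1 : Euc N := ‖ζ‖⁻¹ • ζ with hζ1
  have a1 : ‖ξ1‖ = 1 := by rw [hξ1, norm_smul, norm_inv, norm_norm, inv_mul_cancel₀ hξ'.ne']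
  have a2 : ‖ζ1‖ = 1 := by rw [hζ1, norm_smul, norm_inv, norm_norm, inv_mul_cancel₀ hζ'.ne']
  have b1 : ξ = ‖ξ‖ • ξ1 := by rw [hξ1, smul_inv_smul₀ hξ'.ne']
  have b2 : ζ = ‖ζ‖ • ζ1 := by rw [hζ1, smul_inv_smul₀ hζ'.ne']
  have hm := hmin (show (ξ1, ζ1) ∈ S from ⟨by simpa using a1, by simpa using a2⟩)
  simp only [mem_ofPred_eq] at hm
  have e6 : fderiv ℝ (fderiv ℝ f) ξ ζ ζ
      = ‖ξ‖ ^ (N - 2) * ‖ζ‖ ^ 2 * fderiv ℝ (fderiv ℝ f) ξ1 ζ1 ζ1 := by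
    conv_lhs => rw [b1, b2, hhom _ hξ' _ (hn0 _ a1)]
    simp only [_root_.smul_apply, map_smul, smul_eq_mul]
    ring
  rw [e6]
  have : 0 ≤ ‖ξ‖ ^ (N - 2) * ‖ζ‖ ^ 2 := by positivity
  nlinarith

lemma exists_field_sub_lower_bound {N : ℕ} (hN : 2 ≤ N) {H : Euc N → ℝ}
    (h : IsFinslerNorm N H) (hreg : FinslerRegular N H) :
    ∃ c > 0, ∀ X Y : Euc N, X ≠ 0 → Y ≠ 0 → X ≠ Y → ‖X - Y‖ / 2 ≤ ‖X‖ →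
      c * ‖X - Y‖ ^ N ≤ ⟪finslerField N H X - finslerField N H Y, X - Y⟫ := by
  obtain ⟨c, hc, hc'⟩ := exists_hessian_lower_bound hN h hreg
  set f : Euc N → ℝ := fun η => H η ^ N with hf
  have hN0 : (0 : ℝ) < N := by positivity
  refine ⟨c * (1 / 4) ^ (N - 2) * (1 / 4) / N, by positivity, fun X Y hX hY hXY hle => ?_⟩
  set Z := X - Y with hZ
  have hZ0 : 0 < ‖Z‖ := norm_pos_iff.2 (sub_ne_zero.2 hXY)
  set g : ℝ → ℝ := fun t => fderiv ℝ f (Y + t • Z) Z with hg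
  have hl : ∀ t : ℝ, HasDerivAt (fun t : ℝ => Y + t • Z) Z t := fun t => by
    simpa using ((hasDerivAt_id t).smul_const Z).const_add Y
  have hfd : Differentiable ℝ f := hreg.2.1.differentiable one_ne_zero
  have h1 : g 0 ≤ g (3 / 4) := by
    have hconv : ConvexOn ℝ univ fun t : ℝ => f (Y + t • Z) := by
      have hfc : ConvexOn ℝ univ f := h.1.pow (fun x _ => h.nonneg x) N
      have := hfc.comp_affineMap (AffineMap.lineMap Y X)
      simpa [Function.comp_def, AffineMap.lineMap_apply, add_comm, hZ] using this
    have hd : ∀ t, HasDerivAt (fun t : ℝ => f (Y + t • Z)) (g t) t := fun t =>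
      (hfd _).hasFDerivAt.comp_hasDerivAt t (hl t)
    have hm := hconv.monotoneOn_deriv fun t _ => (hd t).differentiableAt
    have := hm (mem_univ 0) (mem_univ (3 / 4)) (by norm_num)
    rwa [(hd _).deriv, (hd _).deriv] at this
  have hlow : ∀ t ∈ Icc (3 / 4 : ℝ) 1, 1 / 4 * ‖Z‖ ≤ ‖Y + t • Z‖ := by
    intro t ht
    have e : Y + t • Z = X - (1 - t) • Z := by rw [hZ]; module
    have e2 : ‖(1 - t) • Z‖ ≤ 1 / 4 * ‖Z‖ := by
      rw [norm_smul, Real.norm_eq_abs, abs_of_nonneg (by linarith [ht.2])]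
      nlinarith [ht.1]
    have := norm_sub_norm_le X ((1 - t) • Z)
    rw [e]; linarith
  have hgd : ∀ t ∈ Icc (3 / 4 : ℝ) 1,
      HasDerivAt g (fderiv ℝ (fderiv ℝ f) (Y + t • Z) Z Z) t := by
    intro t ht
    have hne : Y + t • Z ≠ 0 := norm_pos_iff.1 (lt_of_lt_of_le (by positivity) (hlow t ht))
    have := ((contDiffAt_fderiv_pow hreg hne).differentiableAt
      one_ne_zero).hasFDerivAt.comp_hasDerivAt t (hl t)
    exact ((ContinuousLinearMap.apply ℝ ℝ Z).hasFDerivAt.comp_hasDerivAt t this)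
  have h2 : c * (1 / 4 * ‖Z‖) ^ (N - 2) * ‖Z‖ ^ 2 * (1 - 3 / 4) ≤ g 1 - g (3 / 4) := by
    refine (convex_Icc (3 / 4 : ℝ) 1).mul_sub_le_image_sub_of_le_deriv
      (fun t ht => (hgd t ht).continuousAt.continuousWithinAt)
      (fun t ht => (hgd t (interior_subset ht)).differentiableAt.differentiableWithinAt)
      (fun t ht => ?_) _ (by norm_num) _ (by norm_num) (by norm_num)
    rw [(hgd t (interior_subset ht)).deriv]
    have hlo := hlow t (interior_subset ht)
    have hne : Y + t • Z ≠ 0 := norm_pos_iff.1 (lt_of_lt_of_le (by positivity) hlo)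
    refine le_trans ?_ (hc' _ hne Z)
    gcongr
  have g0 : g 0 = N * ⟪finslerField N H Y, Z⟫ := by
    simp only [hg, zero_smul, add_zero]
    exact fderiv_pow_eq_inner_field hreg hY Z
  have g1 : g 1 = N * ⟪finslerField N H X, Z⟫ := by
    have : Y + (1 : ℝ) • Z = X := by rw [hZ]; module
    simp only [hg, this]
    exact fderiv_pow_eq_inner_field hreg hX Z
  rw [inner_sub_left]
  have e : ‖Z‖ ^ N = ‖Z‖ ^ (N - 2) * ‖Z‖ ^ 2 := by rw [← pow_add]; congr 1; omega
  rw [e, div_mul_eq_mul_div, div_le_iff₀ hN0]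
  rw [mul_pow] at h2
  linarith

lemma ne_neg_of_ne_zero {N : ℕ} {X : Euc N} (hX : X ≠ 0) : X ≠ -X := fun h => hX (by
  have h1 : (2 : ℝ) • X = 0 := by rw [two_smul]; nth_rewrite 2 [h]; exact add_neg_cancel X
  exact (smul_eq_zero.1 h1).resolve_left two_ne_zero)

lemma dConst_pos {N : ℕ} (hN : 2 ≤ N) {H : Euc N → ℝ} (h : IsFinslerNorm N H)
    (hreg : FinslerRegular N H) : 0 < dConst N H := by
  obtain ⟨c, hc, hc'⟩ := exists_field_sub_lower_bound hN h hreg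
  obtain ⟨C, hC, hC'⟩ := h.exists_le_norm
  have : Nonempty (Fin N) := ⟨⟨0, by omega⟩⟩
  obtain ⟨X, hX⟩ := exists_ne (0 : Euc N)
  refine lt_of_lt_of_le (show 0 < c / C ^ N by positivity) (le_csInf
    ⟨_, X, -X, hX, neg_ne_zero.2 hX, ?_, rfl⟩ ?_)
  · exact ne_neg_of_ne_zero hX
  rintro r ⟨X, Y, hX, hY, hXY, rfl⟩
  have hZ : 0 < H (X - Y) := h.pos (sub_ne_zero.2 hXY)
  have key : c * ‖X - Y‖ ^ N ≤ ⟪finslerField N H X - finslerField N H Y, X - Y⟫ := by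
    rcases le_total (‖X - Y‖ / 2) ‖X‖ with h1 | h1
    · exact hc' X Y hX hY hXY h1
    · have h2 : ‖Y - X‖ / 2 ≤ ‖Y‖ := by
        have := norm_sub_le X Y
        rw [norm_sub_rev]; linarith
      have h3 := hc' Y X hY hX hXY.symm h2
      rw [norm_sub_rev, ← neg_sub X Y, inner_neg_right, ← inner_neg_left, neg_sub] at h3
      exact h3
  unfold dQuot
  rw [le_div_iff₀ (by positivity)]
  refine le_trans ?_ key
  rw [div_mul_eq_mul_div, div_le_iff₀ (by positivity), mul_assoc, ← mul_pow]
  exact mul_le_mul_of_nonneg_left (pow_le_pow_left₀ hZ.le ((hC' _).trans_eq (mul_comm _ _)) N) hc.le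

lemma dConst_le_one {N : ℕ} (hN : 2 ≤ N) {H : Euc N → ℝ} (h : IsFinslerNorm N H)
    (hreg : FinslerRegular N H) : dConst N H ≤ 1 := by
  have : Nonempty (Fin N) := ⟨⟨0, by omega⟩⟩
  obtain ⟨X, hX⟩ := exists_ne (0 : Euc N)
  have hbdd : BddBelow {r : ℝ | ∃ X Y : Euc N, X ≠ 0 ∧ Y ≠ 0 ∧ X ≠ Y ∧ r = dQuot N H X Y} := by
    by_contra hb
    have h1 := dConst_pos hN h hreg
    unfold dConst at h1
    rw [Real.sInf_of_not_bddBelow hb] at h1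
    exact lt_irrefl _ h1
  refine (csInf_le hbdd ⟨X, -X, hX, neg_ne_zero.2 hX,
    ne_neg_of_ne_zero hX, rfl⟩).trans ?_
  have e1 : X - -X = (2 : ℝ) • X := by module
  have hf := h.inner_field_self hreg hN X
  have hf' := h.inner_field_self hreg hN (-X)
  rw [inner_neg_right, h.map_neg] at hf'
  have e2 : ⟪finslerField N H X - finslerField N H (-X), X - -X⟫ = 4 * H X ^ N := by
    rw [e1, real_inner_smul_right, inner_sub_left]; linarith
  change ⟪finslerField N H X - finslerField N H (-X), X - -X⟫ / H (X - -X) ^ N ≤ 1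
  have hp := h.pos hX
  rw [e2, e1, h.smul, abs_of_pos two_pos, mul_pow, div_le_one (by positivity)]
  have : (2 : ℝ) ^ 2 ≤ 2 ^ N := pow_le_pow_right₀ one_le_two hN
  nlinarith [pow_pos hp N]

lemma one_le_floor_exp_div_dConst {N : ℕ} (hN : 2 ≤ N) {H : Euc N → ℝ} (h : IsFinslerNorm N H)
    (hreg : FinslerRegular N H) :
    1 ≤ Nat.floor (Real.exp (((N : ℝ) - 1) / N) / dConst N H) := by
  have hN' : (2 : ℝ) ≤ N := by exact_mod_cast hN
  refine Nat.le_floor ?_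
  rw [Nat.cast_one, one_le_div (dConst_pos hN h hreg)]
  exact (dConst_le_one hN h hreg).trans
    (Real.one_le_exp (div_nonneg (by linarith) (by linarith)))

lemma hasDerivAt_posPart_sq (x : ℝ) : HasDerivAt (fun y : ℝ => max y 0 ^ 2) (2 * max x 0) x := by
  rw [hasDerivAt_iff_isLittleO]
  have h1 : (fun y : ℝ => (y - x) ^ 2) =o[𝓝 x] fun y => y - x := by
    have : Tendsto (fun y : ℝ => y - x) (𝓝 x) (𝓝 0) := by
      have : ContinuousAt (fun y : ℝ => y - x) x := by fun_prop
      simpa [ContinuousAt] using this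
    simpa [pow_two] using
      (((Asymptotics.isLittleO_one_iff ℝ).2 this).mul_isBigO
        (Asymptotics.isBigO_refl (fun y : ℝ => y - x) (𝓝 x)))
  refine Asymptotics.IsBigO.trans_isLittleO (Asymptotics.IsBigO.of_bound 1 ?_) h1
  refine Eventually.of_forall fun y => ?_
  rw [one_mul, Real.norm_eq_abs, Real.norm_eq_abs, abs_of_nonneg (sq_nonneg (y - x)), smul_eq_mul,
    abs_le]
  rcases le_total x 0 with hx | hx <;> rcases le_total y 0 with hy | hy <;>
    simp only [hx, hy, max_eq_left, max_eq_right] <;> constructor <;> nlinarith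

/-- A `C¹` approximation of the identity on `[0, ∞)` vanishing on `(-∞, ε]`. -/
def softTrunc (ε t : ℝ) : ℝ := √(max (t - ε) 0 ^ 2 + ε ^ 2) - ε

def softTruncDeriv (ε t : ℝ) : ℝ := max (t - ε) 0 / √(max (t - ε) 0 ^ 2 + ε ^ 2)

lemma hasDerivAt_softTrunc {ε : ℝ} (hε : 0 < ε) (t : ℝ) :
    HasDerivAt (softTrunc ε) (softTruncDeriv ε t) t := by
  have h1 : HasDerivAt (fun t : ℝ => max (t - ε) 0 ^ 2) (2 * max (t - ε) 0) t := by
    exact (hasDerivAt_posPart_sq (t - ε)).comp_sub_const t ε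
  have h2 := ((h1.add_const (ε ^ 2)).sqrt (by positivity)).sub_const ε
  refine h2.congr_deriv ?_
  rw [softTruncDeriv, mul_div_mul_left _ _ two_ne_zero]

lemma continuous_softTruncDeriv {ε : ℝ} (hε : 0 < ε) : Continuous (softTruncDeriv ε) := by
  unfold softTruncDeriv
  refine Continuous.div (by fun_prop) (by fun_prop) fun t => ?_
  positivity

lemma contDiff_softTrunc {ε : ℝ} (hε : 0 < ε) : ContDiff ℝ 1 (softTrunc ε) := by
  rw [contDiff_one_iff_deriv]
  refine ⟨fun t => (hasDerivAt_softTrunc hε t).differentiableAt, ?_⟩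
  rw [show deriv (softTrunc ε) = softTruncDeriv ε from
    funext fun t => (hasDerivAt_softTrunc hε t).deriv]
  exact continuous_softTruncDeriv hε

lemma softTrunc_nonneg {ε : ℝ} (t : ℝ) : 0 ≤ softTrunc ε t :=
  sub_nonneg.2 (Real.le_sqrt_of_sq_le (by nlinarith [sq_nonneg (max (t - ε) 0)]))

lemma softTrunc_le {ε t : ℝ} (hε : 0 < ε) (ht : 0 ≤ t) : softTrunc ε t ≤ t := by
  rw [softTrunc, sub_le_iff_le_add, Real.sqrt_le_left (by positivity)]
  rcases le_total (t - ε) 0 with h | h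
  · rw [max_eq_right h]; nlinarith
  · rw [max_eq_left h]; nlinarith

lemma softTrunc_eq_zero {ε t : ℝ} (hε : 0 < ε) (ht : t ≤ ε) : softTrunc ε t = 0 := by
  rw [softTrunc, max_eq_right (by linarith)]
  simp [Real.sqrt_sq hε.le]

lemma softTruncDeriv_nonneg (ε t : ℝ) : 0 ≤ softTruncDeriv ε t :=
  div_nonneg (le_max_right _ _) (Real.sqrt_nonneg _)

lemma softTruncDeriv_le_one (ε t : ℝ) : softTruncDeriv ε t ≤ 1 :=
  div_le_one_of_le₀ (Real.le_sqrt_of_sq_le (by nlinarith [sq_nonneg ε])) (Real.sqrt_nonneg _)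

lemma half_le_softTruncDeriv {ε t : ℝ} (hε : 0 < ε) (ht : 4 * ε ≤ t) :
    1 / 2 ≤ softTruncDeriv ε t := by
  rw [softTruncDeriv, max_eq_left (by linarith), div_le_div_iff₀ two_pos (by positivity), one_mul,
    Real.sqrt_le_left (by linarith)]
  nlinarith

lemma tendsto_softTrunc {ε : ℕ → ℝ} (hε : Tendsto ε atTop (𝓝 0)) {t : ℝ} (ht : 0 ≤ t) :
    Tendsto (fun k => softTrunc (ε k) t) atTop (𝓝 t) := by
  have : Continuous fun e : ℝ => softTrunc e t := by unfold softTrunc; fun_prop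
  have h := (this.tendsto 0).comp hε
  simpa [softTrunc, ht, Function.comp_def] using h

lemma tendsto_softTruncDeriv {ε : ℕ → ℝ} (hε : Tendsto ε atTop (𝓝 0)) {t : ℝ} (ht : 0 < t) :
    Tendsto (fun k => softTruncDeriv (ε k) t) atTop (𝓝 1) := by
  have : ContinuousAt (fun e : ℝ => softTruncDeriv e t) 0 := by
    unfold softTruncDeriv
    refine ContinuousAt.div (by fun_prop) (by fun_prop) ?_
    simp [ht.le, ht.ne']
  have h := this.tendsto.comp hε
  simpa [softTruncDeriv, ht.le, ht.ne', Function.comp_def] using h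

namespace IsLeastEnergySolution

variable {N : ℕ} {H : Euc N → ℝ} {Ω : Set (Euc N)} {p : ℝ} {u : Euc N → ℝ}

lemma contDiffOn (hu : IsLeastEnergySolution N H Ω p u) : ContDiffOn ℝ 1 u Ω :=
  hu.1.mono subset_closure

lemma exists_bound (hΩb : Bornology.IsBounded Ω) (hu : IsLeastEnergySolution N H Ω p u) :
    ∃ M > 0, ∀ x ∈ Ω, u x ≤ M := by
  obtain ⟨M, hM⟩ := hΩb.isCompact_closure.exists_bound_of_continuousOn hu.1.continuousOn
  refine ⟨max M 1, by positivity, fun x hx => ?_⟩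
  exact ((le_abs_self _).trans (hM x (subset_closure hx))).trans (le_max_left _ _)

lemma isCompact_superlevel (hΩb : Bornology.IsBounded Ω)
    (hu : IsLeastEnergySolution N H Ω p u) (ε : ℝ) :
    IsCompact {x ∈ closure Ω | ε ≤ u x} := by
  have : {x ∈ closure Ω | ε ≤ u x} = closure Ω ∩ u ⁻¹' Ici ε := rfl
  rw [this]
  exact hΩb.isCompact_closure.of_isClosed_subset
    (hu.1.continuousOn.preimage_isClosed_of_isClosed isClosed_closure isClosed_Ici) inter_subset_left

lemma superlevel_subset (hΩo : IsOpen Ω) (hu : IsLeastEnergySolution N H Ω p u) {ε : ℝ}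
    (hε : 0 < ε) : {x ∈ closure Ω | ε ≤ u x} ⊆ Ω := by
  rintro x ⟨hx, hx'⟩
  by_contra h
  have := hu.2.2.1 x (by rw [hΩo.frontier_eq]; exact ⟨hx, h⟩)
  linarith

lemma gradient_comp {f : Euc N → ℝ} {F : ℝ → ℝ} {F' : ℝ} {x : Euc N}
    (hF : HasDerivAt F F' (f x)) (hf : DifferentiableAt ℝ f x) :
    gradient (fun y => F (f y)) x = F' • gradient f x := by
  have : fderiv ℝ (fun y => F (f y)) x = F' • fderiv ℝ f x :=
    (hF.comp_hasFDerivAt x hf.hasFDerivAt).fderiv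
  simp [gradient, this]

lemma differentiableAt (hΩo : IsOpen Ω) (hu : IsLeastEnergySolution N H Ω p u) {x : Euc N}
    (hx : x ∈ Ω) : DifferentiableAt ℝ u x :=
  (hu.contDiffOn.contDiffAt (hΩo.mem_nhds hx)).differentiableAt one_ne_zero

/-- Compositions of the truncated solution with `C¹` functions vanishing at `0` are admissible
test functions. -/
lemma truncation (hΩo : IsOpen Ω) (hΩb : Bornology.IsBounded Ω)
    (hu : IsLeastEnergySolution N H Ω p u) {ε : ℝ} (hε : 0 < ε) {F : ℝ → ℝ} {O : Set ℝ}
    (hO : IsOpen O) (hO' : Ici 0 ⊆ O) (hF : ContDiffOn ℝ 1 F O) (hF0 : F 0 = 0) :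
    ∃ φ : Euc N → ℝ, ContDiff ℝ 1 φ ∧ HasCompactSupport φ ∧ tsupport φ ⊆ Ω ∧
      (∀ x ∈ Ω, φ x = F (softTrunc ε (u x))) ∧ (∀ x ∉ Ω, φ x = 0) ∧
      ∀ x ∈ Ω, gradient φ x =
        (deriv F (softTrunc ε (u x)) * softTruncDeriv ε (u x)) • gradient u x := by
  set φ : Euc N → ℝ := Ω.indicator fun x => F (softTrunc ε (u x)) with hφ
  have hφΩ : EqOn φ (fun x => F (softTrunc ε (u x))) Ω := fun x hx => indicator_of_mem hx _
  have h1 : ContDiffOn ℝ 1 (fun x => F (softTrunc ε (u x))) Ω :=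
    hF.comp ((contDiff_softTrunc hε).comp_contDiffOn hu.contDiffOn)
      fun x _ => hO' (softTrunc_nonneg _)
  have hK0 : ∀ x ∉ {x ∈ closure Ω | ε ≤ u x}, φ x = 0 := by
    intro x hx
    by_cases hxΩ : x ∈ Ω
    · have : u x ≤ ε := by
        by_contra h
        exact hx ⟨subset_closure hxΩ, (not_le.1 h).le⟩
      rw [hφΩ hxΩ]
      simp only [softTrunc_eq_zero hε this, hF0]
    · exact indicator_of_notMem hxΩ _
  obtain ⟨h2, h3, h4⟩ := contDiff_of_eq_zero_off_compact hΩo (hu.isCompact_superlevel hΩb ε)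
    (hu.superlevel_subset hΩo hε) (h1.congr hφΩ) hK0
  refine ⟨φ, h2, h3, h4.trans (hu.superlevel_subset hΩo hε), hφΩ,
    fun x hx => indicator_of_notMem hx _, fun x hx => ?_⟩
  have h5 : φ =ᶠ[𝓝 x] fun x => F (softTrunc ε (u x)) :=
    eventually_of_mem (hΩo.mem_nhds hx) hφΩ
  have h6 : HasDerivAt F (deriv F (softTrunc ε (u x))) (softTrunc ε (u x)) :=
    ((hF.contDiffAt (hO.mem_nhds (hO' (softTrunc_nonneg _)))).differentiableAt
      one_ne_zero).hasDerivAt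
  rw [← gradient_comp (F := fun t => F (softTrunc ε t))
    (h6.comp (u x) (hasDerivAt_softTrunc hε (u x))) (hu.differentiableAt hΩo hx)]
  simp only [gradient, h5.fderiv_eq]

lemma continuousOn_rpow (hu : IsLeastEnergySolution N H Ω p u) (q : ℝ) :
    ContinuousOn (fun x => u x ^ q) Ω :=
  hu.contDiffOn.continuousOn.rpow_const fun x hx => Or.inl (hu.2.1 x hx).ne'

lemma integrableOn_rpow (hΩo : IsOpen Ω) (hΩb : Bornology.IsBounded Ω)
    (hu : IsLeastEnergySolution N H Ω p u) {q : ℝ} (hq : 0 ≤ q) :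
    IntegrableOn (fun x => u x ^ q) Ω := by
  obtain ⟨M, hM0, hM⟩ := hu.exists_bound hΩb
  refine IntegrableOn.of_bound hΩb.measure_lt_top
    ((hu.continuousOn_rpow q).aestronglyMeasurable hΩo.measurableSet) (M ^ q) ?_
  filter_upwards [ae_restrict_mem hΩo.measurableSet] with x hx
  rw [Real.norm_eq_abs, abs_of_nonneg (Real.rpow_nonneg (hu.2.1 x hx).le _)]
  exact Real.rpow_le_rpow (hu.2.1 x hx).le (hM x hx) hq

lemma integral_rpow_pos (hΩo : IsOpen Ω) (hΩb : Bornology.IsBounded Ω) (hΩne : Ω.Nonempty)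
    (hu : IsLeastEnergySolution N H Ω p u) {q : ℝ} (hq : 0 ≤ q) :
    0 < ∫ x in Ω, u x ^ q := by
  rw [setIntegral_pos_iff_support_of_nonneg_ae _ (hu.integrableOn_rpow hΩo hΩb hq)]
  · have : Ω ⊆ (Function.support fun x => u x ^ q) ∩ Ω := fun x hx =>
      ⟨(Real.rpow_pos_of_pos (hu.2.1 x hx) q).ne', hx⟩
    exact lt_of_lt_of_le (hΩo.measure_pos volume hΩne) (measure_mono this)
  · filter_upwards [ae_restrict_mem hΩo.measurableSet] with x hx
    exact (Real.rpow_pos_of_pos (hu.2.1 x hx) q).le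

/-- Testing the equation with a truncation. -/
lemma integral_truncation (hnorm : IsFinslerNorm N H) (hreg : FinslerRegular N H) (hN : 2 ≤ N)
    (hΩo : IsOpen Ω) (hΩb : Bornology.IsBounded Ω)
    (hu : IsLeastEnergySolution N H Ω p u) {ε : ℝ} (hε : 0 < ε) {F : ℝ → ℝ} {O : Set ℝ}
    (hO : IsOpen O) (hO' : Ici 0 ⊆ O) (hF : ContDiffOn ℝ 1 F O) (hF0 : F 0 = 0) :
    ∫ x in Ω, deriv F (softTrunc ε (u x)) * softTruncDeriv ε (u x) * H (gradient u x) ^ N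
      = ∫ x in Ω, u x ^ p * F (softTrunc ε (u x)) := by
  obtain ⟨φ, h1, h2, h3, h4, h5, h6⟩ := hu.truncation hΩo hΩb hε hO hO' hF hF0
  have := hu.2.2.2.1.integral_field_eq hnorm hreg hN hΩo hu.contDiffOn (hu.continuousOn_rpow p)
    h1 h2 h3
  calc _ = ∫ x in Ω, ⟪finslerField N H (gradient u x), gradient φ x⟫ :=
        setIntegral_congr_fun hΩo.measurableSet fun x hx => by
          simp only [h6 x hx, real_inner_smul_right, hnorm.inner_field_self hreg hN]
    _ = _ := this
    _ = _ := setIntegral_congr_fun hΩo.measurableSet fun x hx => by simp only [h4 x hx]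

end IsLeastEnergySolution

lemma integrableOn_of_eq_zero_on_diff {N : ℕ} {f : Euc N → ℝ} {U K : Set (Euc N)}
    (hU : IsOpen U) (hK : IsCompact K) (hKU : K ⊆ U) (hf : ContinuousOn f U)
    (h0 : ∀ x ∈ U, x ∉ K → f x = 0) : IntegrableOn f U := by
  have h1 : EqOn (U.indicator f) f U := fun x hx => indicator_of_mem hx f
  refine (integrableOn_of_eq_zero_off_compact hK hKU (hf.congr h1) fun x hx => ?_).congr_fun h1
    hU.measurableSet
  by_cases hxU : x ∈ U
  · rw [h1 hxU, h0 x hxU hx]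
  · exact indicator_of_notMem hxU f

lemma tendsto_one_div_nat_succ : Tendsto (fun k : ℕ => 1 / ((k : ℝ) + 1)) atTop (𝓝 0) :=
  tendsto_one_div_add_atTop_nhds_zero_nat

namespace IsLeastEnergySolution

variable {N : ℕ} {H : Euc N → ℝ} {Ω : Set (Euc N)} {p : ℝ} {u : Euc N → ℝ}

lemma continuousOn_energy (hnorm : IsFinslerNorm N H) (hΩo : IsOpen Ω)
    (hu : IsLeastEnergySolution N H Ω p u) :
    ContinuousOn (fun x => H (gradient u x) ^ N) Ω :=
  (hnorm.continuous.comp_continuousOn (continuousOn_gradient hΩo hu.contDiffOn)).pow N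

lemma integrableOn_mul_softTruncDeriv (hΩo : IsOpen Ω) (hΩb : Bornology.IsBounded Ω)
    (hu : IsLeastEnergySolution N H Ω p u) {ε : ℝ} (hε : 0 < ε) {G : Euc N → ℝ}
    (hG : ContinuousOn G Ω) :
    IntegrableOn (fun x => softTruncDeriv ε (u x) * G x) Ω := by
  refine integrableOn_of_eq_zero_on_diff hΩo (hu.isCompact_superlevel hΩb ε)
    (hu.superlevel_subset hΩo hε)
    (((continuous_softTruncDeriv hε).comp_continuousOn hu.contDiffOn.continuousOn).mul hG)
    fun x hx hx' => ?_
  have : u x ≤ ε := by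
    by_contra h
    exact hx' ⟨subset_closure hx, (not_le.1 h).le⟩
  simp [softTruncDeriv, max_eq_right (show u x - ε ≤ 0 by linarith)]

lemma continuousOn_mul_softTrunc (hu : IsLeastEnergySolution N H Ω p u) {ε : ℝ} (hε : 0 < ε) :
    ContinuousOn (fun x => u x ^ p * softTrunc ε (u x)) Ω :=
  (hu.continuousOn_rpow p).mul
    ((contDiff_softTrunc hε).continuous.comp_continuousOn hu.contDiffOn.continuousOn)

lemma mul_softTrunc_le (hu : IsLeastEnergySolution N H Ω p u) {ε : ℝ} (hε : 0 < ε) {x : Euc N}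
    (hx : x ∈ Ω) : u x ^ p * softTrunc ε (u x) ≤ u x ^ (p + 1) := by
  have hux := hu.2.1 x hx
  rw [Real.rpow_add_one hux.ne']
  exact mul_le_mul_of_nonneg_left (softTrunc_le hε hux.le) (Real.rpow_nonneg hux.le _)

lemma integral_softTrunc_energy (hnorm : IsFinslerNorm N H) (hreg : FinslerRegular N H)
    (hN : 2 ≤ N) (hΩo : IsOpen Ω) (hΩb : Bornology.IsBounded Ω)
    (hu : IsLeastEnergySolution N H Ω p u) {ε : ℝ} (hε : 0 < ε) :
    ∫ x in Ω, softTruncDeriv ε (u x) * H (gradient u x) ^ N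
      = ∫ x in Ω, u x ^ p * softTrunc ε (u x) := by
  have := hu.integral_truncation hnorm hreg hN hΩo hΩb hε (F := id) isOpen_univ (subset_univ _)
    contDiff_id.contDiffOn rfl
  simpa using this

lemma integrableOn_energy (hnorm : IsFinslerNorm N H) (hreg : FinslerRegular N H)
    (hN : 2 ≤ N) (hΩo : IsOpen Ω) (hΩb : Bornology.IsBounded Ω) (hp : 1 < p)
    (hu : IsLeastEnergySolution N H Ω p u) :
    IntegrableOn (fun x => H (gradient u x) ^ N) Ω := by
  set ε : ℕ → ℝ := fun k => 1 / ((k : ℝ) + 1) with hε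
  have hε0 : ∀ k, 0 < ε k := fun k => by positivity
  have hK : ∀ k, MeasurableSet {x ∈ closure Ω | 4 * ε k ≤ u x} := fun k =>
    (hu.isCompact_superlevel hΩb _).measurableSet
  have hcov : AECover (volume.restrict Ω) atTop fun k => {x ∈ closure Ω | 4 * ε k ≤ u x} := by
    refine ⟨?_, hK⟩
    filter_upwards [ae_restrict_mem hΩo.measurableSet] with x hx
    have h1 : Tendsto (fun k => 4 * ε k) atTop (𝓝 0) := by
      simpa [hε] using tendsto_one_div_nat_succ.const_mul 4
    filter_upwards [h1.eventually (gt_mem_nhds (hu.2.1 x hx))] with k hk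
    exact ⟨subset_closure hx, hk.le⟩
  have hnn : ∀ x, 0 ≤ H (gradient u x) ^ N := fun x => pow_nonneg (hnorm.nonneg _) _
  have hcont := hu.continuousOn_energy hnorm hΩo
  refine hcov.integrable_of_integral_bounded_of_nonneg_ae (2 * ∫ x in Ω, u x ^ (p + 1))
    (fun k => ?_) (Eventually.of_forall hnn) (Eventually.of_forall fun k => ?_)
  · exact ((hcont.mono (hu.superlevel_subset hΩo (by linarith [hε0 k]))).integrableOn_compact
      (hu.isCompact_superlevel hΩb _)).mono_measure Measure.restrict_le_self
  · have hintg : IntegrableOn (fun x => softTruncDeriv (ε k) (u x) * H (gradient u x) ^ N) Ω :=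
      hu.integrableOn_mul_softTruncDeriv hΩo hΩb (hε0 k) hcont
    calc ∫ x in {x ∈ closure Ω | 4 * ε k ≤ u x}, H (gradient u x) ^ N ∂(volume.restrict Ω)
        ≤ ∫ x in {x ∈ closure Ω | 4 * ε k ≤ u x},
            2 * (softTruncDeriv (ε k) (u x) * H (gradient u x) ^ N) ∂(volume.restrict Ω) := by
          refine integral_mono_of_nonneg (Eventually.of_forall hnn)
            ((hintg.const_mul 2).mono_measure Measure.restrict_le_self) ?_
          filter_upwards [ae_restrict_mem (hK k)] with x hx
          have := half_le_softTruncDeriv (hε0 k) hx.2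
          have h2 := hnn x
          nlinarith
      _ ≤ ∫ x in Ω, 2 * (softTruncDeriv (ε k) (u x) * H (gradient u x) ^ N) :=
          setIntegral_le_integral (hintg.const_mul 2) (Eventually.of_forall fun x =>
            mul_nonneg two_pos.le (mul_nonneg (softTruncDeriv_nonneg _ _) (hnn x)))
      _ = 2 * ∫ x in Ω, u x ^ p * softTrunc (ε k) (u x) := by
          rw [integral_const_mul,
            hu.integral_softTrunc_energy hnorm hreg hN hΩo hΩb (hε0 k)]
      _ ≤ _ := by
          refine mul_le_mul_of_nonneg_left ?_ two_pos.le
          refine integral_mono_of_nonneg ?_ (hu.integrableOn_rpow hΩo hΩb (by linarith)) ?_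
          · filter_upwards [ae_restrict_mem hΩo.measurableSet] with x hx
            exact mul_nonneg (Real.rpow_nonneg (hu.2.1 x hx).le _) (softTrunc_nonneg _)
          · filter_upwards [ae_restrict_mem hΩo.measurableSet] with x hx
            exact hu.mul_softTrunc_le (hε0 k) hx

lemma integral_energy (hnorm : IsFinslerNorm N H) (hreg : FinslerRegular N H)
    (hN : 2 ≤ N) (hΩo : IsOpen Ω) (hΩb : Bornology.IsBounded Ω) (hp : 1 < p)
    (hu : IsLeastEnergySolution N H Ω p u) :
    ∫ x in Ω, H (gradient u x) ^ N = ∫ x in Ω, u x ^ (p + 1) := by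
  have hintg := hu.integrableOn_energy hnorm hreg hN hΩo hΩb hp
  set ε : ℕ → ℝ := fun k => 1 / ((k : ℝ) + 1) with hε
  have hε0 : ∀ k, 0 < ε k := fun k => by positivity
  have hnn : ∀ x, 0 ≤ H (gradient u x) ^ N := fun x => pow_nonneg (hnorm.nonneg _) _
  have h1 : Tendsto (fun k => ∫ x in Ω, softTruncDeriv (ε k) (u x) * H (gradient u x) ^ N) atTop
      (𝓝 (∫ x in Ω, H (gradient u x) ^ N)) := by
    refine tendsto_integral_of_dominated_convergence (fun x => H (gradient u x) ^ N)
      (fun k => (hu.integrableOn_mul_softTruncDeriv hΩo hΩb (hε0 k)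
        (hu.continuousOn_energy hnorm hΩo)).aestronglyMeasurable) hintg
      (fun k => Eventually.of_forall fun x => ?_) ?_
    · rw [Real.norm_eq_abs, abs_of_nonneg (mul_nonneg (softTruncDeriv_nonneg _ _) (hnn x))]
      exact mul_le_of_le_one_left (hnn x) (softTruncDeriv_le_one _ _)
    · filter_upwards [ae_restrict_mem hΩo.measurableSet] with x hx
      simpa [hε] using (tendsto_softTruncDeriv tendsto_one_div_nat_succ (hu.2.1 x hx)).mul_const
        (H (gradient u x) ^ N)
  have h2 : Tendsto (fun k => ∫ x in Ω, u x ^ p * softTrunc (ε k) (u x)) atTop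
      (𝓝 (∫ x in Ω, u x ^ (p + 1))) := by
    refine tendsto_integral_of_dominated_convergence (fun x => u x ^ (p + 1))
      (fun k => (hu.continuousOn_mul_softTrunc (hε0 k)).aestronglyMeasurable hΩo.measurableSet)
      (hu.integrableOn_rpow hΩo hΩb (by linarith)) (fun k => ?_) ?_
    · filter_upwards [ae_restrict_mem hΩo.measurableSet] with x hx
      rw [Real.norm_eq_abs, abs_of_nonneg (mul_nonneg (Real.rpow_nonneg (hu.2.1 x hx).le _)
        (softTrunc_nonneg _))]
      exact hu.mul_softTrunc_le (hε0 k) hx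
    · filter_upwards [ae_restrict_mem hΩo.measurableSet] with x hx
      rw [Real.rpow_add_one (hu.2.1 x hx).ne']
      exact (tendsto_softTrunc tendsto_one_div_nat_succ (hu.2.1 x hx).le).const_mul _
  refine tendsto_nhds_unique h1 (h2.congr fun k => ?_)
  exact (hu.integral_softTrunc_energy hnorm hreg hN hΩo hΩb (hε0 k)).symm

end IsLeastEnergySolution

lemma hasDerivAt_one_add_div_rpow {c : ℝ} (hc : 0 < c) (b : ℝ) {t : ℝ} (ht : -c < t) :
    HasDerivAt (fun t : ℝ => (1 + t / c) ^ b) (b / c * (1 + t / c) ^ (b - 1)) t := by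
  have h0 : 0 < 1 + t / c := by
    have : -1 < t / c := by rw [lt_div_iff₀ hc]; linarith
    linarith
  have h1 : HasDerivAt (fun t : ℝ => 1 + t / c) (1 / c) t :=
    ((hasDerivAt_id t).div_const c).const_add 1
  exact (h1.rpow_const (p := b) (Or.inl h0.ne')).congr_deriv (by ring)

lemma contDiffOn_one_add_div_rpow {c : ℝ} (hc : 0 < c) (b : ℝ) :
    ContDiffOn ℝ 1 (fun t : ℝ => (1 + t / c) ^ b) (Ioi (-c)) := by
  refine ContDiffOn.rpow_const_of_ne (by fun_prop) fun t ht => ?_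
  have : -1 < t / c := by rw [lt_div_iff₀ hc]; linarith [mem_Ioi.1 ht]
  linarith

namespace IsLeastEnergySolution

variable {N : ℕ} {H : Euc N → ℝ} {Ω : Set (Euc N)}

/-- All `L^Q` norms of the normalized solutions are bounded uniformly in the exponent. -/
lemma exists_integral_rpow_le (hnorm : IsFinslerNorm N H) (hreg : FinslerRegular N H)
    (hN : 2 ≤ N) (hΩo : IsOpen Ω) (hΩb : Bornology.IsBounded Ω) (hΩne : Ω.Nonempty)
    {Q : ℝ} (hQ : 1 ≤ Q) :
    ∃ C > 0, ∀ (p : ℝ) (u : Euc N → ℝ), 1 < p → IsLeastEnergySolution N H Ω p u →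
      ∫ x in Ω, u x ^ Q ≤ C * ((∫ x in Ω, u x ^ p) ^ (1 / ((N : ℝ) - 1))) ^ Q := by
  obtain ⟨C, hC1, hC⟩ := exists_sobolev N hN hnorm
  have hN2 : (2 : ℝ) ≤ N := by exact_mod_cast hN
  set B : ℝ := volume.real Ω * (C * (4 * Q)) ^ (4 * Q) with hB
  have hB0 : 0 ≤ B := by positivity
  refine ⟨2 ^ (4 * Q) * (volume.real Ω + B) + 1, by positivity, fun p u hp hu => ?_⟩
  set I : ℝ := ∫ x in Ω, u x ^ p with hI
  have hI0 : 0 < I := hu.integral_rpow_pos hΩo hΩb hΩne (by linarith)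
  set c : ℝ := I ^ (1 / ((N : ℝ) - 1)) with hc
  have hc0 : 0 < c := by positivity
  have hcN : c ^ (N - 1) = I := by
    rw [hc, ← Real.rpow_natCast, ← Real.rpow_mul hI0.le, Nat.cast_sub (by omega), Nat.cast_one,
      one_div_mul_cancel (by linarith), Real.rpow_one]
  set a : ℝ := 3 * N / 4 - 1 with ha
  have ha0 : 1 / 2 ≤ a := by linarith
  set F : ℝ → ℝ := fun t => 1 - (1 + t / c) ^ (-a) with hF
  set W : ℝ → ℝ := fun t => (1 + t / c) ^ (1 / 4 : ℝ) - 1 with hW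
  have hO' : Ici 0 ⊆ Ioi (-c) := fun t ht =>
    lt_of_lt_of_le (neg_lt_zero.2 hc0) (mem_Ici.1 ht)
  have hFs : ContDiffOn ℝ 1 F (Ioi (-c)) := contDiffOn_const.sub (contDiffOn_one_add_div_rpow hc0 _)
  have hWs : ContDiffOn ℝ 1 W (Ioi (-c)) := (contDiffOn_one_add_div_rpow hc0 _).sub contDiffOn_const
  have hFd : ∀ t, 0 ≤ t → deriv F t = a / c * (1 + t / c) ^ (-(3 * N / 4) : ℝ) := fun t ht => by
    have := ((hasDerivAt_one_add_div_rpow hc0 (-a) (t := t) (by linarith)).const_sub 1).deriv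
    rw [hF, this, ha]; ring_nf
  have hWd : ∀ t, 0 ≤ t → deriv W t = 1 / 4 / c * (1 + t / c) ^ (-(3 / 4) : ℝ) := fun t ht => by
    have := ((hasDerivAt_one_add_div_rpow hc0 (1 / 4) (t := t) (by linarith)).sub_const 1).deriv
    rw [hW, this]; norm_num
  have hWF : ∀ t, 0 ≤ t → deriv W t ^ N ≤ I⁻¹ * deriv F t := fun t ht => by
    rw [hFd t ht, hWd t ht, mul_pow, ← Real.rpow_natCast (_ ^ _) N,
      ← Real.rpow_mul (by positivity), div_pow,
      show -(3 / 4 : ℝ) * N = -(3 * N / 4) by ring, ← mul_assoc]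
    refine mul_le_mul_of_nonneg_right ?_ (by positivity)
    have e : c ^ N = c * I := by rw [← hcN, ← pow_succ']; congr 1; omega
    rw [e, inv_mul_eq_div, div_div]
    refine div_le_div_of_nonneg_right ?_ (by positivity)
    have : (1 / 4 : ℝ) ^ N ≤ (1 / 4) ^ 1 :=
      pow_le_pow_of_le_one (by norm_num) (by norm_num) (by omega)
    linarith
  have key : ∀ ε : ℝ, 0 < ε →
      ∫ x in Ω, softTrunc ε (u x) ^ Q ≤ c ^ Q * (2 ^ (4 * Q) * (volume.real Ω + B)) := by
    intro ε hε
    obtain ⟨w, hw1, hw2, hw3, hw4, hw5, hw6⟩ :=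
      hu.truncation hΩo hΩb hε (F := W) isOpen_Ioi hO' hWs (by simp [hW])
    have hF0 : F 0 = 0 := by simp [hF]
    have hFI := hu.integral_truncation hnorm hreg hN hΩo hΩb hε (F := F) isOpen_Ioi hO' hFs hF0
    have hone : ∀ x, 1 ≤ 1 + softTrunc ε (u x) / c := fun x => by
      have : 0 ≤ softTrunc ε (u x) / c := div_nonneg (softTrunc_nonneg _) hc0.le
      linarith
    have hw0 : ∀ x, 0 ≤ w x := by
      intro x
      by_cases hx : x ∈ Ω
      · rw [hw4 x hx]
        exact sub_nonneg.2 (Real.one_le_rpow (hone x) (by norm_num))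
      · rw [hw5 x hx]
    have hFcont : ContinuousOn (fun x => u x ^ p * F (softTrunc ε (u x))) Ω :=
      (hu.continuousOn_rpow p).mul (hFs.continuousOn.comp
        ((contDiff_softTrunc hε).continuous.comp_continuousOn hu.contDiffOn.continuousOn)
        fun x _ => hO' (softTrunc_nonneg _))
    have hF1 : ∫ x in Ω, u x ^ p * F (softTrunc ε (u x)) ≤ I := by
      refine integral_mono_of_nonneg ?_ (hu.integrableOn_rpow hΩo hΩb (by linarith)) ?_
      · filter_upwards [ae_restrict_mem hΩo.measurableSet] with x hx
        refine mul_nonneg (Real.rpow_nonneg (hu.2.1 x hx).le _) (sub_nonneg.2 ?_)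
        exact Real.rpow_le_one_of_one_le_of_nonpos (hone x) (by linarith)
      · filter_upwards [ae_restrict_mem hΩo.measurableSet] with x hx
        refine mul_le_of_le_one_right (Real.rpow_nonneg (hu.2.1 x hx).le _) ?_
        have := Real.rpow_nonneg (zero_le_one.trans (hone x)) (-a)
        simp only [hF]; linarith
    have hFdc : ContinuousOn (fun x => deriv F (softTrunc ε (u x)) * H (gradient u x) ^ N) Ω := by
      refine ContinuousOn.mul ?_ (hu.continuousOn_energy hnorm hΩo)
      refine ((hFs.continuousOn_deriv_of_isOpen isOpen_Ioi le_rfl).comp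
        ((contDiff_softTrunc hε).continuous.comp_continuousOn hu.contDiffOn.continuousOn)
        fun x _ => hO' (softTrunc_nonneg _))
    have hE : ∫ x in Ω, H (gradient w x) ^ N ≤ 1 := by
      calc ∫ x in Ω, H (gradient w x) ^ N
          ≤ ∫ x in Ω, I⁻¹ * (softTruncDeriv ε (u x) *
              (deriv F (softTrunc ε (u x)) * H (gradient u x) ^ N)) := by
            refine integral_mono_of_nonneg (Eventually.of_forall fun x =>
              pow_nonneg (hnorm.nonneg _) _)
              ((hu.integrableOn_mul_softTruncDeriv hΩo hΩb hε hFdc).const_mul _) ?_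
            filter_upwards [ae_restrict_mem hΩo.measurableSet] with x hx
            have hg0 := softTruncDeriv_nonneg ε (u x)
            have hg1 := softTruncDeriv_le_one ε (u x)
            have hs0 := softTrunc_nonneg (ε := ε) (u x)
            have hW0 : 0 ≤ deriv W (softTrunc ε (u x)) := by rw [hWd _ hs0]; positivity
            have hwf := hWF _ hs0
            rw [hw6 x hx, hnorm.smul, abs_of_nonneg (mul_nonneg hW0 hg0), mul_pow, mul_pow]
            have hgN : softTruncDeriv ε (u x) ^ N ≤ softTruncDeriv ε (u x) :=
              pow_le_of_le_one hg0 hg1 (by omega)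
            have hHN : 0 ≤ H (gradient u x) ^ N := pow_nonneg (hnorm.nonneg _) _
            calc _ ≤ I⁻¹ * deriv F (softTrunc ε (u x)) * softTruncDeriv ε (u x) *
                    H (gradient u x) ^ N := by
                  refine mul_le_mul_of_nonneg_right ?_ hHN
                  exact mul_le_mul hwf hgN (pow_nonneg hg0 _) ((pow_nonneg hW0 _).trans hwf)
              _ = _ := by ring
        _ = I⁻¹ * ∫ x in Ω, u x ^ p * F (softTrunc ε (u x)) := by
            rw [integral_const_mul, ← hFI]
            congr 1
            exact integral_congr_ae (Eventually.of_forall fun x => by ring)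
        _ ≤ I⁻¹ * I := mul_le_mul_of_nonneg_left hF1 (by positivity)
        _ = 1 := inv_mul_cancel₀ hI0.ne'
    have hS := hC Ω hΩo hΩb w hw1 hw2 hw3 hw0 (4 * Q) (by linarith)
    have hS' : ∫ x in Ω, w x ^ (4 * Q) ≤ B := by
      refine hS.trans (mul_le_of_le_one_right hB0 ?_)
      exact Real.rpow_le_one (integral_nonneg fun x => pow_nonneg (hnorm.nonneg _) _) hE
        (by positivity)
    have hwi : IntegrableOn (fun x => w x ^ (4 * Q)) Ω := by
      refine ((hw1.continuous.rpow_const fun x => Or.inr (by positivity)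
        ).integrable_of_hasCompactSupport ?_).integrableOn
      exact hw2.mono fun x hx => by
        contrapose! hx
        simp only [Function.mem_support, not_not] at hx ⊢
        rw [hx, Real.zero_rpow (by positivity)]
    have hci : IntegrableOn (fun _ : Euc N => (1 : ℝ)) Ω := integrableOn_const hΩb.measure_lt_top.ne
    calc ∫ x in Ω, softTrunc ε (u x) ^ Q
        ≤ ∫ x in Ω, c ^ Q * (2 ^ (4 * Q) * (1 + w x ^ (4 * Q))) := by
          refine integral_mono_of_nonneg (Eventually.of_forall fun x =>
            Real.rpow_nonneg (softTrunc_nonneg _) _) (((hci.add hwi).const_mul _).const_mul _) ?_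
          filter_upwards [ae_restrict_mem hΩo.measurableSet] with x hx
          have hg := softTrunc_nonneg (ε := ε) (u x)
          have e1 : 1 + w x = (1 + softTrunc ε (u x) / c) ^ (1 / 4 : ℝ) := by
            rw [hw4 x hx, hW]; ring
          have e2 : softTrunc ε (u x) / c ≤ (1 + w x) ^ (4 : ℝ) := by
            rw [e1, ← Real.rpow_mul (by linarith [hone x])]; norm_num
          have e3 : (softTrunc ε (u x) / c) ^ Q ≤ 2 ^ (4 * Q) * (1 + w x ^ (4 * Q)) := by
            calc (softTrunc ε (u x) / c) ^ Q ≤ ((1 + w x) ^ (4 : ℝ)) ^ Q :=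
                  Real.rpow_le_rpow (div_nonneg hg hc0.le) e2 (by linarith)
              _ = (1 + w x) ^ (4 * Q) := (Real.rpow_mul (by linarith [hw0 x]) _ _).symm
              _ ≤ (2 * max 1 (w x)) ^ (4 * Q) := by
                  refine Real.rpow_le_rpow (by linarith [hw0 x]) ?_ (by positivity)
                  linarith [le_max_left 1 (w x), le_max_right 1 (w x)]
              _ = 2 ^ (4 * Q) * max 1 (w x) ^ (4 * Q) :=
                  Real.mul_rpow two_pos.le (by positivity)
              _ ≤ _ := by
                  refine mul_le_mul_of_nonneg_left ?_ (by positivity)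
                  have := Real.rpow_nonneg (hw0 x) (4 * Q)
                  rcases le_total 1 (w x) with h | h
                  · rw [max_eq_right h]; linarith
                  · rw [max_eq_left h, Real.one_rpow]; linarith
          rw [Real.div_rpow hg hc0.le, div_le_iff₀ (by positivity)] at e3
          linarith
      _ = c ^ Q * (2 ^ (4 * Q) * (volume.real Ω + ∫ x in Ω, w x ^ (4 * Q))) := by
          rw [integral_const_mul, integral_const_mul, integral_add hci hwi]
          simp
      _ ≤ _ := by gcongr
  have hlim : Tendsto (fun k : ℕ => ∫ x in Ω, softTrunc (1 / ((k : ℝ) + 1)) (u x) ^ Q) atTop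
      (𝓝 (∫ x in Ω, u x ^ Q)) := by
    have hε0 : ∀ k : ℕ, 0 < 1 / ((k : ℝ) + 1) := fun k => by positivity
    refine tendsto_integral_of_dominated_convergence (fun x => u x ^ Q)
      (fun k => ?_) (hu.integrableOn_rpow hΩo hΩb (by linarith)) (fun k => ?_) ?_
    · exact (((contDiff_softTrunc (hε0 k)).continuous.comp_continuousOn
        hu.contDiffOn.continuousOn).rpow_const fun x _ => Or.inr (by linarith)
        ).aestronglyMeasurable hΩo.measurableSet
    · filter_upwards [ae_restrict_mem hΩo.measurableSet] with x hx
      rw [Real.norm_eq_abs, abs_of_nonneg (Real.rpow_nonneg (softTrunc_nonneg _) _)]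
      exact Real.rpow_le_rpow (softTrunc_nonneg _) (softTrunc_le (hε0 k) (hu.2.1 x hx).le)
        (by linarith)
    · filter_upwards [ae_restrict_mem hΩo.measurableSet] with x hx
      exact (tendsto_softTrunc tendsto_one_div_nat_succ (hu.2.1 x hx).le).rpow_const
        (Or.inr (by linarith))
  have hle := le_of_tendsto' hlim fun k : ℕ => key (1 / ((k : ℝ) + 1)) (by positivity)
  have hcQ : 0 < c ^ Q := by positivity
  linarith

end IsLeastEnergySolution

lemma gradient_sum {N : ℕ} {ι : Type*} (s : Finset ι) {f : ι → Euc N → ℝ} {x : Euc N}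
    (hf : ∀ i ∈ s, DifferentiableAt ℝ (f i) x) :
    gradient (fun y => ∑ i ∈ s, f i y) x = ∑ i ∈ s, gradient (f i) x := by
  simp [gradient, fderiv_fun_sum hf]

lemma gradient_comp_dilation {N : ℕ} {f : Euc N → ℝ} (s : ℝ) (x₀ x : Euc N) :
    gradient (fun y => f (s • (y - x₀))) x = s • gradient f (s • (x - x₀)) := by
  have h1 := fderiv_comp_smul (𝕜 := ℝ) (f := f) (x := x - x₀) s
  have h2 := fderiv_comp_sub (𝕜 := ℝ) (f := fun z => f (s • z)) (x := x) x₀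
  simp only [gradient, h2, h1, map_smul]

lemma IsFinslerNorm.pow_sum_le {N : ℕ} (hN : N ≠ 0) {H : Euc N → ℝ} (h : IsFinslerNorm N H)
    {ι : Type*} (s : Finset ι) (a : ι → Euc N)
    (ha : ∀ i ∈ s, ∀ j ∈ s, a i ≠ 0 → a j ≠ 0 → i = j) :
    H (∑ i ∈ s, a i) ^ N ≤ ∑ i ∈ s, H (a i) ^ N := by
  by_cases h0 : ∀ i ∈ s, a i = 0
  · rw [Finset.sum_eq_zero h0, h.map_zero, zero_pow hN]
    exact Finset.sum_nonneg fun i _ => pow_nonneg (h.nonneg _) _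
  · push Not at h0
    obtain ⟨i, hi, hai⟩ := h0
    rw [Finset.sum_eq_single i (fun j hj hji => by
      by_contra haj; exact hji (ha j hj i hi haj hai)) fun h => absurd hi h]
    exact Finset.single_le_sum (f := fun i => H (a i) ^ N)
      (fun j _ => pow_nonneg (h.nonneg _) _) hi

/-- The energy levels decay like `p ^ (1 - N)`, by testing with truncated logarithms. -/
lemma exists_energyInf_le (N : ℕ) (hN : 2 ≤ N) {H : Euc N → ℝ} (hnorm : IsFinslerNorm N H)
    {Ω : Set (Euc N)} (hΩo : IsOpen Ω) (hΩne : Ω.Nonempty) :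
    ∃ C > 0, ∀ p : ℝ, (N : ℝ) ≤ p → energyInf N H Ω p ≤ C * p ^ (1 - (N : ℝ)) := by
  obtain ⟨x₀, hx₀⟩ := hΩne
  obtain ⟨R', hR', hball'⟩ := Metric.isOpen_iff.1 hΩo x₀ hx₀
  set R : ℝ := R' / 4 with hRdef
  have hR : 0 < R := by positivity
  have hball : Metric.closedBall x₀ (2 * R) ⊆ Ω :=
    (Metric.closedBall_subset_ball (by linarith)).trans hball'
  let b : ContDiffBump (0 : Euc N) := ⟨1, 2, one_pos, one_lt_two⟩
  set ψ : Euc N → ℝ := fun y => b y with hψ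
  have hψc : ContDiff ℝ (⊤ : ℕ∞) ψ := b.contDiff
  have hψ1 : ContDiff ℝ 1 ψ := hψc.of_le (by exact_mod_cast le_top)
  have hψg : ∀ y, gradient ψ y ≠ 0 → 1 ≤ ‖y‖ ∧ ‖y‖ ≤ 2 := by
    intro y hy
    constructor
    · by_contra! h
      refine hy ?_
      have : ψ =ᶠ[𝓝 y] fun _ => (1 : ℝ) := by
        filter_upwards [Metric.isOpen_ball.mem_nhds (mem_ball_zero_iff.2 h)] with z hz
        exact b.one_of_mem_closedBall (Metric.ball_subset_closedBall hz)
      simp [gradient, this.fderiv_eq]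
    · by_contra! h
      refine hy ?_
      refine gradient_eq_zero_of_notMem_tsupport fun h' => ?_
      rw [b.tsupport_eq] at h'
      have := mem_closedBall_zero_iff.1 h'
      exact absurd h (not_lt.2 this)
  have hgi : Integrable fun y => H (gradient ψ y) ^ N := by
    refine ((hnorm.continuous.comp (continuous_gradient hψ1)).pow N
      ).integrable_of_hasCompactSupport ?_
    refine (isCompact_closedBall (0 : Euc N) 2).of_isClosed_subset isClosed_closure
      (closure_minimal (fun y hy => mem_closedBall_zero_iff.2 (hψg y fun h0 => ?_).2)
        Metric.isClosed_closedBall)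
    simp [h0, hnorm.map_zero, show N ≠ 0 by omega] at hy
  set A : ℝ := ∫ y, H (gradient ψ y) ^ N with hA
  have hA0 : 0 ≤ A := integral_nonneg fun y => pow_nonneg (hnorm.nonneg _) _
  set κ : ℝ := volume.real (Metric.ball (0 : Euc N) 1) with hκ
  have hκ0 : 0 < κ := ENNReal.toReal_pos (Metric.measure_ball_pos _ _ one_pos).ne'
    measure_ball_lt_top.ne
  set m : ℝ := min 1 (κ * R ^ N) with hm
  have hm0 : 0 < m := lt_min one_pos (by positivity)
  have hm1 : m ≤ 1 := min_le_left _ _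
  refine ⟨(A + 1) / (m * (4 : ℝ) ^ (-((N : ℝ) ^ 2))), by positivity, fun p hp => ?_⟩
  have hN2 : (2 : ℝ) ≤ N := by exact_mod_cast hN
  have hp0 : 0 < p := by linarith
  set K : ℕ := ⌈p⌉₊ with hK
  have hpK : p ≤ K := Nat.le_ceil p
  have hKp : (K : ℝ) ≤ p + 1 := (Nat.ceil_lt_add_one hp0.le).le
  have hK0 : (0 : ℝ) < K := by linarith
  set s : ℕ → ℝ := fun k => 4 ^ k * R⁻¹ with hs
  have hs0 : ∀ k, 0 < s k := fun k => by positivity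
  set f : ℕ → Euc N → ℝ := fun k x => ψ (s k • (x - x₀)) with hf
  have hfc : ∀ k, ContDiff ℝ (⊤ : ℕ∞) (f k) := fun k =>
    hψc.comp (contDiff_const_smul (s k) |>.comp (contDiff_id.sub contDiff_const))
  have hfd : ∀ k x, DifferentiableAt ℝ (f k) x := fun k x =>
    ((hfc k).differentiable (by simp)) x
  have hfg : ∀ k x, gradient (f k) x = s k • gradient ψ (s k • (x - x₀)) := fun k x =>
    gradient_comp_dilation _ _ _
  set φ : Euc N → ℝ := fun x => (K : ℝ)⁻¹ * ∑ k ∈ Finset.range K, f k x with hφ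
  have hφc : ContDiff ℝ (⊤ : ℕ∞) φ := contDiff_const.mul (ContDiff.sum fun k _ => hfc k)
  have hφ0 : ∀ x, 0 ≤ φ x := fun x =>
    mul_nonneg (by positivity) (Finset.sum_nonneg fun k _ => b.nonneg)
  have hns : ∀ k x, ‖s k • (x - x₀)‖ = 4 ^ k / R * ‖x - x₀‖ := fun k x => by
    rw [norm_smul, Real.norm_eq_abs, abs_of_pos (hs0 k)]; rfl
  have hφsupp : tsupport φ ⊆ Metric.closedBall x₀ (2 * R) := by
    refine closure_minimal (fun x hx => ?_) Metric.isClosed_closedBall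
    by_contra hx2
    refine hx ?_
    rw [mem_closedBall_iff_norm, not_le] at hx2
    simp only [hφ]
    rw [Finset.sum_eq_zero fun k _ => ?_, mul_zero]
    refine b.zero_of_le_dist ?_
    rw [dist_zero_right, hns]
    change (2 : ℝ) ≤ _
    have h4 : (1 : ℝ) ≤ 4 ^ k := one_le_pow₀ (by norm_num)
    rw [div_mul_eq_mul_div, le_div_iff₀ hR]
    nlinarith
  have hφcs : HasCompactSupport φ :=
    (isCompact_closedBall _ _).of_isClosed_subset (isClosed_tsupport _) hφsupp
  have h1 := energyInf_mul_le hnorm hΩo hp0 (by omega) (hφc.of_le (by exact_mod_cast le_top)) hφcs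
    (hφsupp.trans hball)
  have hgrad : ∀ x, gradient φ x = (K : ℝ)⁻¹ • ∑ k ∈ Finset.range K, gradient (f k) x := by
    intro x
    rw [← gradient_sum _ fun k _ => hfd k x]
    exact gradient_const_mul _ (DifferentiableAt.fun_sum fun k _ => hfd k x)
  have hfi : ∀ k, Integrable (fun x => H (gradient (f k) x) ^ N) ∧
      ∫ x, H (gradient (f k) x) ^ N = A := by
    intro k
    have e : (fun x => H (gradient (f k) x) ^ N)
        = fun x => s k ^ N * H (gradient ψ (s k • (x - x₀))) ^ N := by
      funext x
      rw [hfg, hnorm.smul, abs_of_pos (hs0 k), mul_pow]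
    rw [e]
    refine ⟨((hgi.comp_smul (hs0 k).ne').comp_sub_right x₀).const_mul _, ?_⟩
    rw [integral_const_mul, integral_sub_right_eq_self
        (fun x => H (gradient ψ (s k • x)) ^ N) x₀,
      Measure.integral_comp_smul volume (fun x => H (gradient ψ x) ^ N) (s k)]
    have := hs0 k
    rw [finrank_euclideanSpace_fin, abs_of_pos (by positivity), smul_eq_mul, ← mul_assoc,
      mul_inv_cancel₀ (by positivity), one_mul]
  have hdisj : ∀ x : Euc N, ∀ i j : ℕ, i < j → gradient (f i) x ≠ 0 → gradient (f j) x ≠ 0 →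
      False := by
    intro x i j hij hi hj
    rw [hfg] at hi hj
    have a1 := (hψg _ (right_ne_zero_of_smul hi)).1
    have a2 := (hψg _ (right_ne_zero_of_smul hj)).2
    rw [hns] at a1 a2
    have : (4 : ℝ) ^ j = 4 ^ i * 4 ^ (j - i) := by rw [← pow_add]; congr 1; omega
    have h4 : (4 : ℝ) ≤ 4 ^ (j - i) := le_self_pow₀ (by norm_num) (by omega)
    rw [this, mul_div_right_comm, mul_right_comm] at a2
    nlinarith
  have h2 : ∫ x in Ω, H (gradient φ x) ^ N ≤ A * (K : ℝ) ^ (1 - (N : ℝ)) := by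
    have hsum : Integrable fun x => ∑ k ∈ Finset.range K, H (gradient (f k) x) ^ N :=
      integrable_finsetSum _ fun k _ => (hfi k).1
    calc ∫ x in Ω, H (gradient φ x) ^ N
        ≤ ∫ x in Ω, (K : ℝ)⁻¹ ^ N * ∑ k ∈ Finset.range K, H (gradient (f k) x) ^ N := by
          refine integral_mono_of_nonneg (Eventually.of_forall fun x =>
            pow_nonneg (hnorm.nonneg _) _) (hsum.const_mul _).integrableOn
            (Eventually.of_forall fun x => ?_)
          simp only []
          rw [hgrad, hnorm.smul, abs_of_pos (by positivity), mul_pow]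
          refine mul_le_mul_of_nonneg_left (hnorm.pow_sum_le (by omega) _ _ ?_) (by positivity)
          intro i _ j _ hi hj
          rcases lt_trichotomy i j with h | h | h
          · exact (hdisj x i j h hi hj).elim
          · exact h
          · exact (hdisj x j i h hj hi).elim
      _ ≤ ∫ x, (K : ℝ)⁻¹ ^ N * ∑ k ∈ Finset.range K, H (gradient (f k) x) ^ N :=
          setIntegral_le_integral (hsum.const_mul _) (Eventually.of_forall fun x =>
            mul_nonneg (by positivity) (Finset.sum_nonneg fun k _ => pow_nonneg (hnorm.nonneg _) _))
      _ = A * (K : ℝ) ^ (1 - (N : ℝ)) := by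
          rw [integral_const_mul, integral_finsetSum _ fun k _ => (hfi k).1,
            Finset.sum_congr rfl fun k _ => (hfi k).2, Finset.sum_const, Finset.card_range,
            nsmul_eq_mul, Real.rpow_sub hK0, Real.rpow_one, Real.rpow_natCast, inv_pow]
          field_simp
  have h3 : m * (4 : ℝ) ^ (-((N : ℝ) ^ 2))
      ≤ (∫ x in Ω, |φ x| ^ (p + 1)) ^ ((N : ℝ) / (p + 1)) := by
    set ρ : ℝ := R * (4 ^ K)⁻¹ with hρ
    have hρ0 : 0 < ρ := by positivity
    have hbs : Metric.ball x₀ ρ ⊆ Ω := by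
      refine Subset.trans ?_ hball
      refine (Metric.ball_subset_ball ?_).trans Metric.ball_subset_closedBall
      have : ((4 : ℝ) ^ K)⁻¹ ≤ 1 := inv_le_one_of_one_le₀ (one_le_pow₀ (by norm_num))
      rw [hρ]; nlinarith
    have hone : ∀ x ∈ Metric.ball x₀ ρ, φ x = 1 := by
      intro x hx
      have : ∀ k ∈ Finset.range K, f k x = 1 := fun k hk => by
        refine b.one_of_mem_closedBall ?_
        rw [mem_closedBall_zero_iff, hns]
        change _ ≤ (1 : ℝ)
        have hx' : ‖x - x₀‖ < R * (4 ^ K)⁻¹ := mem_ball_iff_norm.1 hx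
        have : (4 : ℝ) ^ k ≤ 4 ^ K :=
          pow_le_pow_right₀ (by norm_num) (Finset.mem_range.1 hk).le
        calc 4 ^ k / R * ‖x - x₀‖ ≤ 4 ^ K / R * (R * (4 ^ K)⁻¹) := by gcongr
          _ = 1 := by field_simp
      simp only [hφ]
      rw [Finset.sum_congr rfl this]
      simp [hK0.ne']
    have hvol : κ * R ^ N * ((4 : ℝ) ^ K)⁻¹ ^ N ≤ ∫ x in Ω, |φ x| ^ (p + 1) := by
      have e1 : volume.real (Metric.ball x₀ ρ) = κ * R ^ N * ((4 : ℝ) ^ K)⁻¹ ^ N := by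
        rw [Measure.real, Measure.addHaar_ball_of_pos _ _ hρ0, ENNReal.toReal_mul,
          ENNReal.toReal_ofReal (by positivity), finrank_euclideanSpace_fin, hρ, mul_pow, hκ,
          Measure.real]
        ring
      have hintg : Integrable fun x => |φ x| ^ (p + 1) := by
        refine (hφc.continuous.abs.rpow_const fun x => Or.inr (by linarith)
          ).integrable_of_hasCompactSupport (hφcs.mono fun x hx => ?_)
        contrapose! hx
        simp only [Function.mem_support, not_not] at hx ⊢
        rw [hx, abs_zero, Real.zero_rpow (by linarith)]
      calc _ = ∫ x in Metric.ball x₀ ρ, |φ x| ^ (p + 1) := by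
            rw [setIntegral_congr_fun (g := fun _ => (1 : ℝ)) measurableSet_ball fun x hx => by
              simp [hone x hx]]
            rw [← e1]; simp
        _ ≤ _ := setIntegral_mono_set hintg.integrableOn
            (Eventually.of_forall fun x => by positivity) (Eventually.of_forall hbs)
    have hNp : (N : ℝ) / (p + 1) ≤ 1 := by rw [div_le_one (by linarith)]; linarith
    have hNp0 : 0 ≤ (N : ℝ) / (p + 1) := by positivity
    calc m * (4 : ℝ) ^ (-((N : ℝ) ^ 2))
        ≤ m ^ ((N : ℝ) / (p + 1)) * (((4 : ℝ) ^ K)⁻¹ ^ N) ^ ((N : ℝ) / (p + 1)) := by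
          refine mul_le_mul ?_ ?_ (by positivity) (by positivity)
          · calc m = m ^ (1 : ℝ) := (Real.rpow_one m).symm
              _ ≤ _ := Real.rpow_le_rpow_of_exponent_ge hm0 hm1 hNp
          · rw [← Real.rpow_natCast 4 K, ← Real.rpow_neg (by norm_num), ← Real.rpow_natCast _ N,
              ← Real.rpow_mul (by norm_num), ← Real.rpow_mul (by norm_num)]
            refine Real.rpow_le_rpow_of_exponent_le (by norm_num) ?_
            have e2 : -(K : ℝ) * (N * (N / (p + 1))) = -(K / (p + 1) * (N : ℝ) ^ 2) := by ring
            have e3 : (K : ℝ) / (p + 1) ≤ 1 := (div_le_one (by linarith)).2 hKp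
            rw [e2]
            nlinarith [sq_nonneg (N : ℝ)]
      _ = (m * ((4 : ℝ) ^ K)⁻¹ ^ N) ^ ((N : ℝ) / (p + 1)) :=
          (Real.mul_rpow hm0.le (by positivity)).symm
      _ ≤ _ := by
          refine Real.rpow_le_rpow (by positivity) (le_trans ?_ hvol) hNp0
          exact mul_le_mul_of_nonneg_right (min_le_right _ _) (by positivity)
  have h4 : (K : ℝ) ^ (1 - (N : ℝ)) ≤ p ^ (1 - (N : ℝ)) :=
    Real.rpow_le_rpow_of_nonpos hp0 hpK (by linarith)
  rw [div_mul_eq_mul_div, le_div_iff₀ (by positivity)]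
  calc energyInf N H Ω p * (m * (4 : ℝ) ^ (-((N : ℝ) ^ 2)))
      ≤ energyInf N H Ω p * (∫ x in Ω, |φ x| ^ (p + 1)) ^ ((N : ℝ) / (p + 1)) :=
        mul_le_mul_of_nonneg_left h3 (energyInf_nonneg hnorm _ _)
    _ ≤ A * (K : ℝ) ^ (1 - (N : ℝ)) := h1.trans h2
    _ ≤ (A + 1) * p ^ (1 - (N : ℝ)) := by
        have : 0 < p ^ (1 - (N : ℝ)) := by positivity
        nlinarith

namespace IsLeastEnergySolution

variable {N : ℕ} {H : Euc N → ℝ} {Ω : Set (Euc N)}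

/-- Decay of the energy and of the total mass as the exponent tends to infinity. -/
lemma exists_energy_decay (hN : 2 ≤ N) (hnorm : IsFinslerNorm N H) (hreg : FinslerRegular N H)
    (hΩo : IsOpen Ω) (hΩb : Bornology.IsBounded Ω) (hΩne : Ω.Nonempty) :
    ∃ C ≥ 1, ∃ P ≥ (N : ℝ), ∀ (p : ℝ) (u : Euc N → ℝ), P ≤ p → IsLeastEnergySolution N H Ω p u →
      0 < (∫ x in Ω, u x ^ (p + 1)) ∧ (∫ x in Ω, u x ^ (p + 1)) ≤ 1 ∧
      (∫ x in Ω, u x ^ (p + 1)) ≤ C * p ^ (1 - (N : ℝ)) ∧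
      (∫ x in Ω, u x ^ p) ≤ C * (∫ x in Ω, u x ^ (p + 1)) ^ (p / (p + 1)) ∧
      (∫ x in Ω, u x ^ p) ≤ C * p ^ (1 - (N : ℝ)) := by
  obtain ⟨C₀, hC₀, hC⟩ := exists_energyInf_le N hN hnorm hΩo hΩne
  have hN2 : (2 : ℝ) ≤ N := by exact_mod_cast hN
  set V : ℝ := volume.real Ω with hV
  have hV0 : 0 ≤ V := measureReal_nonneg
  set C₁ : ℝ := max 1 C₀ with hC₁
  have hC₁1 : 1 ≤ C₁ := le_max_left _ _
  refine ⟨(1 + V) * (C₁ * 2 ^ ((N : ℝ) - 1)), ?_, max N C₁, le_max_left _ _,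
    fun p u hp hu => ?_⟩
  · have : (1 : ℝ) ≤ 2 ^ ((N : ℝ) - 1) := Real.one_le_rpow one_le_two (by linarith)
    nlinarith [mul_le_mul hC₁1 this zero_le_one (by linarith)]
  have hpN : (N : ℝ) ≤ p := (le_max_left _ _).trans hp
  have hpC : C₁ ≤ p := (le_max_right _ _).trans hp
  have hp0 : 0 < p := by linarith
  set E : ℝ := ∫ x in Ω, u x ^ (p + 1) with hE
  have hE0 : 0 < E := hu.integral_rpow_pos hΩo hΩb hΩne (by linarith)
  have hpN' : p ^ (1 - (N : ℝ)) ≤ p⁻¹ := by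
    rw [← Real.rpow_neg_one]
    exact Real.rpow_le_rpow_of_exponent_le (by linarith) (by linarith)
  have hEC : E ≤ C₀ * p ^ (1 - (N : ℝ)) * E ^ ((N : ℝ) / (p + 1)) := by
    calc E = ∫ x in Ω, H (gradient u x) ^ N :=
          (hu.integral_energy hnorm hreg hN hΩo hΩb (by linarith)).symm
      _ = energyInf N H Ω p * E ^ ((N : ℝ) / (p + 1)) := hu.2.2.2.2
      _ ≤ _ := mul_le_mul_of_nonneg_right (hC p hpN) (by positivity)
  have hEC' : E ≤ C₁ * p ^ (1 - (N : ℝ)) * E ^ ((N : ℝ) / (p + 1)) := by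
    refine hEC.trans (mul_le_mul_of_nonneg_right (mul_le_mul_of_nonneg_right (le_max_right _ _)
      (by positivity)) (by positivity))
  have hsm : C₁ * p ^ (1 - (N : ℝ)) ≤ 1 := by
    calc C₁ * p ^ (1 - (N : ℝ)) ≤ p * p⁻¹ := by gcongr
      _ = 1 := mul_inv_cancel₀ hp0.ne'
  have hNp : (N : ℝ) / (p + 1) < 1 := by rw [div_lt_one (by linarith)]; linarith
  have hE1 : E ≤ 1 := by
    by_contra! h
    have h1 : E ^ ((N : ℝ) / (p + 1)) < E ^ (1 : ℝ) := Real.rpow_lt_rpow_of_exponent_lt h hNp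
    rw [Real.rpow_one] at h1
    have h2 : 0 < E ^ ((N : ℝ) / (p + 1)) := by positivity
    nlinarith
  have hEp : E ≤ C₁ * p ^ (1 - (N : ℝ)) :=
    hEC'.trans (mul_le_of_le_one_right (by positivity)
      (Real.rpow_le_one hE0.le hE1 (by positivity)))
  have hI : ∫ x in Ω, u x ^ p ≤ (1 + V) * E ^ (p / (p + 1)) := by
    set l : ℝ := E ^ (1 / (p + 1)) with hl
    have hl0 : 0 < l := by positivity
    have hlp : l ^ p = E ^ (p / (p + 1)) := by
      rw [hl, ← Real.rpow_mul hE0.le]; congr 1; ring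
    have hlE : l⁻¹ * E = E ^ (p / (p + 1)) := by
      have h1 : l ^ (p + 1) = E := by
        rw [hl, ← Real.rpow_mul hE0.le, one_div_mul_cancel (by linarith), Real.rpow_one]
      calc l⁻¹ * E = l⁻¹ * l ^ (p + 1) := by rw [h1]
        _ = l ^ p := by rw [Real.rpow_add_one hl0.ne']; field_simp
        _ = _ := hlp
    have hintg := hu.integrableOn_rpow hΩo hΩb (q := p + 1) (by linarith)
    calc ∫ x in Ω, u x ^ p ≤ ∫ x in Ω, (l⁻¹ * u x ^ (p + 1) + l ^ p) := by
          refine integral_mono_of_nonneg ?_ ((hintg.const_mul _).add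
            (integrableOn_const hΩb.measure_lt_top.ne)) ?_
          · filter_upwards [ae_restrict_mem hΩo.measurableSet] with x hx
            exact Real.rpow_nonneg (hu.2.1 x hx).le _
          · filter_upwards [ae_restrict_mem hΩo.measurableSet] with x hx
            have hux := hu.2.1 x hx
            rcases le_total (u x) l with h | h
            · have h1 : u x ^ p ≤ l ^ p := Real.rpow_le_rpow hux.le h hp0.le
              have h2 : 0 ≤ l⁻¹ * u x ^ (p + 1) := by positivity
              linarith
            · have h1 : u x ^ p ≤ l⁻¹ * u x ^ (p + 1) := by
                rw [Real.rpow_add_one hux.ne', inv_mul_eq_div, le_div_iff₀ hl0]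
                exact mul_le_mul_of_nonneg_left h (by positivity)
              have h2 : 0 ≤ l ^ p := by positivity
              linarith
      _ = l⁻¹ * E + V * l ^ p := by
          rw [integral_add (hintg.const_mul _) (integrableOn_const hΩb.measure_lt_top.ne),
            integral_const_mul, setIntegral_const, smul_eq_mul]
      _ = _ := by rw [hlE, hlp]; ring
  have hEp' : E ^ (p / (p + 1)) ≤ C₁ * 2 ^ ((N : ℝ) - 1) * p ^ (1 - (N : ℝ)) := by
    have hpp : p / (p + 1) ≤ 1 := by rw [div_le_one (by linarith)]; linarith
    have hp2 : p ^ (1 / (p + 1)) ≤ 2 := by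
      have h1 : p ≤ 2 ^ (p + 1) := by
        have := one_add_mul_self_le_rpow_one_add (s := 1) (by norm_num) (p := p + 1) (by linarith)
        norm_num at this
        linarith
      calc p ^ (1 / (p + 1)) ≤ (2 ^ (p + 1)) ^ (1 / (p + 1)) :=
            Real.rpow_le_rpow hp0.le h1 (by positivity)
        _ = 2 := by
            rw [← Real.rpow_mul two_pos.le, mul_one_div_cancel (by linarith), Real.rpow_one]
    calc E ^ (p / (p + 1)) ≤ (C₁ * p ^ (1 - (N : ℝ))) ^ (p / (p + 1)) :=
          Real.rpow_le_rpow hE0.le hEp (by positivity)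
      _ = C₁ ^ (p / (p + 1)) * (p ^ (1 - (N : ℝ))) ^ (p / (p + 1)) :=
          Real.mul_rpow (by linarith) (by positivity)
      _ ≤ C₁ * ((p ^ (1 / (p + 1))) ^ ((N : ℝ) - 1) * p ^ (1 - (N : ℝ))) := by
          refine mul_le_mul ?_ (le_of_eq ?_) (by positivity) (by linarith)
          · calc C₁ ^ (p / (p + 1)) ≤ C₁ ^ (1 : ℝ) :=
                  Real.rpow_le_rpow_of_exponent_le hC₁1 hpp
              _ = C₁ := Real.rpow_one _
          · rw [← Real.rpow_mul hp0.le, ← Real.rpow_mul hp0.le, ← Real.rpow_add hp0]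
            congr 1
            field_simp
            ring
      _ ≤ C₁ * (2 ^ ((N : ℝ) - 1) * p ^ (1 - (N : ℝ))) := by
          have : (p ^ (1 / (p + 1))) ^ ((N : ℝ) - 1) ≤ 2 ^ ((N : ℝ) - 1) :=
            Real.rpow_le_rpow (by positivity) hp2 (by linarith)
          gcongr
      _ = _ := by ring
  have h21 : (1 : ℝ) ≤ 2 ^ ((N : ℝ) - 1) := Real.one_le_rpow one_le_two (by linarith)
  have hC2 : C₁ ≤ C₁ * 2 ^ ((N : ℝ) - 1) := le_mul_of_one_le_right (by linarith) h21
  have hC2' : C₁ * 2 ^ ((N : ℝ) - 1) ≤ (1 + V) * (C₁ * 2 ^ ((N : ℝ) - 1)) :=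
    le_mul_of_one_le_left (by positivity) (by linarith)
  refine ⟨hE0, hE1, hEp.trans ?_, hI.trans ?_, hI.trans ?_⟩
  · exact mul_le_mul_of_nonneg_right (hC2.trans hC2') (by positivity)
  · refine mul_le_mul_of_nonneg_right ?_ (by positivity)
    exact le_mul_of_one_le_right (by linarith) (by linarith)
  · rw [mul_assoc]
    exact mul_le_mul_of_nonneg_left hEp' (by linarith)

end IsLeastEnergySolution

lemma gradient_mul {N : ℕ} {f g : Euc N → ℝ} {x : Euc N} (hf : DifferentiableAt ℝ f x)
    (hg : DifferentiableAt ℝ g x) :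
    gradient (fun y => f y * g y) x = f x • gradient g x + g x • gradient f x := by
  simp [gradient, fderiv_fun_mul hf hg]

lemma exists_abs_deriv_smoothTransition_le :
    ∃ D > 0, ∀ t, |deriv Real.smoothTransition t| ≤ D := by
  have hc : Continuous (deriv Real.smoothTransition) :=
    (Real.smoothTransition.contDiff (n := 1)).continuous_deriv le_rfl
  obtain ⟨D, hD⟩ := (isCompact_Icc (a := (0 : ℝ)) (b := 1)).exists_bound_of_continuousOn
    hc.continuousOn
  refine ⟨max D 1, by positivity, fun t => ?_⟩
  rcases lt_or_ge t 0 with h | h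
  · have : Real.smoothTransition =ᶠ[𝓝 t] fun _ => 0 := by
      filter_upwards [Iio_mem_nhds h] with s hs
      exact Real.smoothTransition.zero_of_nonpos (le_of_lt hs)
    rw [this.deriv_eq]; simp
  rcases lt_or_ge 1 t with h' | h'
  · have : Real.smoothTransition =ᶠ[𝓝 t] fun _ => 1 := by
      filter_upwards [Ioi_mem_nhds h'] with s hs
      exact Real.smoothTransition.one_of_one_le (le_of_lt hs)
    rw [this.deriv_eq]; simp
  · exact (hD t ⟨h, h'⟩).trans (le_max_left _ _)

lemma exists_cutoff (N : ℕ) : ∃ K > 0, ∀ (x₀ : Euc N) (a b : ℝ), 0 ≤ a → a < b →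
    ∃ η : Euc N → ℝ, ContDiff ℝ 1 η ∧ (∀ x, 0 ≤ η x) ∧ (∀ x, η x ≤ 1) ∧
      (∀ x ∈ Metric.closedBall x₀ a, η x = 1) ∧ (∀ x ∉ Metric.closedBall x₀ b, η x = 0) ∧
      (∀ x ∉ Metric.closedBall x₀ b, gradient η x = 0) ∧
      ∀ x, ‖gradient η x‖ ≤ K / (b - a) := by
  obtain ⟨D, hD0, hD⟩ := exists_abs_deriv_smoothTransition_le
  refine ⟨2 * D, by positivity, fun x₀ a b ha hab => ?_⟩
  have hb : 0 < b := ha.trans_lt hab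
  have hba : 0 < b ^ 2 - a ^ 2 := by nlinarith
  set g : Euc N → ℝ := fun x => (b ^ 2 - ‖x - x₀‖ ^ 2) / (b ^ 2 - a ^ 2) with hg
  have hgc : ContDiff ℝ 1 g :=
    (contDiff_const.sub ((contDiff_id.sub contDiff_const).norm_sq ℝ)).div_const _
  have hdist : ∀ x c, x ∈ Metric.closedBall x₀ c ↔ ‖x - x₀‖ ≤ c := fun x c => by
    rw [Metric.mem_closedBall, dist_eq_norm]
  have h0 : ∀ x ∉ Metric.closedBall x₀ b, Real.smoothTransition (g x) = 0 := fun x hx => by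
    rw [hdist, not_le] at hx
    exact Real.smoothTransition.zero_of_nonpos
      (div_nonpos_of_nonpos_of_nonneg (by nlinarith) hba.le)
  have hgrad0 : ∀ x ∉ Metric.closedBall x₀ b,
      gradient (fun x => Real.smoothTransition (g x)) x = 0 := fun x hx =>
    gradient_eq_zero_of_notMem_tsupport fun h => hx <| (closure_minimal (fun y hy => by
      by_contra hyn; exact hy (h0 y hyn)) Metric.isClosed_closedBall) h
  have hpos : 0 < 2 * D / (b - a) := by have := sub_pos.2 hab; positivity
  refine ⟨fun x => Real.smoothTransition (g x), Real.smoothTransition.contDiff.comp hgc,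
    fun x => Real.smoothTransition.nonneg _, fun x => Real.smoothTransition.le_one _,
    fun x hx => ?_, h0, hgrad0, fun x => ?_⟩
  · rw [hdist] at hx
    apply Real.smoothTransition.one_of_one_le
    rw [hg, one_le_div hba]
    nlinarith [norm_nonneg (x - x₀)]
  · by_cases hx : x ∈ Metric.closedBall x₀ b
    swap
    · rw [hgrad0 x hx, norm_zero]; exact hpos.le
    have hgd : HasFDerivAt g (-((b ^ 2 - a ^ 2)⁻¹ • (2 • innerSL ℝ (x - x₀)))) x := by
      have h1 : HasFDerivAt (fun y : Euc N => ‖y - x₀‖ ^ 2) (2 • innerSL ℝ (x - x₀)) x := by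
        simpa using ((hasFDerivAt_id x).sub_const x₀).norm_sq
      have h2 := (h1.const_sub (b ^ 2)).const_mul (b ^ 2 - a ^ 2)⁻¹
      rw [smul_neg] at h2
      refine h2.congr_of_eventuallyEq (Eventually.of_forall fun y => ?_)
      simp only [hg]
      rw [inv_mul_eq_div]
    rw [IsLeastEnergySolution.gradient_comp
      ((Real.smoothTransition.contDiff (n := 1)).differentiable one_ne_zero _).hasDerivAt
      hgd.differentiableAt, norm_smul, norm_gradient_eq, hgd.fderiv, norm_neg, norm_smul,
      two_smul, ← two_smul ℝ, norm_smul, innerSL_apply_norm, Real.norm_eq_abs, norm_inv,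
      Real.norm_eq_abs, abs_of_pos hba]
    rw [hdist] at hx
    calc _ ≤ D * ((b ^ 2 - a ^ 2)⁻¹ * (2 * b)) := by
          have := hD (g x)
          norm_num
          gcongr
      _ ≤ 2 * D / (b - a) := by
          rw [inv_mul_eq_div, ← mul_div_assoc, div_le_div_iff₀ hba (sub_pos.2 hab)]
          have : b * (b - a) ≤ b ^ 2 - a ^ 2 := by nlinarith
          nlinarith

/-- The binomial inequality with a leading constant arbitrarily close to one. -/
lemma exists_add_pow_le (N : ℕ) : ∃ C > 0, ∀ a b : ℝ, 0 ≤ a → 0 ≤ b →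
    (a + b) ^ N ≤ 5 / 4 * a ^ N + C * b ^ N := by
  have h1 : Tendsto (fun ε : ℝ => (1 + ε) ^ N) (𝓝[>] 0) (𝓝 ((1 + 0) ^ N)) :=
    (Continuous.tendsto (by fun_prop) 0).mono_left nhdsWithin_le_nhds
  rw [add_zero, one_pow] at h1
  obtain ⟨ε, hε, hε0⟩ := ((h1.eventually (ge_mem_nhds (by norm_num : (1 : ℝ) < 5 / 4))).and
    self_mem_nhdsWithin).exists
  have hε0 : 0 < ε := hε0
  refine ⟨(1 / ε + 1) ^ N, by positivity, fun a b ha hb => ?_⟩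
  have ha' := pow_nonneg ha N
  have hb' := pow_nonneg hb N
  rcases le_total b (ε * a) with h | h
  · calc (a + b) ^ N ≤ ((1 + ε) * a) ^ N := pow_le_pow_left₀ (by positivity) (by linarith) _
      _ = (1 + ε) ^ N * a ^ N := mul_pow _ _ _
      _ ≤ 5 / 4 * a ^ N := by gcongr
      _ ≤ _ := le_add_of_nonneg_right (by positivity)
  · have h2 : a ≤ 1 / ε * b := by
      rw [one_div_mul_eq_div, le_div_iff₀ hε0]; linarith
    calc (a + b) ^ N ≤ ((1 / ε + 1) * b) ^ N :=
          pow_le_pow_left₀ (by positivity) (by linarith) _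
      _ = (1 / ε + 1) ^ N * b ^ N := mul_pow _ _ _
      _ ≤ _ := le_add_of_nonneg_left (by positivity)

namespace IsLeastEnergySolution

variable {N : ℕ} {H : Euc N → ℝ} {Ω : Set (Euc N)}

lemma contDiffOn_rpow {p : ℝ} {u : Euc N → ℝ} (hu : IsLeastEnergySolution N H Ω p u) (q : ℝ) :
    ContDiffOn ℝ 1 (fun x => u x ^ q) Ω :=
  hu.contDiffOn.rpow_const_of_ne fun x hx => (hu.2.1 x hx).ne'

/-- Local energy bound for the product of the solution with a cutoff. -/
lemma cutoff_energy_le (hnorm : IsFinslerNorm N H) (hreg : FinslerRegular N H)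
    (hN : 2 ≤ N) (hΩo : IsOpen Ω) (hΩb : Bornology.IsBounded Ω) {x₀ : Euc N} {r : ℝ} (hr : 0 < r)
    (hB : Metric.closedBall x₀ (8 * r) ⊆ Ω) :
    ∃ C > 0, ∀ (p : ℝ) (u : Euc N → ℝ), 1 < p → IsLeastEnergySolution N H Ω p u →
      energyInf N H Ω p *
        (∫ x in Metric.closedBall x₀ (4 * r), u x ^ (p + 1)) ^ ((N : ℝ) / (p + 1))
        ≤ 5 / 4 * (∫ x in Metric.closedBall x₀ (8 * r), H (gradient u x) ^ N)
          + C * ∫ x in Ω, u x ^ (N : ℝ) := by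
  obtain ⟨K, hK0, hK⟩ := exists_cutoff N
  obtain ⟨η, hη, hη0, hη1, hηa, hηb, hηg, hηK⟩ := hK x₀ (4 * r) (8 * r) (by positivity)
    (by linarith)
  obtain ⟨L, hL0, hL⟩ := hnorm.exists_le_norm
  obtain ⟨C, hC0, hC⟩ := exists_add_pow_le N
  set G : ℝ := L * (K / (8 * r - 4 * r)) with hG
  have hG0 : 0 < G := by
    have : 0 < 8 * r - 4 * r := by linarith
    positivity
  refine ⟨C * G ^ N, by positivity, fun p u hp hu => ?_⟩
  have hBc : IsCompact (Metric.closedBall x₀ (8 * r)) := isCompact_closedBall _ _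
  set φ : Euc N → ℝ := fun x => η x * u x with hφ
  obtain ⟨h1, h2, h3⟩ := contDiff_of_eq_zero_off_compact (φ := φ) hΩo hBc hB
    (hη.contDiffOn.mul hu.contDiffOn) fun x hx => by simp [hφ, hηb x hx]
  have hle := energyInf_mul_le hnorm hΩo (p := p) (by linarith) (by omega) h1 h2 (h3.trans hB)
  have hgφ : ∀ x ∈ Ω, H (gradient φ x) ^ N ≤
      (Metric.closedBall x₀ (8 * r)).indicator (fun x => 5 / 4 * H (gradient u x) ^ N) x
        + C * G ^ N * u x ^ (N : ℝ) := fun x hx => by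
    have hux := hu.2.1 x hx
    rw [Real.rpow_natCast]
    by_cases hxB : x ∈ Metric.closedBall x₀ (8 * r)
    · rw [indicator_of_mem hxB, hφ, gradient_mul (hη.differentiable one_ne_zero x)
        (hu.differentiableAt hΩo hx)]
      have e1 : H (η x • gradient u x + u x • gradient η x) ≤ H (gradient u x) + G * u x := by
        refine (hnorm.add_le _ _).trans ?_
        rw [hnorm.smul, hnorm.smul, abs_of_nonneg (hη0 x), abs_of_pos hux]
        refine add_le_add (mul_le_of_le_one_left (hnorm.nonneg _) (hη1 x)) ?_
        rw [mul_comm]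
        refine mul_le_mul_of_nonneg_right ((hL _).trans ?_) hux.le
        exact mul_le_mul_of_nonneg_left (hηK x) hL0.le
      calc _ ≤ (H (gradient u x) + G * u x) ^ N := pow_le_pow_left₀ (hnorm.nonneg _) e1 _
        _ ≤ 5 / 4 * H (gradient u x) ^ N + C * (G * u x) ^ N :=
            hC _ _ (hnorm.nonneg _) (by positivity)
        _ = _ := by rw [mul_pow]; ring
    · rw [indicator_of_notMem hxB, gradient_eq_zero_of_notMem_tsupport fun h => hxB (h3 h),
        hnorm.map_zero, zero_pow (by omega), zero_add]
      positivity
  have hiE := (hu.integrableOn_energy hnorm hreg hN hΩo hΩb hp).const_mul (5 / 4)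
  have hiN := (hu.integrableOn_rpow hΩo hΩb (q := N) (by positivity)).const_mul (C * G ^ N)
  have hmB : MeasurableSet (Metric.closedBall x₀ (8 * r)) := measurableSet_closedBall
  have hup : ∫ x in Ω, H (gradient φ x) ^ N ≤
      5 / 4 * (∫ x in Metric.closedBall x₀ (8 * r), H (gradient u x) ^ N)
          + C * G ^ N * ∫ x in Ω, u x ^ (N : ℝ) := by
    calc _ ≤ ∫ x in Ω, ((Metric.closedBall x₀ (8 * r)).indicator
          (fun x => 5 / 4 * H (gradient u x) ^ N) x + C * G ^ N * u x ^ (N : ℝ)) := by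
          refine integral_mono_of_nonneg (Eventually.of_forall fun x =>
            pow_nonneg (hnorm.nonneg _) _) ((hiE.indicator hmB).add hiN) ?_
          filter_upwards [ae_restrict_mem hΩo.measurableSet] with x hx using hgφ x hx
      _ = _ := by
          rw [integral_add (hiE.indicator hmB) hiN, setIntegral_indicator hmB,
            inter_eq_right.2 hB, integral_const_mul, integral_const_mul]
  have hlo : ∫ x in Metric.closedBall x₀ (4 * r), u x ^ (p + 1) ≤ ∫ x in Ω, |φ x| ^ (p + 1) := by
    have hsub : Metric.closedBall x₀ (4 * r) ⊆ Ω :=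
      (Metric.closedBall_subset_closedBall (by linarith)).trans hB
    have hi : IntegrableOn (fun x => |φ x| ^ (p + 1)) Ω := by
      refine integrableOn_of_eq_zero_off_compact hBc hB ?_ fun x hx => ?_
      · exact (h1.continuous.abs.rpow_const fun x => Or.inr (by linarith)).continuousOn
      · simp only [hφ, hηb x hx, zero_mul, abs_zero]
        exact Real.zero_rpow (by linarith)
    calc _ = ∫ x in Metric.closedBall x₀ (4 * r), |φ x| ^ (p + 1) :=
          setIntegral_congr_fun measurableSet_closedBall fun x hx => by
            simp only [hφ, hηa x hx, one_mul, abs_of_pos (hu.2.1 x (hsub hx))]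
      _ ≤ _ := setIntegral_mono_set hi (Eventually.of_forall fun x => by positivity)
          hsub.eventuallyLE
  refine le_trans (mul_le_mul_of_nonneg_left ?_ (energyInf_nonneg hnorm Ω p)) (hle.trans hup)
  refine Real.rpow_le_rpow (setIntegral_nonneg measurableSet_closedBall fun x hx => ?_) hlo
    (by positivity)
  exact Real.rpow_nonneg (hu.2.1 x (hB (Metric.closedBall_subset_closedBall (by linarith) hx))).le _

end IsLeastEnergySolution

namespace IsLeastEnergySolution

variable {N : ℕ} {H : Euc N → ℝ} {Ω : Set (Euc N)}

/-- Least energy solutions cannot concentrate near two distinct points: on one of two disjoint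
balls the mass is exponentially small. -/
lemma exists_mass_le_or (hN : 2 ≤ N) (hnorm : IsFinslerNorm N H) (hreg : FinslerRegular N H)
    (hΩo : IsOpen Ω) (hΩb : Bornology.IsBounded Ω) (hΩne : Ω.Nonempty)
    {x₁ x₂ : Euc N} {r : ℝ} (hr : 0 < r)
    (hB₁ : Metric.closedBall x₁ (8 * r) ⊆ Ω) (hB₂ : Metric.closedBall x₂ (8 * r) ⊆ Ω)
    (hd : Disjoint (Metric.closedBall x₁ (8 * r)) (Metric.closedBall x₂ (8 * r))) :
    ∃ P ≥ (N : ℝ), ∀ (p : ℝ) (u : Euc N → ℝ), P ≤ p → IsLeastEnergySolution N H Ω p u →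
      (∫ x in Metric.closedBall x₁ (4 * r), u x ^ (p + 1))
          ≤ ((3 / 4 : ℝ) ^ (1 / (N : ℝ))) ^ (p + 1) ∨
      (∫ x in Metric.closedBall x₂ (4 * r), u x ^ (p + 1))
          ≤ ((3 / 4 : ℝ) ^ (1 / (N : ℝ))) ^ (p + 1) := by
  have hN2 : (2 : ℝ) ≤ N := by exact_mod_cast hN
  obtain ⟨C₁, hC₁, P₁, hP₁, hdec⟩ := exists_energy_decay hN hnorm hreg hΩo hΩb hΩne
  obtain ⟨C₂, hC₂, hpow⟩ := exists_integral_rpow_le hnorm hreg hN hΩo hΩb hΩne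
    (Q := N) (by linarith)
  obtain ⟨D₁, hD₁, hcut₁⟩ := cutoff_energy_le hnorm hreg hN hΩo hΩb hr hB₁
  obtain ⟨D₂, hD₂, hcut₂⟩ := cutoff_energy_le hnorm hreg hN hΩo hΩb hr hB₂
  have hN1 : 0 < (N : ℝ) - 1 := by linarith
  set δ : ℝ := 1 / (2 * ((N : ℝ) - 1)) with hδ
  have hδ0 : 0 < δ := by positivity
  set C₃ : ℝ := (C₁ ^ (1 / ((N : ℝ) - 1))) ^ (N : ℝ) with hC₃
  have hC₃0 : 0 < C₃ := by positivity
  set D : ℝ := (D₁ + D₂) * (C₂ * C₃) with hD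
  have hlim : Tendsto (fun p : ℝ => D * (C₁ * p ^ (1 - (N : ℝ))) ^ δ) atTop (𝓝 0) := by
    have h1 : Tendsto (fun p : ℝ => p ^ (1 - (N : ℝ))) atTop (𝓝 0) := by
      simpa using tendsto_rpow_neg_atTop hN1
    have h2 : Tendsto (fun p : ℝ => C₁ * p ^ (1 - (N : ℝ))) atTop (𝓝 0) := by
      simpa using h1.const_mul C₁
    have h3 := h2.rpow_const (p := δ) (Or.inr hδ0.le)
    rw [Real.zero_rpow hδ0.ne'] at h3
    simpa using h3.const_mul D
  obtain ⟨P₂, hP₂⟩ := eventually_atTop.1 (hlim.eventually (gt_mem_nhds (by norm_num : (0 : ℝ) < 1 / 4)))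
  refine ⟨max P₁ (max P₂ (2 * N)), hP₁.trans (le_max_left _ _), fun p u hp hu => ?_⟩
  have hp1 : P₁ ≤ p := (le_max_left _ _).trans hp
  have hp2 : P₂ ≤ p := (le_max_left _ _).trans ((le_max_right _ _).trans hp)
  have hp3 : 2 * (N : ℝ) ≤ p := (le_max_right _ _).trans ((le_max_right _ _).trans hp)
  have hp0 : 0 < p := by linarith
  obtain ⟨hE0, hE1, hEp, hI, -⟩ := hdec p u hp1 hu
  have hpw := hpow p u (by linarith) hu
  have hc1 := hcut₁ p u (by linarith) hu
  have hc2 := hcut₂ p u (by linarith) hu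
  have heq := hu.2.2.2.2
  have hen := hu.integral_energy hnorm hreg hN hΩo hΩb (by linarith)
  rw [hen] at heq
  have hintg := hu.integrableOn_energy hnorm hreg hN hΩo hΩb (by linarith)
  have hI0 : 0 < ∫ x in Ω, u x ^ p := hu.integral_rpow_pos hΩo hΩb hΩne hp0.le
  set E : ℝ := ∫ x in Ω, u x ^ (p + 1) with hE
  set I : ℝ := ∫ x in Ω, u x ^ p with hIdef
  have hsplit : (∫ x in Metric.closedBall x₁ (8 * r), H (gradient u x) ^ N) +
      (∫ x in Metric.closedBall x₂ (8 * r), H (gradient u x) ^ N) ≤ E := by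
    rw [← setIntegral_union hd measurableSet_closedBall (hintg.mono_set hB₁) (hintg.mono_set hB₂),
      ← hen]
    exact setIntegral_mono_set hintg (Eventually.of_forall fun x => pow_nonneg (hnorm.nonneg _) _)
      (union_subset hB₁ hB₂).eventuallyLE
  have hCE : E ≤ energyInf N H Ω p := by
    have h1 : E ^ ((N : ℝ) / (p + 1)) ≤ 1 := Real.rpow_le_one hE0.le hE1 (by positivity)
    calc E = energyInf N H Ω p * E ^ ((N : ℝ) / (p + 1)) := heq
      _ ≤ _ := mul_le_of_le_one_right (energyInf_nonneg hnorm Ω p) h1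
  have hU : ∫ x in Ω, u x ^ (N : ℝ) ≤ C₂ * C₃ * (E * E ^ δ) := by
    refine hpw.trans ?_
    rw [mul_assoc]
    refine mul_le_mul_of_nonneg_left ?_ hC₂.le
    calc (I ^ (1 / ((N : ℝ) - 1))) ^ (N : ℝ)
        ≤ ((C₁ * E ^ (p / (p + 1))) ^ (1 / ((N : ℝ) - 1))) ^ (N : ℝ) := by gcongr
      _ = C₃ * E ^ (p / (p + 1) * (1 / ((N : ℝ) - 1)) * N) := by
          rw [Real.mul_rpow (by positivity) (by positivity),
            Real.mul_rpow (by positivity) (by positivity), ← Real.rpow_mul hE0.le,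
            ← Real.rpow_mul hE0.le]
      _ ≤ C₃ * E ^ (1 + δ) := by
          refine mul_le_mul_of_nonneg_left (Real.rpow_le_rpow_of_exponent_ge hE0 hE1 ?_) hC₃0.le
          rw [hδ, div_mul_div_comm, mul_one, div_mul_eq_mul_div, one_add_div (by positivity),
            div_le_div_iff₀ (by positivity) (by positivity)]
          nlinarith [mul_pos hN1 hN1, mul_nonneg hN1.le (sub_nonneg.2 hp3)]
      _ = C₃ * (E * E ^ δ) := by rw [Real.rpow_one_add' hE0.le (by positivity)]
  by_contra! hcon
  have hθ : ∀ x₀ : Euc N, ((3 / 4 : ℝ) ^ (1 / (N : ℝ))) ^ (p + 1)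
      < (∫ x in Metric.closedBall x₀ (4 * r), u x ^ (p + 1)) →
      E * (3 / 4) ≤ energyInf N H Ω p *
        (∫ x in Metric.closedBall x₀ (4 * r), u x ^ (p + 1)) ^ ((N : ℝ) / (p + 1)) := by
    intro x₀ h
    refine mul_le_mul hCE ?_ (by norm_num) (energyInf_nonneg hnorm Ω p)
    calc (3 / 4 : ℝ) = (((3 / 4 : ℝ) ^ (1 / (N : ℝ))) ^ (p + 1)) ^ ((N : ℝ) / (p + 1)) := by
          rw [← Real.rpow_mul (by positivity), ← Real.rpow_mul (by positivity)]
          conv_lhs => rw [← Real.rpow_one (3 / 4 : ℝ)]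
          congr 1
          field_simp
      _ ≤ _ := Real.rpow_le_rpow (by positivity) h.le (by positivity)
  have h1 := (hθ x₁ hcon.1).trans hc1
  have h2 := (hθ x₂ hcon.2).trans hc2
  have h3 : (D₁ + D₂) * ∫ x in Ω, u x ^ (N : ℝ) ≤ D * (E * E ^ δ) := by
    rw [hD, mul_assoc (D₁ + D₂)]
    exact mul_le_mul_of_nonneg_left hU (by positivity)
  have h4 : D * E ^ δ < 1 / 4 := by
    refine lt_of_le_of_lt ?_ (hP₂ p hp2)
    gcongr
  nlinarith

end IsLeastEnergySolution

/-- Young inequality absorbing the top power. -/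
lemma mul_pow_mul_le_half_add {N : ℕ} (hN : 0 < N) {X Y : ℝ} (hX : 0 ≤ X) (hY : 0 ≤ Y) :
    N * (X ^ (N - 1) * Y) ≤ X ^ N / 2 + N * (2 * N) ^ (N - 1) * Y ^ N := by
  have hN' : (0 : ℝ) < N := by exact_mod_cast hN
  have e : ∀ t : ℝ, t ^ N = t ^ (N - 1) * t := fun t => by
    rw [← pow_succ, Nat.sub_add_cancel hN]
  rcases le_total (2 * N * Y) X with h | h
  · have h1 : N * (X ^ (N - 1) * Y) ≤ X ^ N / 2 := by
      rw [e X]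
      nlinarith [mul_le_mul_of_nonneg_left h (pow_nonneg hX (N - 1))]
    have : 0 ≤ N * (2 * N) ^ (N - 1) * Y ^ N := by positivity
    linarith
  · have h1 : X ^ (N - 1) ≤ (2 * N) ^ (N - 1) * Y ^ (N - 1) := by
      rw [← mul_pow]; exact pow_le_pow_left₀ hX h _
    have h2 := mul_le_mul_of_nonneg_right h1 (mul_nonneg hN'.le hY)
    rw [e Y]
    have : 0 ≤ X ^ N / 2 := by positivity
    nlinarith

namespace IsLeastEnergySolution

variable {N : ℕ} {H : Euc N → ℝ} {Ω : Set (Euc N)}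

lemma gradient_rpow {p : ℝ} {u : Euc N → ℝ} (hΩo : IsOpen Ω)
    (hu : IsLeastEnergySolution N H Ω p u) (q : ℝ) {x : Euc N} (hx : x ∈ Ω) :
    gradient (fun y => u y ^ q) x = (q * u x ^ (q - 1)) • gradient u x :=
  gradient_comp (F := fun t => t ^ q) (Real.hasDerivAt_rpow_const (Or.inl (hu.2.1 x hx).ne'))
    (hu.differentiableAt hΩo hx)

/-- Caccioppoli inequality for powers of a solution. -/
lemma integral_gradient_cutoff_rpow_le (hnorm : IsFinslerNorm N H) (hreg : FinslerRegular N H)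
    (hN : 2 ≤ N) (hΩo : IsOpen Ω) {p γ : ℝ} {u η : Euc N → ℝ}
    (hu : IsLeastEnergySolution N H Ω p u) (hγ : 1 ≤ γ) (hη : ContDiff ℝ 1 η)
    (hη0 : ∀ x, 0 ≤ η x) {K : Set (Euc N)} (hK : IsCompact K) (hKΩ : K ⊆ Ω)
    (hηK : ∀ x ∉ K, η x = 0) :
    ∫ x in Ω, H (gradient (fun y => η y * u y ^ γ) x) ^ N ≤
      2 ^ (N - 1) * (2 * (N * (2 * N) ^ (N - 1)) + 2) * (γ ^ N *
        ((∫ x in Ω, η x ^ N * u x ^ (p + N * (γ - 1) + 1)) +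
          ∫ x in Ω, (u x ^ γ * H (gradient η x)) ^ N)) := by
  have hN0 : N ≠ 0 := by omega
  have hN' : (0 : ℝ) < N := by exact_mod_cast Nat.pos_of_ne_zero hN0
  set C₀ : ℝ := N * (2 * N) ^ (N - 1) with hC₀
  have hC₀0 : 0 < C₀ := by positivity
  set β : ℝ := N * (γ - 1) + 1 with hβ
  have hβ1 : 1 ≤ β := by have : 0 ≤ γ - 1 := by linarith
                         rw [hβ]; nlinarith
  have hηs : tsupport η ⊆ K := closure_minimal (fun x hx => by
    by_contra h; exact hx (hηK x h)) hK.isClosed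
  have hηg : ∀ x ∉ K, gradient η x = 0 := fun x hx =>
    gradient_eq_zero_of_notMem_tsupport fun h => hx (hηs h)
  set φ : Euc N → ℝ := fun x => η x ^ N * u x ^ β with hφ
  set w : Euc N → ℝ := fun x => η x * u x ^ γ with hw
  obtain ⟨a1, a2, a3⟩ := contDiff_of_eq_zero_off_compact (φ := φ) hΩo hK hKΩ
    ((hη.pow N).contDiffOn.mul (hu.contDiffOn_rpow β)) fun x hx => by
      simp [hφ, hηK x hx, hN0]
  obtain ⟨b1, b2, b3⟩ := contDiff_of_eq_zero_off_compact (φ := w) hΩo hK hKΩ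
    (hη.contDiffOn.mul (hu.contDiffOn_rpow γ)) fun x hx => by
      simp [hw, hηK x hx]
  have hweak := hu.2.2.2.1.integral_field_eq hnorm hreg hN hΩo hu.contDiffOn
    (hu.continuousOn_rpow p) a1 a2 (a3.trans hKΩ)
  have hcgu := continuousOn_gradient hΩo hu.contDiffOn
  have hiI : IntegrableOn (fun x => ⟪finslerField N H (gradient u x), gradient φ x⟫) Ω := by
    refine integrableOn_of_eq_zero_on_diff hΩo hK hKΩ ?_ fun x hx hxK => ?_
    · exact ((hnorm.continuous_field hreg hN).comp_continuousOn hcgu).inner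
        (continuous_gradient a1).continuousOn
    · rw [gradient_eq_zero_of_notMem_tsupport fun h => hxK (a3 h), inner_zero_right]
  have hiY : IntegrableOn (fun x => (u x ^ γ * H (gradient η x)) ^ N) Ω := by
    refine integrableOn_of_eq_zero_on_diff hΩo hK hKΩ ?_ fun x hx hxK => ?_
    · exact ((hu.continuousOn_rpow γ).mul
        (hnorm.continuous.comp (continuous_gradient hη)).continuousOn).pow N
    · rw [hηg x hxK, hnorm.map_zero, mul_zero, zero_pow hN0]
  have hpt : ∀ x ∈ Ω, H (gradient w x) ^ N ≤ γ ^ N * 2 ^ (N - 1) *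
      (2 * ⟪finslerField N H (gradient u x), gradient φ x⟫ +
        (2 * C₀ + 1) * (u x ^ γ * H (gradient η x)) ^ N) := fun x hx => by
    have hux := hu.2.1 x hx
    have hηd := hη.differentiable one_ne_zero x
    have hud := hu.differentiableAt hΩo hx
    have hpd : ∀ q : ℝ, DifferentiableAt ℝ (fun y => u y ^ q) x := fun q =>
      ((hu.contDiffOn_rpow q).contDiffAt (hΩo.mem_nhds hx)).differentiableAt one_ne_zero
    set a : ℝ := u x ^ (γ - 1) with ha
    have ha0 : 0 < a := Real.rpow_pos_of_pos hux _
    have hγa : u x ^ γ = a * u x := by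
      rw [ha, ← Real.rpow_add_one hux.ne', sub_add_cancel]
    have hβa1 : u x ^ (β - 1) = a ^ N := by
      rw [ha, ← Real.rpow_natCast, ← Real.rpow_mul hux.le, hβ]; congr 1; ring
    have hβa : u x ^ β = a ^ N * u x := by
      rw [← hβa1, ← Real.rpow_add_one hux.ne', sub_add_cancel]
    have hgw : gradient w x = η x • ((γ * a) • gradient u x) + (a * u x) • gradient η x := by
      rw [hw, gradient_mul hηd (hpd γ), hu.gradient_rpow hΩo γ hx, hγa]
    have hgφ : gradient φ x = η x ^ N • ((β * a ^ N) • gradient u x)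
        + (a ^ N * u x) • ((N * η x ^ (N - 1)) • gradient η x) := by
      rw [hφ, gradient_mul (hηd.fun_pow N) (hpd β), hu.gradient_rpow hΩo β hx, hβa, hβa1,
        gradient_comp (F := fun t => t ^ N) (hasDerivAt_pow N (η x)) hηd]
    set h : ℝ := H (gradient u x) with hh
    set k : ℝ := H (gradient η x) with hk
    have hh0 : 0 ≤ h := hnorm.nonneg _
    have hk0 : 0 ≤ k := hnorm.nonneg _
    have hηx := hη0 x
    set X : ℝ := η x * a * h with hX
    set Y : ℝ := a * u x * k with hY
    have hX0 : 0 ≤ X := by positivity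
    have hY0 : 0 ≤ Y := by positivity
    have e : ∀ t : ℝ, t ^ N = t ^ (N - 1) * t := fun t => by
      rw [← pow_succ, Nat.sub_add_cancel (by omega)]
    have hin : X ^ N - N * (X ^ (N - 1) * Y) ≤
        ⟪finslerField N H (gradient u x), gradient φ x⟫ := by
      rw [hgφ, inner_add_right]
      simp only [real_inner_smul_right]
      rw [hnorm.inner_field_self hreg hN, ← hh]
      have h1 := (abs_le.1 (hnorm.abs_inner_field_le (gradient u x) (gradient η x))).1
      have h2 : X ^ N ≤ η x ^ N * (β * a ^ N * h ^ N) := by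
        rw [hX, mul_pow, mul_pow]
        have : 0 ≤ η x ^ N * a ^ N * h ^ N := by positivity
        nlinarith
      have h3 : N * (X ^ (N - 1) * Y) =
          a ^ N * u x * (N * η x ^ (N - 1)) * (h ^ (N - 1) * k) := by
        rw [hX, hY, mul_pow, mul_pow, e a]; ring
      have h4 : 0 ≤ a ^ N * u x * (N * η x ^ (N - 1)) := by positivity
      have h5 := mul_le_mul_of_nonneg_left h1 h4
      rw [h3]
      nlinarith
    have hyo := mul_pow_mul_le_half_add (Nat.pos_of_ne_zero hN0) hX0 hY0
    have hle : H (gradient w x) ≤ γ * (X + Y) := by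
      rw [hgw]
      refine (hnorm.add_le _ _).trans ?_
      rw [hnorm.smul, hnorm.smul, hnorm.smul, abs_of_nonneg hηx, abs_of_nonneg (by positivity),
        abs_of_nonneg (by positivity), ← hh, ← hk, mul_add]
      have : Y ≤ γ * Y := le_mul_of_one_le_left hY0 hγ
      have e2 : η x * (γ * a * h) = γ * X := by rw [hX]; ring
      rw [e2]; linarith
    rw [hγa]
    calc _ ≤ (γ * (X + Y)) ^ N := pow_le_pow_left₀ (hnorm.nonneg _) hle _
      _ = γ ^ N * (X + Y) ^ N := mul_pow _ _ _
      _ ≤ γ ^ N * (2 ^ (N - 1) * (X ^ N + Y ^ N)) := by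
          have := add_pow_le hX0 hY0 N
          gcongr
      _ = γ ^ N * 2 ^ (N - 1) * (X ^ N + Y ^ N) := by ring
      _ ≤ _ := by
          refine mul_le_mul_of_nonneg_left ?_ (by positivity)
          linarith
  have hA0 : 0 ≤ ∫ x in Ω, η x ^ N * u x ^ (p + N * (γ - 1) + 1) :=
    setIntegral_nonneg hΩo.measurableSet fun x hx =>
      mul_nonneg (pow_nonneg (hη0 x) _) (Real.rpow_nonneg (hu.2.1 x hx).le _)
  have hB0 : 0 ≤ ∫ x in Ω, (u x ^ γ * H (gradient η x)) ^ N :=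
    setIntegral_nonneg hΩo.measurableSet fun x hx =>
      pow_nonneg (mul_nonneg (Real.rpow_nonneg (hu.2.1 x hx).le _) (hnorm.nonneg _)) _
  have hAe : ∫ x in Ω, ⟪finslerField N H (gradient u x), gradient φ x⟫ =
      ∫ x in Ω, η x ^ N * u x ^ (p + N * (γ - 1) + 1) := by
    rw [hweak]
    refine setIntegral_congr_fun hΩo.measurableSet fun x hx => ?_
    simp only [hφ]
    rw [mul_left_comm, ← Real.rpow_add (hu.2.1 x hx), hβ, add_assoc]
  have hmono : ∫ x in Ω, H (gradient w x) ^ N ≤ ∫ x in Ω, γ ^ N * 2 ^ (N - 1) *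
      (2 * ⟪finslerField N H (gradient u x), gradient φ x⟫ +
        (2 * C₀ + 1) * (u x ^ γ * H (gradient η x)) ^ N) := by
    refine integral_mono_of_nonneg (Eventually.of_forall fun x => pow_nonneg (hnorm.nonneg _) _)
      (((hiI.const_mul 2).add (hiY.const_mul _)).const_mul _) ?_
    filter_upwards [ae_restrict_mem hΩo.measurableSet] with x hx using hpt x hx
  rw [integral_const_mul, integral_add (hiI.const_mul 2) (hiY.const_mul _), integral_const_mul,
    integral_const_mul, hAe] at hmono
  refine hmono.trans ?_
  set A := ∫ x in Ω, η x ^ N * u x ^ (p + N * (γ - 1) + 1)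
  set B := ∫ x in Ω, (u x ^ γ * H (gradient η x)) ^ N
  have h6 : 2 * A + (2 * C₀ + 1) * B ≤ (2 * C₀ + 2) * (A + B) := by nlinarith
  have h7 : 0 ≤ γ ^ N * 2 ^ (N - 1) := by positivity
  calc _ ≤ γ ^ N * 2 ^ (N - 1) * ((2 * C₀ + 2) * (A + B)) := mul_le_mul_of_nonneg_left h6 h7
    _ = _ := by ring

/-- One step of the Moser iteration: a reverse Sobolev inequality for powers of a solution. -/
lemma exists_cutoff_rpow_le (hN : 2 ≤ N) (hnorm : IsFinslerNorm N H) (hreg : FinslerRegular N H)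
    (hΩo : IsOpen Ω) (hΩb : Bornology.IsBounded Ω) :
    ∃ C ≥ 1, ∀ (p γ q : ℝ) (u η : Euc N → ℝ) (K : Set (Euc N)),
      IsLeastEnergySolution N H Ω p u → 1 ≤ γ → 2 < q → ContDiff ℝ 1 η → (∀ x, 0 ≤ η x) →
      IsCompact K → K ⊆ Ω → (∀ x ∉ K, η x = 0) →
      ∫ x in Ω, (η x * u x ^ γ) ^ q ≤ C * (C * q) ^ q * (γ ^ N *
        ((∫ x in Ω, η x ^ N * u x ^ (p + N * (γ - 1) + 1)) +
          ∫ x in Ω, (u x ^ γ * H (gradient η x)) ^ N)) ^ (q / N) := by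
  obtain ⟨S, hS1, hS⟩ := exists_sobolev N hN hnorm
  have hN' : (0 : ℝ) < N := by exact_mod_cast (by omega : 0 < N)
  set T : ℝ := 2 ^ (N - 1) * (2 * (N * (2 * N) ^ (N - 1)) + 2) with hT
  have hT1 : 1 ≤ T := by
    have h1 : (1 : ℝ) ≤ 2 ^ (N - 1) := one_le_pow₀ one_le_two
    have h2 : (0 : ℝ) ≤ N * (2 * N) ^ (N - 1) := by positivity
    nlinarith
  have hT2 : 1 ≤ T ^ (1 / (N : ℝ)) := Real.one_le_rpow hT1 (by positivity)
  set V : ℝ := volume.real Ω with hV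
  have hV0 : 0 ≤ V := measureReal_nonneg
  have hST : 1 ≤ S * T ^ (1 / (N : ℝ)) := one_le_mul_of_one_le_of_one_le hS1 hT2
  refine ⟨(1 + V) * (S * T ^ (1 / (N : ℝ))),
    one_le_mul_of_one_le_of_one_le (by linarith) hST,
    fun p γ q u η K hu hγ hq hη hη0 hK hKΩ hηK => ?_⟩
  have hcac := hu.integral_gradient_cutoff_rpow_le hnorm hreg hN hΩo hγ hη hη0 hK hKΩ hηK
  obtain ⟨b1, b2, b3⟩ := contDiff_of_eq_zero_off_compact (φ := fun x => η x * u x ^ γ) hΩo hK hKΩ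
    (hη.contDiffOn.mul (hu.contDiffOn_rpow γ)) fun x hx => by simp [hηK x hx]
  have hw0 : ∀ x, 0 ≤ η x * u x ^ γ := fun x => by
    by_cases hx : x ∈ K
    · exact mul_nonneg (hη0 x) (Real.rpow_nonneg (hu.2.1 x (hKΩ hx)).le _)
    · simp [hηK x hx]
  have hsob := hS Ω hΩo hΩb _ b1 b2 (b3.trans hKΩ) hw0 q hq
  set G : ℝ := γ ^ N * ((∫ x in Ω, η x ^ N * u x ^ (p + N * (γ - 1) + 1)) +
          ∫ x in Ω, (u x ^ γ * H (gradient η x)) ^ N) with hG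
  have hG0 : 0 ≤ G := by
    refine mul_nonneg (by positivity) (add_nonneg ?_ ?_)
    · exact setIntegral_nonneg hΩo.measurableSet fun x hx =>
        mul_nonneg (pow_nonneg (hη0 x) _) (Real.rpow_nonneg (hu.2.1 x hx).le _)
    · exact setIntegral_nonneg hΩo.measurableSet fun x hx =>
        pow_nonneg (mul_nonneg (Real.rpow_nonneg (hu.2.1 x hx).le _) (hnorm.nonneg _)) _
  have hq0 : 0 < q := by linarith
  calc _ ≤ V * (S * q) ^ q * (T * G) ^ (q / N) := by
        refine hsob.trans (mul_le_mul_of_nonneg_left ?_ (by positivity))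
        exact Real.rpow_le_rpow (integral_nonneg fun x => pow_nonneg (hnorm.nonneg _) _) hcac
          (by positivity)
    _ = V * (S * T ^ (1 / (N : ℝ)) * q) ^ q * G ^ (q / N) := by
        rw [Real.mul_rpow (by positivity) hG0, mul_right_comm S, Real.mul_rpow (x := S * q)
          (by positivity) (by positivity), ← Real.rpow_mul (x := T) (by positivity),
          one_div_mul_eq_div]
        ring
    _ ≤ _ := by
        have h1 : V ≤ (1 + V) * (S * T ^ (1 / (N : ℝ))) := by nlinarith
        have h2 : S * T ^ (1 / (N : ℝ)) ≤ (1 + V) * (S * T ^ (1 / (N : ℝ))) :=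
          le_mul_of_one_le_left (by positivity) (by linarith)
        gcongr

end IsLeastEnergySolution

/-- Interpolation between integrals of powers. -/
lemma setIntegral_rpow_interpolation {α : Type*} [MeasurableSpace α] {μ : Measure α} {S : Set α}
    (hS : MeasurableSet S) {f : α → ℝ} (hf : ∀ x ∈ S, 0 < f x) {a b t A B : ℝ} (ht0 : 0 ≤ t)
    (ht1 : t ≤ 1) (ha : IntegrableOn (fun x => f x ^ a) S μ)
    (hb : IntegrableOn (fun x => f x ^ b) S μ) (hA : 0 < A) (hB : 0 < B)
    (hfa : ∫ x in S, f x ^ a ∂μ ≤ A) (hfb : ∫ x in S, f x ^ b ∂μ ≤ B) :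
    ∫ x in S, f x ^ ((1 - t) * a + t * b) ∂μ ≤ A ^ (1 - t) * B ^ t := by
  have hAB : 0 < A ^ (1 - t) * B ^ t := by positivity
  have hpt : ∀ x ∈ S, f x ^ ((1 - t) * a + t * b) ≤
      A ^ (1 - t) * B ^ t * ((1 - t) / A * f x ^ a + t / B * f x ^ b) := fun x hx => by
    have hfx := hf x hx
    have h := Real.geom_mean_le_arith_mean2_weighted (w₁ := 1 - t) (w₂ := t)
      (p₁ := f x ^ a / A) (p₂ := f x ^ b / B) (by linarith) ht0 (by positivity) (by positivity)
      (by ring)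
    rw [Real.div_rpow (by positivity) hA.le, Real.div_rpow (by positivity) hB.le,
      ← Real.rpow_mul hfx.le, ← Real.rpow_mul hfx.le, div_mul_div_comm, ← Real.rpow_add hfx,
      div_le_iff₀ hAB] at h
    calc _ = f x ^ (a * (1 - t) + b * t) := by congr 1; ring
      _ ≤ _ := h
      _ = _ := by ring
  calc _ ≤ ∫ x in S, A ^ (1 - t) * B ^ t * ((1 - t) / A * f x ^ a + t / B * f x ^ b) ∂μ := by
        refine integral_mono_of_nonneg ?_
          (((ha.const_mul _).add (hb.const_mul _)).const_mul _) ?_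
        · filter_upwards [ae_restrict_mem hS] with x hx using Real.rpow_nonneg (hf x hx).le _
        · filter_upwards [ae_restrict_mem hS] with x hx using hpt x hx
    _ ≤ A ^ (1 - t) * B ^ t * 1 := by
        rw [integral_const_mul, integral_add (ha.const_mul _) (hb.const_mul _),
          integral_const_mul, integral_const_mul]
        refine mul_le_mul_of_nonneg_left ?_ hAB.le
        have h1 : (1 - t) / A * ∫ x in S, f x ^ a ∂μ ≤ 1 - t := by
          rw [div_mul_eq_mul_div, div_le_iff₀ hA]
          exact mul_le_mul_of_nonneg_left hfa (by linarith)
        have h2 : t / B * ∫ x in S, f x ^ b ∂μ ≤ t := by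
          rw [div_mul_eq_mul_div, div_le_iff₀ hB]
          exact mul_le_mul_of_nonneg_left hfb ht0
        linarith
    _ = _ := mul_one _

lemma rpow_le_one_add_rpow {x b e : ℝ} (hx : 0 < x) (hb : 0 ≤ b) (hbe : b ≤ e) :
    x ^ b ≤ 1 + x ^ e := by
  have h0 : 0 < x ^ e := Real.rpow_pos_of_pos hx e
  rcases le_total x 1 with h | h
  · linarith [Real.rpow_le_one hx.le h hb]
  · linarith [Real.rpow_le_rpow_of_exponent_le h hbe]

lemma one_add_rpow_le {V s : ℝ} (hV : 0 ≤ V) (hs : 0 ≤ s) :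
    (1 + V) ^ s ≤ 2 ^ s * (1 + V ^ s) := by
  have h0 : 0 ≤ V ^ s := Real.rpow_nonneg hV s
  have h2 : 0 < (2 : ℝ) ^ s := by positivity
  rcases le_total V 1 with h | h
  · have : (1 + V) ^ s ≤ 2 ^ s := Real.rpow_le_rpow (by linarith) (by linarith) hs
    nlinarith
  · have : (1 + V) ^ s ≤ (2 * V) ^ s := Real.rpow_le_rpow (by linarith) (by linarith) hs
    rw [Real.mul_rpow two_pos.le hV] at this
    nlinarith

lemma exists_rpow_le_rpow_neg {θ : ℝ} (hθ0 : 0 < θ) (hθ1 : θ < 1) (m : ℝ) :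
    ∃ P, ∀ p ≥ P, θ ^ p ≤ p ^ (-m) := by
  have h := tendsto_rpow_mul_exp_neg_mul_atTop_nhds_zero m (-Real.log θ)
    (by linarith [Real.log_neg hθ0 hθ1])
  obtain ⟨P, hP⟩ := eventually_atTop.1 ((h.eventually (gt_mem_nhds one_pos)).and
    (eventually_gt_atTop (0 : ℝ)))
  refine ⟨P, fun p hp => ?_⟩
  obtain ⟨h1, h2⟩ := hP p hp
  rw [neg_neg, ← Real.rpow_def_of_pos hθ0] at h1
  rw [Real.rpow_neg h2.le, ← one_div, le_div_iff₀ (by positivity), mul_comm]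
  exact h1.le

namespace IsLeastEnergySolution

variable {N : ℕ} {H : Euc N → ℝ} {Ω : Set (Euc N)}

/-- If the mass of `u ^ (p + 1)` on a ball is exponentially small, then `u ^ (p + 1 - N)` is bounded
in a Lebesgue space of exponent larger than one on a smaller ball. -/
lemma exists_integral_one_add_rpow_le (hN : 2 ≤ N) (hnorm : IsFinslerNorm N H)
    (hreg : FinslerRegular N H) (hΩo : IsOpen Ω) (hΩb : Bornology.IsBounded Ω)
    (hΩne : Ω.Nonempty) {x₀ : Euc N} {r : ℝ} (hr : 0 < r)
    (hB : Metric.closedBall x₀ (4 * r) ⊆ Ω) {θ : ℝ} (hθ0 : 0 < θ) (hθ1 : θ < 1) :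
    ∃ s : ℝ, 1 < s ∧ ∃ L > 0, ∃ P ≥ (N : ℝ), ∀ (p : ℝ) (u : Euc N → ℝ), P ≤ p →
      IsLeastEnergySolution N H Ω p u →
      ∫ x in Metric.closedBall x₀ (4 * r), u x ^ (p + 1) ≤ θ ^ (p + 1) →
      ∫ x in Metric.closedBall x₀ (2 * r), (1 + u x ^ (p + 1 - N)) ^ s ≤ L := by
  have hN2 : (2 : ℝ) ≤ N := by exact_mod_cast hN
  have hN1 : 0 < (N : ℝ) - 1 := by linarith
  have hN0 : N ≠ 0 := by omega
  obtain ⟨C₁, hC₁, P₁, hP₁, hdec⟩ := exists_energy_decay hN hnorm hreg hΩo hΩb hΩne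
  obtain ⟨C₂, hC₂, hpow⟩ := exists_integral_rpow_le hnorm hreg hN hΩo hΩb hΩne
    (Q := N) (by linarith)
  obtain ⟨C, hC, hmos⟩ := exists_cutoff_rpow_le hN hnorm hreg hΩo hΩb
  obtain ⟨P₂, hP₂⟩ := exists_rpow_le_rpow_neg hθ0 hθ1 N
  obtain ⟨K, hK0, hK⟩ := exists_cutoff N
  obtain ⟨η, hη, hη0, hη1, hηa, hηb, hηg, hηK⟩ := hK x₀ (2 * r) (4 * r) (by positivity)
    (by linarith)
  obtain ⟨A, hA0, hA⟩ := hnorm.exists_le_norm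
  set G : ℝ := A * (K / (4 * r - 2 * r)) with hG
  have hG0 : 0 < G := by
    have : 0 < 4 * r - 2 * r := by linarith
    positivity
  set C₃ : ℝ := (C₁ ^ (1 / ((N : ℝ) - 1))) ^ (N : ℝ) with hC₃
  have hC₃0 : 0 < C₃ := by positivity
  set C₄ : ℝ := 1 + G ^ N * (C₂ * C₃) with hC₄
  have hC₄1 : 1 ≤ C₄ := by
    have : 0 ≤ G ^ N * (C₂ * C₃) := by positivity
    linarith
  set M : ℝ := C * (C * 2 * C₄ ^ (1 / (N : ℝ))) with hM
  have hM0 : 0 < M := by positivity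
  obtain ⟨t, ht, ht0, ht1⟩ : ∃ t : ℝ, θ ^ (1 - t) * M ^ (2 * t) ≤ 1 ∧ 0 < t ∧ t < 1 := by
    have h1 : Tendsto (fun t : ℝ => θ ^ (1 - t) * M ^ (2 * t)) (𝓝[>] 0)
        (𝓝 (θ ^ (1 - (0 : ℝ)) * M ^ (2 * (0 : ℝ)))) := by
      refine (ContinuousAt.tendsto ?_).mono_left nhdsWithin_le_nhds
      exact ((continuousAt_const_rpow hθ0.ne').comp (f := fun t : ℝ => 1 - t)
        (by fun_prop)).mul ((continuousAt_const_rpow hM0.ne').comp (f := fun t : ℝ => 2 * t)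
        (by fun_prop))
    rw [sub_zero, mul_zero, Real.rpow_one, Real.rpow_zero, mul_one] at h1
    obtain ⟨t, h2, h3⟩ := ((h1.eventually (ge_mem_nhds hθ1)).and
      (Ioo_mem_nhdsGT (zero_lt_one' ℝ))).exists
    exact ⟨t, h2, h3.1, h3.2⟩
  refine ⟨1 + t, by linarith, 2 ^ (1 + t) * (2 * volume.real Ω + 1),
    by have : 0 ≤ volume.real Ω := measureReal_nonneg
       positivity,
    max P₁ P₂, hP₁.trans (le_max_left _ _), fun p u hp hu hmass => ?_⟩
  have hp1 : P₁ ≤ p := (le_max_left _ _).trans hp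
  have hp2 : P₂ ≤ p := (le_max_right _ _).trans hp
  have hpN : (N : ℝ) ≤ p := by linarith
  have hp0 : 0 < p := by linarith
  have hB2 : Metric.closedBall x₀ (2 * r) ⊆ Metric.closedBall x₀ (4 * r) :=
    Metric.closedBall_subset_closedBall (by linarith)
  obtain ⟨-, -, -, -, hI⟩ := hdec p u hp1 hu
  have hpw := hpow p u (by linarith) hu
  have hI0 : 0 < ∫ x in Ω, u x ^ p := hu.integral_rpow_pos hΩo hΩb hΩne hp0.le
  set I : ℝ := ∫ x in Ω, u x ^ p with hIdef
  have hKc : IsCompact (Metric.closedBall x₀ (4 * r)) := isCompact_closedBall _ _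
  have hm := hmos p 1 (2 * p) u η _ hu le_rfl (by linarith) hη hη0 hKc hB hηb
  simp only [sub_self, mul_zero, add_zero, Real.rpow_one, one_pow, one_mul] at hm
  have hA' : ∫ x in Ω, η x ^ N * u x ^ (p + 1) ≤ p ^ (-(N : ℝ)) := by
    calc _ ≤ ∫ x in Ω, (Metric.closedBall x₀ (4 * r)).indicator (fun x => u x ^ (p + 1)) x := by
          refine integral_mono_of_nonneg ?_ ((hu.integrableOn_rpow hΩo hΩb
            (by linarith)).indicator measurableSet_closedBall) ?_
          · filter_upwards [ae_restrict_mem hΩo.measurableSet] with x hx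
            exact mul_nonneg (pow_nonneg (hη0 x) _) (Real.rpow_nonneg (hu.2.1 x hx).le _)
          · filter_upwards [ae_restrict_mem hΩo.measurableSet] with x hx
            by_cases hxB : x ∈ Metric.closedBall x₀ (4 * r)
            · rw [indicator_of_mem hxB]
              exact mul_le_of_le_one_left (Real.rpow_nonneg (hu.2.1 x hx).le _)
                (pow_le_one₀ (hη0 x) (hη1 x))
            · rw [indicator_of_notMem hxB, hηb x hxB, zero_pow hN0, zero_mul]
      _ = ∫ x in Metric.closedBall x₀ (4 * r), u x ^ (p + 1) := by
          rw [setIntegral_indicator measurableSet_closedBall, inter_eq_right.2 hB]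
      _ ≤ θ ^ (p + 1) := hmass
      _ ≤ θ ^ p := Real.rpow_le_rpow_of_exponent_ge hθ0 hθ1.le (by linarith)
      _ ≤ _ := hP₂ p hp2
  have hB' : ∫ x in Ω, (u x * H (gradient η x)) ^ N ≤
      G ^ N * (C₂ * C₃) * p ^ (-(N : ℝ)) := by
    have h1 : ∫ x in Ω, (u x * H (gradient η x)) ^ N ≤ ∫ x in Ω, G ^ N * u x ^ (N : ℝ) := by
      refine integral_mono_of_nonneg ?_ ((hu.integrableOn_rpow hΩo hΩb
        (by linarith)).const_mul _) ?_
      · filter_upwards [ae_restrict_mem hΩo.measurableSet] with x hx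
        exact pow_nonneg (mul_nonneg (hu.2.1 x hx).le (hnorm.nonneg _)) _
      · filter_upwards [ae_restrict_mem hΩo.measurableSet] with x hx
        rw [Real.rpow_natCast, ← mul_pow, mul_comm G]
        have hux := hu.2.1 x hx
        have : H (gradient η x) ≤ G :=
          (hA _).trans (mul_le_mul_of_nonneg_left (hηK x) hA0.le)
        exact pow_le_pow_left₀ (mul_nonneg hux.le (hnorm.nonneg _))
          (mul_le_mul_of_nonneg_left this hux.le) _
    rw [integral_const_mul] at h1
    refine h1.trans ?_
    rw [mul_assoc, mul_assoc]
    refine mul_le_mul_of_nonneg_left (hpw.trans (mul_le_mul_of_nonneg_left ?_ hC₂.le))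
      (by positivity)
    calc (I ^ (1 / ((N : ℝ) - 1))) ^ (N : ℝ)
        ≤ ((C₁ * p ^ (1 - (N : ℝ))) ^ (1 / ((N : ℝ) - 1))) ^ (N : ℝ) := by gcongr
      _ = C₃ * p ^ (-(N : ℝ)) := by
          rw [Real.mul_rpow (by positivity) (by positivity),
            Real.mul_rpow (by positivity) (by positivity), ← Real.rpow_mul hp0.le,
            ← Real.rpow_mul hp0.le]
          congr 2
          field_simp
          ring
  have hnn1 : 0 ≤ ∫ x in Ω, η x ^ N * u x ^ (p + 1) :=
    setIntegral_nonneg hΩo.measurableSet fun x hx =>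
      mul_nonneg (pow_nonneg (hη0 x) _) (Real.rpow_nonneg (hu.2.1 x hx).le _)
  have hnn2 : 0 ≤ ∫ x in Ω, (u x * H (gradient η x)) ^ N :=
    setIntegral_nonneg hΩo.measurableSet fun x hx =>
      pow_nonneg (mul_nonneg (hu.2.1 x hx).le (hnorm.nonneg _)) _
  have hup : ∫ x in Metric.closedBall x₀ (2 * r), u x ^ (2 * p) ≤ M ^ (2 * p) := by
    have hi : IntegrableOn (fun x => (η x * u x) ^ (2 * p)) Ω := by
      refine integrableOn_of_eq_zero_on_diff hΩo hKc hB ?_ fun x hx hxK => ?_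
      · exact (hη.continuous.continuousOn.mul hu.contDiffOn.continuousOn).rpow_const
          fun x hx => Or.inr (by linarith)
      · rw [hηb x hxK, zero_mul, Real.zero_rpow (by linarith)]
    calc _ = ∫ x in Metric.closedBall x₀ (2 * r), (η x * u x) ^ (2 * p) :=
          setIntegral_congr_fun measurableSet_closedBall fun x hx => by
            simp only [hηa x hx, one_mul]
      _ ≤ ∫ x in Ω, (η x * u x) ^ (2 * p) := by
          refine setIntegral_mono_set hi ?_ (hB2.trans hB).eventuallyLE
          filter_upwards [ae_restrict_mem hΩo.measurableSet] with x hx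
          exact Real.rpow_nonneg (mul_nonneg (hη0 x) (hu.2.1 x hx).le) _
      _ ≤ C * (C * (2 * p)) ^ (2 * p) * (C₄ * p ^ (-(N : ℝ))) ^ (2 * p / N) := by
          refine hm.trans (mul_le_mul_of_nonneg_left (Real.rpow_le_rpow (add_nonneg hnn1 hnn2) ?_
            (by positivity)) (by positivity))
          rw [hC₄, add_mul, one_mul]
          exact add_le_add hA' hB'
      _ = C * (C * 2 * C₄ ^ (1 / (N : ℝ))) ^ (2 * p) := by
          have h1 : (C₄ * p ^ (-(N : ℝ))) ^ (2 * p / N) = (C₄ ^ (1 / (N : ℝ)) * p⁻¹) ^ (2 * p) := by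
            have h2 : C₄ ^ (1 / (N : ℝ)) * p⁻¹ = (C₄ * p ^ (-(N : ℝ))) ^ (1 / (N : ℝ)) := by
              rw [Real.mul_rpow (by positivity) (by positivity), ← Real.rpow_mul hp0.le,
                ← Real.rpow_neg_one]
              congr 2
              field_simp
            rw [h2, ← Real.rpow_mul (by positivity)]
            congr 1
            ring
          rw [h1, mul_assoc, ← Real.mul_rpow (by positivity) (by positivity)]
          congr 2
          field_simp
      _ ≤ C ^ (2 * p) * (C * 2 * C₄ ^ (1 / (N : ℝ))) ^ (2 * p) := by
          refine mul_le_mul_of_nonneg_right ?_ (by positivity)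
          exact Real.self_le_rpow_of_one_le hC (by linarith)
      _ = _ := by rw [hM, Real.mul_rpow (x := C) (by positivity) (by positivity)]
  have hlow : ∫ x in Metric.closedBall x₀ (2 * r), u x ^ (p + 1) ≤ θ ^ p := by
    have hi := (hu.integrableOn_rpow hΩo hΩb (q := p + 1) (by linarith)).mono_set hB
    refine (setIntegral_mono_set hi ?_ hB2.eventuallyLE).trans (hmass.trans
      (Real.rpow_le_rpow_of_exponent_ge hθ0 hθ1.le (by linarith)))
    filter_upwards [ae_restrict_mem measurableSet_closedBall] with x hx
    exact Real.rpow_nonneg (hu.2.1 x (hB hx)).le _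
  have hintg : ∀ q : ℝ, 0 ≤ q →
      IntegrableOn (fun x => u x ^ q) (Metric.closedBall x₀ (2 * r)) := fun q hq =>
    (hu.integrableOn_rpow hΩo hΩb hq).mono_set (hB2.trans hB)
  have hinter := setIntegral_rpow_interpolation (f := u) (μ := volume) (a := p + 1) (b := 2 * p)
    (t := t) measurableSet_closedBall (fun x hx => hu.2.1 x (hB (hB2 hx))) ht0.le ht1.le
    (hintg _ (by linarith)) (hintg _ (by linarith)) (by positivity : 0 < θ ^ p)
    (by positivity : 0 < M ^ (2 * p)) hlow hup
  set e : ℝ := (1 - t) * (p + 1) + t * (2 * p) with he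
  have hbe : (p + 1 - N) * (1 + t) ≤ e := by rw [he]; nlinarith
  have hb0 : 0 ≤ (p + 1 - N) * (1 + t) := mul_nonneg (by linarith) (by linarith)
  have hie1 : ∫ x in Metric.closedBall x₀ (2 * r), u x ^ e ≤ 1 := by
    refine hinter.trans ?_
    calc (θ ^ p) ^ (1 - t) * (M ^ (2 * p)) ^ t = (θ ^ (1 - t) * M ^ (2 * t)) ^ p := by
          rw [Real.mul_rpow (x := θ ^ (1 - t)) (by positivity) (by positivity),
            ← Real.rpow_mul hθ0.le, ← Real.rpow_mul hθ0.le, ← Real.rpow_mul hM0.le, ← Real.rpow_mul hM0.le]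
          congr 2 <;> ring
      _ ≤ 1 := Real.rpow_le_one (by positivity) ht hp0.le
  have hfin : volume (Metric.closedBall x₀ (2 * r)) ≠ ⊤ := measure_closedBall_lt_top.ne
  have hc2 : Integrable (fun _ : Euc N => (2 : ℝ))
      (volume.restrict (Metric.closedBall x₀ (2 * r))) := integrableOn_const hfin
  have hvol : volume.real (Metric.closedBall x₀ (2 * r)) ≤ volume.real Ω :=
    measureReal_mono (hB2.trans hB) hΩb.measure_lt_top.ne
  calc _ ≤ ∫ x in Metric.closedBall x₀ (2 * r), 2 ^ (1 + t) * (2 + u x ^ e) := by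
        refine integral_mono_of_nonneg ?_ ((hc2.add (hintg e (hb0.trans hbe))).const_mul _) ?_
        · filter_upwards [ae_restrict_mem measurableSet_closedBall] with x hx
          have hux := hu.2.1 x (hB (hB2 hx))
          positivity
        · filter_upwards [ae_restrict_mem measurableSet_closedBall] with x hx
          have hux := hu.2.1 x (hB (hB2 hx))
          refine (one_add_rpow_le (by positivity) (by linarith)).trans
            (mul_le_mul_of_nonneg_left ?_ (by positivity))
          rw [← Real.rpow_mul hux.le]
          have := rpow_le_one_add_rpow hux hb0 hbe
          linarith
    _ = 2 ^ (1 + t) * (2 * volume.real (Metric.closedBall x₀ (2 * r)) +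
          ∫ x in Metric.closedBall x₀ (2 * r), u x ^ e) := by
        rw [integral_const_mul, integral_add hc2 (hintg e (hb0.trans hbe)),
          setIntegral_const, smul_eq_mul, mul_comm (2 : ℝ) (volume.real _)]
    _ ≤ _ := by
        refine mul_le_mul_of_nonneg_left ?_ (by positivity)
        linarith

end IsLeastEnergySolution

/-- Quadratic recursive inequalities grow at most like iterated squares. -/
lemma mul_le_pow_two_pow_of_recursion {F : ℕ → ℝ} {A B : ℝ} (hA : 0 < A) (hB : 0 < B)
    (hF : ∀ k, 0 ≤ F k) (h : ∀ k, F (k + 1) ≤ A * B ^ k * F k ^ 2) (k : ℕ) :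
    F k * (A * B ^ (k + 1)) ≤ (A * B * F 0) ^ 2 ^ k := by
  induction k with
  | zero => simp; linarith
  | succ k ih =>
    calc F (k + 1) * (A * B ^ (k + 1 + 1)) ≤ A * B ^ k * F k ^ 2 * (A * B ^ (k + 1 + 1)) :=
          mul_le_mul_of_nonneg_right (h k) (by positivity)
      _ = (F k * (A * B ^ (k + 1))) ^ 2 := by ring
      _ ≤ ((A * B * F 0) ^ 2 ^ k) ^ 2 :=
          pow_le_pow_left₀ (mul_nonneg (hF k) (by positivity)) ih 2
      _ = _ := by rw [← pow_mul, pow_succ]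

/-- Geometric control of the integrals of `2 ^ k`-th powers yields a pointwise bound. -/
lemma le_of_setIntegral_pow_two_pow_le {N : ℕ} {f : Euc N → ℝ} {V : Set (Euc N)} (hV : IsOpen V)
    (hVb : volume V ≠ ⊤) (hf : ContinuousOn f V) (hf0 : ∀ x ∈ V, 0 ≤ f x) {c D : ℝ} (hD : 0 ≤ D)
    (hi : ∀ k : ℕ, IntegrableOn (fun x => f x ^ 2 ^ k) V)
    (h : ∀ k : ℕ, ∫ x in V, f x ^ 2 ^ k ≤ c * D ^ 2 ^ k) {x : Euc N} (hx : x ∈ V) : f x ≤ D := by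
  by_contra! hlt
  obtain ⟨D', hD1, hD2⟩ := exists_between hlt
  have hD'0 : 0 < D' := hD.trans_lt hD1
  set W : Set (Euc N) := V ∩ f ⁻¹' Ioi D' with hW
  have hWo : IsOpen W := hf.isOpen_inter_preimage hV isOpen_Ioi
  have hWV : W ⊆ V := inter_subset_left
  have hWfin : volume W ≠ ⊤ := measure_ne_top_of_subset hWV hVb
  have hm : 0 < volume.real W :=
    ENNReal.toReal_pos (hWo.measure_pos volume ⟨x, hx, hD2⟩).ne' hWfin
  have hk : ∀ k : ℕ, volume.real W ≤ c * (D / D') ^ 2 ^ k := fun k => by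
    have h1 : volume.real W * D' ^ 2 ^ k ≤ ∫ x in V, f x ^ 2 ^ k := by
      calc _ = ∫ _ in W, D' ^ 2 ^ k := by rw [setIntegral_const, smul_eq_mul]
        _ ≤ ∫ x in W, f x ^ 2 ^ k :=
            setIntegral_mono_on (integrableOn_const hWfin) ((hi k).mono_set hWV)
              hWo.measurableSet fun y hy => pow_le_pow_left₀ hD'0.le (le_of_lt hy.2) _
        _ ≤ _ := by
            refine setIntegral_mono_set (hi k) ?_ hWV.eventuallyLE
            filter_upwards [ae_restrict_mem hV.measurableSet] with y hy
            exact pow_nonneg (hf0 y hy) _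
    rw [div_pow, ← mul_div_assoc, le_div_iff₀ (by positivity)]
    exact h1.trans (h k)
  have hlim : Tendsto (fun k : ℕ => c * (D / D') ^ 2 ^ k) atTop (𝓝 (c * 0)) :=
    ((tendsto_pow_atTop_nhds_zero_of_lt_one (by positivity)
      ((div_lt_one hD'0).2 hD1)).comp (tendsto_pow_atTop_atTop_of_one_lt (by norm_num : (1 : ℕ) < 2))).const_mul c
  have := ge_of_tendsto' hlim hk
  rw [mul_zero] at this
  linarith

lemma memLp_of_continuousOn_isCompact {N : ℕ} {f : Euc N → ℝ} {K : Set (Euc N)}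
    (hK : IsCompact K) (hf : ContinuousOn f K) (q : ENNReal) : MemLp f q (volume.restrict K) := by
  obtain ⟨C, hC⟩ := hK.exists_bound_of_continuousOn hf
  have : IsFiniteMeasure (volume.restrict K) := ⟨by simpa using hK.measure_lt_top⟩
  refine MemLp.of_bound (hf.aestronglyMeasurable hK.measurableSet) C ?_
  filter_upwards [ae_restrict_mem hK.measurableSet] with x hx using hC x hx

namespace IsLeastEnergySolution

variable {N : ℕ} {H : Euc N → ℝ} {Ω : Set (Euc N)}

/-- Local boundedness by Moser iteration. -/
lemma exists_rpow_le_of_integral_le (hN : 2 ≤ N) (hnorm : IsFinslerNorm N H)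
    (hreg : FinslerRegular N H) (hΩo : IsOpen Ω) (hΩb : Bornology.IsBounded Ω)
    {x₀ : Euc N} {r : ℝ} (hr : 0 < r)
    (hB : Metric.closedBall x₀ (2 * r) ⊆ Ω) {s L : ℝ} (hs : 1 < s) (hL : 0 < L) :
    ∃ Q ≥ (1 : ℝ), ∃ D > 0, ∀ (p : ℝ) (u : Euc N → ℝ), (N : ℝ) ≤ p →
      IsLeastEnergySolution N H Ω p u →
      ∫ x in Metric.closedBall x₀ (2 * r), (1 + u x ^ (p + 1 - N)) ^ s ≤ L →
      ∀ x ∈ Metric.ball x₀ r, u x ^ Q ≤ D * ∫ x in Ω, u x ^ Q := by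
  have hN2 : (2 : ℝ) ≤ N := by exact_mod_cast hN
  have hN0 : N ≠ 0 := by omega
  obtain ⟨C, hC, hmos⟩ := exists_cutoff_rpow_le hN hnorm hreg hΩo hΩb
  obtain ⟨K, hK0, hK⟩ := exists_cutoff N
  obtain ⟨A, hA0, hA⟩ := hnorm.exists_le_norm
  set s' : ℝ := s / (s - 1) with hs'
  have hconj : s.HolderConjugate s' := Real.HolderConjugate.conjExponent hs
  have hs'1 : 1 < s' := hconj.symm.lt
  set Q : ℝ := N * s' with hQ
  have hQ1 : 2 < Q := by rw [hQ]; nlinarith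
  set T : ℝ := max 1 (A * (2 * K / r)) with hT
  have hT1 : 1 ≤ T := le_max_left _ _
  set A₀ : ℝ := C * (C * (2 * Q)) ^ (2 * Q) * (T ^ (2 * Q) * (L ^ (1 / s)) ^ (2 * s')) with hA₀
  set B₀ : ℝ := 4 ^ (2 * Q) with hB₀
  have hA₀0 : 0 < A₀ := by positivity
  have hB₀0 : 0 < B₀ := by positivity
  have hB₀1 : 1 ≤ B₀ := Real.one_le_rpow (by norm_num) (by linarith)
  refine ⟨Q, by linarith, A₀ * B₀, by positivity, fun p u hp hu hLu x hx => ?_⟩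
  set R : ℕ → ℝ := fun k => r * (1 + (1 / 2) ^ k) with hR
  have hRr : ∀ k, r ≤ R k := fun k => le_mul_of_one_le_right hr.le
    (le_add_of_nonneg_right (by positivity))
  have hR2 : ∀ k, R k ≤ 2 * r := fun k => by
    have : ((1 : ℝ) / 2) ^ k ≤ 1 := pow_le_one₀ (by norm_num) (by norm_num)
    simp only [hR]; nlinarith
  have hRd : ∀ k, R k - R (k + 1) = r * (1 / 2) ^ (k + 1) := fun k => by
    simp only [hR]; ring
  have hsub2 : ∀ k, Metric.closedBall x₀ (R k) ⊆ Metric.closedBall x₀ (2 * r) := fun k =>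
    Metric.closedBall_subset_closedBall (hR2 k)
  have hsub : ∀ k, Metric.closedBall x₀ (R k) ⊆ Ω := fun k => (hsub2 k).trans hB
  set F : ℕ → ℝ := fun k => ∫ x in Metric.closedBall x₀ (R k), u x ^ (Q * 2 ^ k) with hF
  have hF0 : ∀ k, 0 ≤ F k := fun k => setIntegral_nonneg measurableSet_closedBall fun y hy =>
    Real.rpow_nonneg (hu.2.1 y (hsub k hy)).le _
  have hcont : ∀ (k : ℕ) (q : ℝ),
      ContinuousOn (fun x => u x ^ q) (Metric.closedBall x₀ (R k)) :=
    fun k q => (hu.continuousOn_rpow q).mono (hsub k)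
  have hstep : ∀ k, F (k + 1) ≤ A₀ * B₀ ^ k * F k ^ 2 := fun k => by
    have hpos : 0 < R k - R (k + 1) := by rw [hRd]; positivity
    obtain ⟨η, hη, hη0, hη1, hηa, hηb, hηg, hηK⟩ := hK x₀ (R (k + 1)) (R k)
      (hr.le.trans (hRr _)) (by linarith)
    have hBk : IsCompact (Metric.closedBall x₀ (R k)) := isCompact_closedBall _ _
    set g : ℝ := 2 ^ k with hg
    have hg1 : 1 ≤ g := one_le_pow₀ one_le_two
    have hTg : 1 ≤ T * g := one_le_mul_of_one_le_of_one_le hT1 hg1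
    have hHη : ∀ y, H (gradient η y) ≤ T * g := fun y => by
      calc H (gradient η y) ≤ A * (K / (R k - R (k + 1))) :=
            (hA _).trans (mul_le_mul_of_nonneg_left (hηK y) hA0.le)
        _ = A * (2 * K / r) * g := by
            rw [hRd, hg, one_div, inv_pow, pow_succ]; field_simp
        _ ≤ T * g := mul_le_mul_of_nonneg_right (le_max_right _ _) (by positivity)
    have hm := hmos p g (2 * Q) u η _ hu hg1 (by linarith) hη hη0 hBk (hsub k) hηb
    set W : Euc N → ℝ := fun y => (1 + u y ^ (p + 1 - N)) * u y ^ (N * g) with hW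
    have hcW : ContinuousOn (fun y => 1 + u y ^ (p + 1 - N)) (Metric.closedBall x₀ (R k)) :=
      continuousOn_const.add (hcont k _)
    have hiW : IntegrableOn W (Metric.closedBall x₀ (R k)) :=
      (hcW.mul (hcont k _)).integrableOn_compact hBk
    have hi1 : IntegrableOn (fun y => η y ^ N * u y ^ (p + N * (g - 1) + 1)) Ω := by
      refine integrableOn_of_eq_zero_on_diff hΩo hBk (hsub k)
        ((hη.continuous.pow N).continuousOn.mul (hu.continuousOn_rpow _)) fun y hy hyK => ?_
      rw [hηb y hyK, zero_pow hN0, zero_mul]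
    have hi2 : IntegrableOn (fun y => (u y ^ g * H (gradient η y)) ^ N) Ω := by
      refine integrableOn_of_eq_zero_on_diff hΩo hBk (hsub k) (((hu.continuousOn_rpow g).mul
        (hnorm.continuous.comp (continuous_gradient hη)).continuousOn).pow N) fun y hy hyK => ?_
      rw [hηg y hyK, hnorm.map_zero, mul_zero, zero_pow hN0]
    have hAB : (∫ y in Ω, η y ^ N * u y ^ (p + N * (g - 1) + 1)) +
        (∫ y in Ω, (u y ^ g * H (gradient η y)) ^ N) ≤
        (T * g) ^ N * ∫ y in Metric.closedBall x₀ (R k), W y := by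
      rw [← integral_add hi1 hi2, ← integral_const_mul, ← inter_eq_right.2 (hsub k),
        ← setIntegral_indicator measurableSet_closedBall]
      refine setIntegral_mono_on (hi1.add hi2) ?_ hΩo.measurableSet fun y hy => ?_
      · exact ((integrable_indicator_iff measurableSet_closedBall).2
          (hiW.const_mul _)).integrableOn
      by_cases hyB : y ∈ Metric.closedBall x₀ (R k)
      · have huy := hu.2.1 y hy
        have e1 : u y ^ (p + N * (g - 1) + 1) = u y ^ (p + 1 - N) * u y ^ (N * g) := by
          rw [← Real.rpow_add huy]; congr 1; ring
        have e2 : (u y ^ g) ^ N = u y ^ (N * g) := by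
          rw [← Real.rpow_natCast, ← Real.rpow_mul huy.le, mul_comm]
        have h1 : η y ^ N ≤ (T * g) ^ N :=
          pow_le_pow_left₀ (hη0 y) ((hη1 y).trans hTg) N
        have h2 : H (gradient η y) ^ N ≤ (T * g) ^ N :=
          pow_le_pow_left₀ (hnorm.nonneg _) (hHη y) N
        rw [indicator_of_mem hyB, mul_pow, e1, e2, hW]
        have h3 : 0 ≤ u y ^ (p + 1 - N) * u y ^ (N * g) := by positivity
        have h4 : 0 ≤ u y ^ (N * g) := by positivity
        nlinarith [mul_le_mul_of_nonneg_right h1 h3, mul_le_mul_of_nonneg_left h2 h4]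
      · rw [indicator_of_notMem hyB, hηb y hyB, hηg y hyB, hnorm.map_zero, mul_zero,
          zero_pow hN0, zero_mul, add_zero]
    have hhol : ∫ y in Metric.closedBall x₀ (R k), W y ≤ L ^ (1 / s) * F k ^ (1 / s') := by
      refine (integral_mul_le_Lp_mul_Lq_of_nonneg hconj ?_ ?_
        (memLp_of_continuousOn_isCompact hBk hcW _)
        (memLp_of_continuousOn_isCompact hBk (hcont k _) _)).trans ?_
      · filter_upwards [ae_restrict_mem measurableSet_closedBall] with y hy
        have := Real.rpow_pos_of_pos (hu.2.1 y (hsub k hy)) (p + 1 - N)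
        exact (by linarith : (0 : ℝ) ≤ 1 + u y ^ (p + 1 - N))
      · filter_upwards [ae_restrict_mem measurableSet_closedBall] with y hy
        exact Real.rpow_nonneg (hu.2.1 y (hsub k hy)).le _
      · have hVp : ∀ y ∈ Metric.closedBall x₀ (2 * r), 0 ≤ (1 + u y ^ (p + 1 - N)) ^ s :=
          fun y hy => by
            have := Real.rpow_pos_of_pos (hu.2.1 y (hB hy)) (p + 1 - N)
            exact Real.rpow_nonneg (by linarith) _
        have h1 : ∫ y in Metric.closedBall x₀ (R k), (1 + u y ^ (p + 1 - N)) ^ s ≤ L := by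
          refine (setIntegral_mono_set ?_ ?_ (hsub2 k).eventuallyLE).trans hLu
          · refine ContinuousOn.integrableOn_compact (isCompact_closedBall _ _) ?_
            exact ContinuousOn.rpow_const
              (continuousOn_const.add ((hu.continuousOn_rpow _).mono hB))
              fun y hy => Or.inr (by linarith)
          · filter_upwards [ae_restrict_mem measurableSet_closedBall] with y hy using hVp y hy
        have h2 : ∫ y in Metric.closedBall x₀ (R k), (u y ^ (N * g)) ^ s' = F k := by
          refine setIntegral_congr_fun measurableSet_closedBall fun y hy => ?_
          rw [← Real.rpow_mul (hu.2.1 y (hsub k hy)).le, hQ]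
          congr 1; ring
        rw [h2]
        refine mul_le_mul_of_nonneg_right (Real.rpow_le_rpow ?_ h1 (by positivity))
          (Real.rpow_nonneg (hF0 k) _)
        exact setIntegral_nonneg measurableSet_closedBall fun y hy => hVp y (hsub2 k hy)
    have hle : F (k + 1) ≤ ∫ y in Ω, (η y * u y ^ g) ^ (2 * Q) := by
      have hi : IntegrableOn (fun y => (η y * u y ^ g) ^ (2 * Q)) Ω := by
        refine integrableOn_of_eq_zero_on_diff hΩo hBk (hsub k) ?_ fun y hy hyK => ?_
        · exact (hη.continuous.continuousOn.mul (hu.continuousOn_rpow g)).rpow_const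
            fun y hy => Or.inr (by linarith)
        · rw [hηb y hyK, zero_mul, Real.zero_rpow (by linarith)]
      calc F (k + 1) = ∫ y in Metric.closedBall x₀ (R (k + 1)), (η y * u y ^ g) ^ (2 * Q) :=
            setIntegral_congr_fun measurableSet_closedBall fun y hy => by
              simp only [hηa y hy, one_mul]
              rw [← Real.rpow_mul (hu.2.1 y (hsub _ hy)).le, hg, pow_succ]
              congr 1; ring
        _ ≤ _ := by
            refine setIntegral_mono_set hi ?_ (hsub _).eventuallyLE
            filter_upwards [ae_restrict_mem hΩo.measurableSet] with y hy
            exact Real.rpow_nonneg (mul_nonneg (hη0 y) (Real.rpow_nonneg (hu.2.1 y hy).le _)) _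
    have hFk := hF0 k
    have hnn : 0 ≤ (∫ y in Ω, η y ^ N * u y ^ (p + N * (g - 1) + 1)) +
        (∫ y in Ω, (u y ^ g * H (gradient η y)) ^ N) := by
      refine add_nonneg ?_ ?_
      · exact setIntegral_nonneg hΩo.measurableSet fun y hy =>
          mul_nonneg (pow_nonneg (hη0 y) _) (Real.rpow_nonneg (hu.2.1 y hy).le _)
      · exact setIntegral_nonneg hΩo.measurableSet fun y hy =>
          pow_nonneg (mul_nonneg (Real.rpow_nonneg (hu.2.1 y hy).le _) (hnorm.nonneg _)) _
    have hQN : 2 * Q / N = 2 * s' := by rw [hQ]; field_simp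
    rw [hQN] at hm
    calc F (k + 1) ≤ C * (C * (2 * Q)) ^ (2 * Q) *
          (g ^ N * ((T * g) ^ N * (L ^ (1 / s) * F k ^ (1 / s')))) ^ (2 * s') := by
          refine (hle.trans hm).trans (mul_le_mul_of_nonneg_left (Real.rpow_le_rpow
            (mul_nonneg (by positivity) hnn) (mul_le_mul_of_nonneg_left (hAB.trans
              (mul_le_mul_of_nonneg_left hhol (by positivity))) (by positivity))
            (by positivity)) (by positivity))
      _ = A₀ * B₀ ^ k * F k ^ 2 := by
          have e1 : g ^ N * ((T * g) ^ N * (L ^ (1 / s) * F k ^ (1 / s'))) =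
              (T * 4 ^ k) ^ (N : ℝ) * (L ^ (1 / s) * F k ^ (1 / s')) := by
            rw [Real.rpow_natCast, hg, show (4 : ℝ) = 2 * 2 by norm_num, mul_pow, mul_pow,
              mul_pow, mul_pow]
            ring
          have e2 : (F k ^ (1 / s')) ^ (2 * s') = F k ^ 2 := by
            rw [← Real.rpow_mul hFk, ← Real.rpow_natCast]
            congr 1
            field_simp
            norm_num
          have e3 : ((T * 4 ^ k) ^ (N : ℝ)) ^ (2 * s') = T ^ (2 * Q) * B₀ ^ k := by
            rw [← Real.rpow_mul (by positivity), Real.mul_rpow (by positivity) (by positivity),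
              hB₀, ← Real.rpow_natCast, ← Real.rpow_natCast, ← Real.rpow_mul (by norm_num),
              ← Real.rpow_mul (by norm_num), hQ]
            congr 2 <;> ring
          have e4 : ((T * 4 ^ k) ^ (N : ℝ) * (L ^ (1 / s) * F k ^ (1 / s'))) ^ (2 * s') =
              T ^ (2 * Q) * B₀ ^ k * ((L ^ (1 / s)) ^ (2 * s') * F k ^ 2) := by
            rw [Real.mul_rpow (by positivity) (by positivity), e3,
              Real.mul_rpow (x := L ^ (1 / s)) (by positivity) (by positivity), e2]
          rw [e1, e4, hA₀]
          ring
  have hrec := mul_le_pow_two_pow_of_recursion hA₀0 hB₀0 hF0 hstep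
  have hbr : Metric.ball x₀ r ⊆ Ω := fun y hy =>
    hsub 0 (Metric.closedBall_subset_closedBall (hRr 0) (Metric.ball_subset_closedBall hy))
  have hpoweq : ∀ k : ℕ, ∀ y ∈ Ω, (u y ^ Q) ^ 2 ^ k = u y ^ (Q * 2 ^ k) := fun k y hy => by
    rw [← Real.rpow_natCast, ← Real.rpow_mul (hu.2.1 y hy).le]
    push_cast
    rfl
  have hpi : ∀ k : ℕ, IntegrableOn (fun y => u y ^ (Q * 2 ^ k)) Ω := fun k =>
    hu.integrableOn_rpow hΩo hΩb (by positivity)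
  have hsup := le_of_setIntegral_pow_two_pow_le (f := fun y => u y ^ Q) (V := Metric.ball x₀ r)
    (c := 1 / A₀) (D := A₀ * B₀ * F 0)
    Metric.isOpen_ball measure_ball_lt_top.ne ((hu.continuousOn_rpow Q).mono hbr)
    (fun y hy => Real.rpow_nonneg (hu.2.1 y (hbr hy)).le _)
    (mul_nonneg (by positivity) (hF0 0))
    (fun k => ((hpi k).mono_set hbr).congr_fun (fun y hy => (hpoweq k y (hbr hy)).symm)
      measurableSet_ball) (fun k => ?_) hx
  · refine hsup.trans (mul_le_mul_of_nonneg_left ?_ (by positivity))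
    have hF0e : F 0 = ∫ y in Metric.closedBall x₀ (R 0), u y ^ Q := by simp [hF]
    rw [hF0e]
    refine setIntegral_mono_set (hu.integrableOn_rpow hΩo hΩb (by linarith)) ?_
      (hsub 0).eventuallyLE
    filter_upwards [ae_restrict_mem hΩo.measurableSet] with y hy
    exact Real.rpow_nonneg (hu.2.1 y hy).le _
  · calc ∫ y in Metric.ball x₀ r, (u y ^ Q) ^ 2 ^ k
        = ∫ y in Metric.ball x₀ r, u y ^ (Q * 2 ^ k) :=
          setIntegral_congr_fun measurableSet_ball fun y hy => hpoweq k y (hbr hy)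
      _ ≤ F k := by
          refine setIntegral_mono_set ((hpi k).mono_set (hsub k)) ?_
            (Metric.ball_subset_closedBall.trans
              (Metric.closedBall_subset_closedBall (hRr k))).eventuallyLE
          filter_upwards [ae_restrict_mem measurableSet_closedBall] with y hy
          exact Real.rpow_nonneg (hu.2.1 y (hsub k hy)).le _
      _ ≤ 1 / A₀ * (A₀ * B₀ * F 0) ^ 2 ^ k := by
          rw [one_div_mul_eq_div, le_div_iff₀ hA₀0]
          refine le_trans (mul_le_mul_of_nonneg_left ?_ (hF0 k)) (hrec k)
          exact le_mul_of_one_le_right hA₀0.le (one_le_pow₀ hB₀1)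

end IsLeastEnergySolution

namespace IsLeastEnergySolution

variable {N : ℕ} {H : Euc N → ℝ} {Ω : Set (Euc N)}

/-- Small local mass forces the normalized solutions to be locally bounded. -/
lemma exists_div_le_of_mass_le (hN : 2 ≤ N) (hnorm : IsFinslerNorm N H)
    (hreg : FinslerRegular N H) (hΩo : IsOpen Ω) (hΩb : Bornology.IsBounded Ω)
    (hΩne : Ω.Nonempty) {x₀ : Euc N} {r : ℝ} (hr : 0 < r)
    (hB : Metric.closedBall x₀ (4 * r) ⊆ Ω) {θ : ℝ} (hθ0 : 0 < θ) (hθ1 : θ < 1) :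
    ∃ M : ℝ, ∃ P ≥ (N : ℝ), ∀ (p : ℝ) (u : Euc N → ℝ), P ≤ p →
      IsLeastEnergySolution N H Ω p u →
      ∫ x in Metric.closedBall x₀ (4 * r), u x ^ (p + 1) ≤ θ ^ (p + 1) →
      ∀ x ∈ Metric.ball x₀ r, u x / (∫ y in Ω, u y ^ p) ^ (1 / ((N : ℝ) - 1)) ≤ M := by
  have hN2 : (2 : ℝ) ≤ N := by exact_mod_cast hN
  obtain ⟨s, hs, L, hL, P, hP, hintg⟩ :=
    exists_integral_one_add_rpow_le hN hnorm hreg hΩo hΩb hΩne hr hB hθ0 hθ1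
  obtain ⟨Q, hQ, D, hD, hsup⟩ := exists_rpow_le_of_integral_le hN hnorm hreg hΩo hΩb hr
    ((Metric.closedBall_subset_closedBall (by linarith)).trans hB) hs hL
  obtain ⟨C, hC, hmass⟩ := exists_integral_rpow_le hnorm hreg hN hΩo hΩb hΩne hQ
  refine ⟨(D * C) ^ (1 / Q), P, hP, fun p u hp hu hm x hx => ?_⟩
  have hpN : (N : ℝ) ≤ p := hP.le.trans hp
  have hxΩ : x ∈ Ω := hB (Metric.closedBall_subset_closedBall (by linarith)
    (Metric.ball_subset_closedBall hx))
  have hux := hu.2.1 x hxΩ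
  set c : ℝ := (∫ y in Ω, u y ^ p) ^ (1 / ((N : ℝ) - 1)) with hc
  have hc0 : 0 < c := Real.rpow_pos_of_pos
    (hu.integral_rpow_pos hΩo hΩb hΩne (by linarith)) _
  have hQ0 : 0 < Q := by linarith
  have h1 : u x ^ Q ≤ D * C * c ^ Q := by
    rw [mul_assoc]
    exact (hsup p u hpN hu (hintg p u hp hu hm) x hx).trans
      (mul_le_mul_of_nonneg_left (hmass p u (by linarith) hu) hD.le)
  have h2 : (u x / c) ^ Q ≤ D * C := by
    rw [Real.div_rpow hux.le hc0.le, div_le_iff₀ (by positivity)]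
    exact h1
  calc u x / c = ((u x / c) ^ Q) ^ (1 / Q) := by
        rw [← Real.rpow_mul (by positivity), mul_one_div_cancel hQ0.ne', Real.rpow_one]
    _ ≤ _ := Real.rpow_le_rpow (by positivity) h2 (by positivity)

/-- The normalized solutions cannot be unbounded near two distinct interior points. -/
lemma exists_div_le_or (hN : 2 ≤ N) (hnorm : IsFinslerNorm N H)
    (hreg : FinslerRegular N H) (hΩo : IsOpen Ω) (hΩb : Bornology.IsBounded Ω)
    {x₁ x₂ : Euc N} (hx₁ : x₁ ∈ Ω) (hx₂ : x₂ ∈ Ω) (hne : x₁ ≠ x₂) :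
    ∃ r > 0, ∃ M P : ℝ, ∀ (p : ℝ) (u : Euc N → ℝ), P ≤ p →
      IsLeastEnergySolution N H Ω p u →
      (∀ x ∈ Metric.ball x₁ r, u x / (∫ y in Ω, u y ^ p) ^ (1 / ((N : ℝ) - 1)) ≤ M) ∨
      (∀ x ∈ Metric.ball x₂ r, u x / (∫ y in Ω, u y ^ p) ^ (1 / ((N : ℝ) - 1)) ≤ M) := by
  have hN0 : 0 < (N : ℝ) := by exact_mod_cast (by omega : 0 < N)
  obtain ⟨ε₁, hε₁, hB₁⟩ := Metric.isOpen_iff.1 hΩo x₁ hx₁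
  obtain ⟨ε₂, hε₂, hB₂⟩ := Metric.isOpen_iff.1 hΩo x₂ hx₂
  have hd : 0 < dist x₁ x₂ := dist_pos.2 hne
  set r : ℝ := min (min ε₁ ε₂) (dist x₁ x₂) / 20 with hr
  have hm : 0 < min (min ε₁ ε₂) (dist x₁ x₂) := lt_min (lt_min hε₁ hε₂) hd
  have hr0 : 0 < r := by positivity
  have h20 : 20 * r = min (min ε₁ ε₂) (dist x₁ x₂) := by rw [hr]; ring
  have h1 : 20 * r ≤ ε₁ := h20.le.trans ((min_le_left _ _).trans (min_le_left _ _))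
  have h2 : 20 * r ≤ ε₂ := h20.le.trans ((min_le_left _ _).trans (min_le_right _ _))
  have h3 : 20 * r ≤ dist x₁ x₂ := h20.le.trans (min_le_right _ _)
  have hc₁ : Metric.closedBall x₁ (8 * r) ⊆ Ω :=
    (Metric.closedBall_subset_ball (by linarith)).trans hB₁
  have hc₂ : Metric.closedBall x₂ (8 * r) ⊆ Ω :=
    (Metric.closedBall_subset_ball (by linarith)).trans hB₂
  obtain ⟨P, -, hP⟩ := exists_mass_le_or hN hnorm hreg hΩo hΩb ⟨x₁, hx₁⟩ hr0 hc₁ hc₂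
    (Metric.closedBall_disjoint_closedBall (by linarith))
  have hθ0 : 0 < ((3 : ℝ) / 4) ^ (1 / (N : ℝ)) := by positivity
  have hθ1 : ((3 : ℝ) / 4) ^ (1 / (N : ℝ)) < 1 :=
    Real.rpow_lt_one (by norm_num) (by norm_num) (by positivity)
  have h48 : ∀ x : Euc N, Metric.closedBall x (4 * r) ⊆ Metric.closedBall x (8 * r) := fun x =>
    Metric.closedBall_subset_closedBall (by linarith)
  obtain ⟨M₁, P₁, -, hM₁⟩ := exists_div_le_of_mass_le hN hnorm hreg hΩo hΩb ⟨x₁, hx₁⟩ hr0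
    ((h48 x₁).trans hc₁) hθ0 hθ1
  obtain ⟨M₂, P₂, -, hM₂⟩ := exists_div_le_of_mass_le hN hnorm hreg hΩo hΩb ⟨x₁, hx₁⟩ hr0
    ((h48 x₂).trans hc₂) hθ0 hθ1
  refine ⟨r, hr0, max M₁ M₂, max P (max P₁ P₂), fun p u hp hu => ?_⟩
  obtain ⟨hp0, hp12⟩ := max_le_iff.1 hp
  obtain ⟨hp1, hp2⟩ := max_le_iff.1 hp12
  rcases hP p u hp0 hu with h | h
  · exact Or.inl fun x hx => (hM₁ p u hp1 hu h x hx).trans (le_max_left _ _)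
  · exact Or.inr fun x hx => (hM₂ p u hp2 hu h x hx).trans (le_max_right _ _)

end IsLeastEnergySolution

/-- Estimate on the number of interior blow-up points, along a subsequence
(Theorem 1.3, second assertion). -/
theorem blowup_set_card (N : ℕ) (hN : 2 ≤ N) (H : Euc N → ℝ)
    (hnorm : IsFinslerNorm N H) (hreg : FinslerRegular N H)
    (Ω : Set (Euc N)) (hΩo : IsOpen Ω) (hΩb : Bornology.IsBounded Ω) (hΩne : Ω.Nonempty)
    (p : ℕ → ℝ) (hp : ∀ n, 1 < p n) (hptop : Tendsto p atTop atTop)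
    (u : ℕ → Euc N → ℝ) (hu : ∀ n, IsLeastEnergySolution N H Ω (p n) (u n))
    (v : ℕ → Euc N → ℝ)
    (hv : ∀ n x, v n x = u n x / (∫ y in Ω, u n y ^ p n) ^ (1 / ((N : ℝ) - 1))) :
    ∃ σ : ℕ → ℕ, StrictMono σ ∧
      (BlowUpSet Ω (fun n => v (σ n)) ∩ Ω).Finite ∧
      (BlowUpSet Ω (fun n => v (σ n)) ∩ Ω).ncard
        ≤ Nat.floor (Real.exp (((N : ℝ) - 1) / N) / dConst N H) := by
  by_cases hS : BlowUpSet Ω v ∩ Ω = ∅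
  · refine ⟨id, strictMono_id, ?_⟩
    simp [hS]
  obtain ⟨x₁, ⟨-, σ, hσ, xs, hxsΩ, hxs, hxsv⟩, hx₁⟩ := nonempty_iff_ne_empty.2 hS
  have hsub : BlowUpSet Ω (fun n => v (σ n)) ∩ Ω ⊆ {x₁} := by
    rintro x₂ ⟨⟨-, σ', hσ', ys, -, hys, hysv⟩, hx₂⟩
    by_contra hne
    obtain ⟨r, hr, M, P, hMP⟩ := IsLeastEnergySolution.exists_div_le_or hN hnorm hreg hΩo hΩb
      hx₁ hx₂ (Ne.symm hne)
    have h1 := (hxs.comp hσ'.tendsto_atTop).eventually (Metric.ball_mem_nhds x₁ hr)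
    have h2 := hys.eventually (Metric.ball_mem_nhds x₂ hr)
    have h3 := (hxsv.comp hσ'.tendsto_atTop).eventually (eventually_gt_atTop M)
    have h4 := hysv.eventually (eventually_gt_atTop M)
    have h5 := (hptop.comp (hσ.comp hσ').tendsto_atTop).eventually (eventually_ge_atTop P)
    obtain ⟨n, hn1, hn2, hn3, hn4, hn5⟩ := (h1.and (h2.and (h3.and (h4.and h5)))).exists
    simp only [Function.comp_apply, hv] at hn1 hn3 hn4 hn5
    rcases hMP _ _ hn5 (hu _) with h | h
    · exact (h _ hn1).not_gt hn3
    · exact (h _ hn2).not_gt hn4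
  refine ⟨σ, hσ, (finite_singleton x₁).subset hsub, ?_⟩
  calc _ ≤ ({x₁} : Set (Euc N)).ncard := ncard_le_ncard hsub
    _ = 1 := ncard_singleton x₁
    _ ≤ _ := one_le_floor_exp_div_dConst hN hnorm hreg
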